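/- There is an absolute constant c > 0 such that for every number field K of degree n_K with absolute discriminant D_K, and every T ≥ 2, the number of nontrivial zeros ρ = β + iγ of ζ_K (0 < β < 1, counted with multiplicity) with T ≤ |γ| ≤ T + 1 is at most c·(log D_K + n_K log T). -/

import Mathlib

noncomputable section

open NumberField Filter Topology MeasureTheory Complex

open scoped Classical

/-- The Möbius function on integral ideals of a number field `K`. -/
def moebiusK (K : Type) [Field K] [NumberField K] (I : Ideal (𝓞 K)) : ℤ :=
  if Squarefree I then (-1) ^ (UniqueFactorizationMonoid.factors I).card else 0

/-- The Mertens function of a number field `K`: the sum of `μ_K(𝔞)` over nonzero integral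
ideals `𝔞` of norm at most `x`, where ideals of norm exactly `x` count with weight `1/2`. -/
def mertensK (K : Type) [Field K] [NumberField K] (x : ℝ) : ℝ :=
  ∑' I : Ideal (𝓞 K),
    if I ≠ ⊥ ∧ (Ideal.absNorm I : ℝ) < x then (moebiusK K I : ℝ)
    else if I ≠ ⊥ ∧ (Ideal.absNorm I : ℝ) = x then (moebiusK K I : ℝ) / 2
    else 0

/-- `M_K^- = liminf_{x → ∞} M_K(x) / x^{1/2}`, as an extended real number. -/
def MKminus (K : Type) [Field K] [NumberField K] : EReal :=
  Filter.liminf (fun x : ℝ => ((mertensK K x / Real.sqrt x : ℝ) : EReal)) Filter.atTop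

/-- `M_K^+ = limsup_{x → ∞} M_K(x) / x^{1/2}`, as an extended real number. -/
def MKplus (K : Type) [Field K] [NumberField K] : EReal :=
  Filter.limsup (fun x : ℝ => ((mertensK K x / Real.sqrt x : ℝ) : EReal)) Filter.atTop

/-- The naïve Mertens-type conjecture over `K`: `-1 ≤ M_K^- ≤ M_K^+ ≤ 1`. -/
def NaiveMertensConj (K : Type) [Field K] [NumberField K] : Prop :=
  -1 ≤ MKminus K ∧ MKminus K ≤ MKplus K ∧ MKplus K ≤ 1

/-- A predicate identifying the Dedekind zeta function of `K`: a function analytic away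
from `s = 1` agreeing with the Dirichlet series `∑ N(𝔞)^{-s}` on `Re s > 1`. -/
def IsDedekindZeta (K : Type) [Field K] [NumberField K] (Z : ℂ → ℂ) : Prop :=
  (∀ s : ℂ, s ≠ 1 → DifferentiableAt ℂ Z s) ∧
  ∀ s : ℂ, 1 < s.re →
    Z s = ∑' I : {I : Ideal (𝓞 K) // I ≠ ⊥}, (Ideal.absNorm I.1 : ℂ) ^ (-s)

/-- The Riemann hypothesis for a zeta function `Z`: all nontrivial zeros lie on `Re s = 1/2`. -/
def ZetaRH (Z : ℂ → ℂ) : Prop :=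
  ∀ ρ : ℂ, Z ρ = 0 → 0 < ρ.re → ρ.re < 1 → ρ.re = 1 / 2

/-- The order of vanishing of `f` at `ρ`: the least `m` with `f^(m)(ρ) ≠ 0`. -/
def zeroOrder (f : ℂ → ℂ) (ρ : ℂ) : ℕ :=
  sInf {m : ℕ | iteratedDeriv m f ρ ≠ 0}

set_option linter.unusedSectionVars false

lemma norm_Gamma_le_Gamma_re {s : ℂ} (hs : 0 < s.re) : ‖Gamma s‖ ≤ Real.Gamma s.re := by
  rw [Gamma_eq_integral hs, Real.Gamma_eq_integral hs]
  refine (norm_integral_le_integral_norm _).trans_eq ?_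
  refine setIntegral_congr_fun measurableSet_Ioi fun x hx ↦ ?_
  rw [norm_mul, norm_cpow_eq_rpow_re_of_pos hx, norm_real, Real.norm_of_nonneg (Real.exp_pos _).le]
  simp

lemma norm_cos_le_exp_abs_im (z : ℂ) : ‖cos z‖ ≤ Real.exp |z.im| := by
  rw [cos, norm_div]
  have h1 : ‖exp (z * I)‖ ≤ Real.exp |z.im| := by
    rw [norm_exp]; simp [neg_le_abs]
  have h2 : ‖exp (-z * I)‖ ≤ Real.exp |z.im| := by
    rw [norm_exp]; simp [le_abs_self]
  have := norm_add_le (exp (z * I)) (exp (-z * I))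
  have h3 : ‖(2 : ℂ)‖ = 2 := by simp
  rw [h3]; linarith

lemma norm_sin_le_exp_abs_im (z : ℂ) : ‖sin z‖ ≤ Real.exp |z.im| := by
  have := norm_cos_le_exp_abs_im (z - Real.pi / 2)
  rw [cos_sub_pi_div_two] at this
  simpa using this

lemma exp_abs_mul_abs_le_sinh (x : ℝ) :
    Real.exp |x| * |x| ≤ (1 + 2 * |x|) * |Real.sinh x| := by
  wlog hx : 0 ≤ x generalizing x
  · have := this (-x) (by linarith)
    simpa using this
  rw [abs_of_nonneg hx, abs_of_nonneg (Real.sinh_nonneg_iff.2 hx), Real.sinh_eq]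
  have h1 : 2 * x + 1 ≤ Real.exp x * Real.exp x := by
    rw [← Real.exp_add, ← two_mul]; exact Real.add_one_le_exp _
  have h2 : Real.exp x * Real.exp (-x) = 1 := by rw [← Real.exp_add]; simp
  have h3 := Real.exp_pos x
  have h4 := Real.exp_pos (-x)
  have : (1 + 2 * x) * Real.exp (-x) ≤ Real.exp x := by
    have := mul_le_mul_of_nonneg_right h1 h4.le
    rw [mul_assoc, h2] at this
    linarith
  nlinarith

lemma norm_Gamma_two_add_mul_I_sq (t : ℝ) (ht : t ≠ 0) :
    ‖Gamma (2 + t * I)‖ ^ 2 * |Real.sinh (Real.pi * t)| = (1 + t ^ 2) * |Real.pi * t| := by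
  have hc : (starRingEnd ℂ) (Gamma (2 + t * I)) = Gamma (2 - t * I) := by
    rw [← Gamma_conj]; simp [sub_eq_add_neg, Complex.conj_ofNat]
  have h0 : (t : ℂ) * I ≠ 0 := by simp [ht]
  have h1 : (1 : ℂ) + t * I ≠ 0 := by
    intro h; have := congrArg Complex.re h; simp at this
  have h2 : (1 : ℂ) - t * I ≠ 0 := by
    intro h; have := congrArg Complex.re h; simp at this
  have e1 : Gamma (2 + t * I) = (1 + t * I) * (t * I) * Gamma (t * I) := by
    rw [show (2 : ℂ) + t * I = (t * I + 1) + 1 by ring, Gamma_add_one _ (by rwa [add_comm]),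
      Gamma_add_one _ h0]; ring
  have e2 : Gamma (2 - t * I) = (1 - t * I) * Gamma (1 - t * I) := by
    rw [show (2 : ℂ) - t * I = (1 - t * I) + 1 by ring, Gamma_add_one _ h2]
  have e3 := Gamma_mul_Gamma_one_sub (t * I)
  have hs : sin (Real.pi * (t * I)) = Real.sinh (Real.pi * t) * I := by
    rw [← mul_assoc, sin_mul_I]; push_cast; rfl
  have hsh : (Real.sinh (Real.pi * t) : ℂ) ≠ 0 := by
    rw [Ne, ofReal_eq_zero, Real.sinh_eq_zero]
    exact mul_ne_zero Real.pi_ne_zero ht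
  have key : (Gamma (2 + t * I) * (starRingEnd ℂ) (Gamma (2 + t * I))) *
      Real.sinh (Real.pi * t) = (1 + t ^ 2) * (Real.pi * t) := by
    rw [hc, e1, e2]
    calc _ = (1 + t * I) * (1 - t * I) * (t * I) * (Gamma (t * I) * Gamma (1 - t * I)) *
          Real.sinh (Real.pi * t) := by ring
      _ = _ := by
        rw [e3, hs]
        field_simp [hsh]
        ring_nf
        simp
        
  rw [mul_conj, normSq_eq_norm_sq] at key
  have := congrArg norm key
  rw [norm_mul, norm_mul] at this
  rw [norm_real, norm_real, Real.norm_of_nonneg (by positivity), Real.norm_eq_abs] at this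
  rw [this]
  norm_cast
  rw [Real.norm_of_nonneg (by positivity)]
  rfl

lemma norm_Gamma_two_add_mul_I_le (t : ℝ) :
    ‖Gamma (2 + t * I)‖ * Real.exp (Real.pi * |t| / 2) ≤ 3 * (1 + |t|) ^ 2 := by
  rcases eq_or_ne t 0 with rfl | ht
  · simp [Complex.Gamma_ofNat_eq_factorial]
  have h := norm_Gamma_two_add_mul_I_sq t ht
  have h2 := exp_abs_mul_abs_le_sinh (Real.pi * t)
  have hp : 0 < |Real.pi * t| := abs_pos.2 (mul_ne_zero Real.pi_ne_zero ht)
  refine abs_le_of_sq_le_sq' ?_ (by positivity) |>.2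
  have hq : |Real.pi * t| = Real.pi * |t| := by rw [abs_mul, abs_of_pos Real.pi_pos]
  have e : (‖Gamma (2 + t * I)‖ * Real.exp (Real.pi * |t| / 2)) ^ 2 =
      ‖Gamma (2 + t * I)‖ ^ 2 * Real.exp |Real.pi * t| := by
    rw [mul_pow, ← Real.exp_nat_mul, hq]; congr 2; push_cast; ring
  rw [e]
  have h3 : ‖Gamma (2 + t * I)‖ ^ 2 * Real.exp |Real.pi * t| ≤ (1 + 2 * |Real.pi * t|) * (1 + t ^ 2) := by
    refine le_of_mul_le_mul_right ?_ hp
    calc _ = ‖Gamma (2 + t * I)‖ ^ 2 * (Real.exp |Real.pi * t| * |Real.pi * t|) := by ring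
      _ ≤ ‖Gamma (2 + t * I)‖ ^ 2 * ((1 + 2 * |Real.pi * t|) * |Real.sinh (Real.pi * t)|) := by gcongr
      _ = (1 + 2 * |Real.pi * t|) * (‖Gamma (2 + t * I)‖ ^ 2 * |Real.sinh (Real.pi * t)|) := by ring
      _ = _ := by rw [h]; ring
  refine h3.trans ?_
  rw [hq, ← sq_abs t]
  have := Real.pi_lt_four
  have ha := abs_nonneg t
  calc (1 + 2 * (Real.pi * |t|)) * (1 + |t| ^ 2) ≤ (1 + 2 * (4 * |t|)) * (1 + |t| ^ 2) := by gcongr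
    _ ≤ _ := by nlinarith [pow_nonneg ha 2, pow_nonneg ha 3, pow_nonneg ha 4]

lemma norm_Gammaℂ_two_add_mul_I_le (t : ℝ) :
    ‖Gammaℂ (2 + t * I)‖ * Real.exp (Real.pi * |t| / 2) ≤ 3 * (1 + |t|) ^ 2 := by
  refine le_trans ?_ (norm_Gamma_two_add_mul_I_le t)
  gcongr
  rw [Gammaℂ_def, norm_mul, norm_mul]
  refine mul_le_of_le_one_left (norm_nonneg _) ?_
  have : (2 * Real.pi : ℂ) = ((2 * Real.pi : ℝ) : ℂ) := by push_cast; rfl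
  rw [this, norm_cpow_eq_rpow_re_of_pos (by positivity)]
  simp
  rw [← div_eq_mul_inv, div_le_one (by positivity)]
  nlinarith [Real.pi_gt_three]

lemma norm_Gammaℂ_mul_cos_le (t : ℝ) :
    ‖Gammaℂ (2 + t * I) * cos (Real.pi * (2 + t * I) / 2)‖ ≤ 3 * (1 + |t|) ^ 2 := by
  refine le_trans ?_ (norm_Gammaℂ_two_add_mul_I_le t)
  rw [norm_mul]
  gcongr
  refine (norm_cos_le_exp_abs_im _).trans_eq ?_
  congr 1
  have : ((Real.pi : ℂ) * (2 + t * I) / 2).im = Real.pi * t / 2 := by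
    rw [show (Real.pi : ℂ) * (2 + t * I) / 2 = Real.pi + ((Real.pi * t / 2 : ℝ) : ℂ) * I by push_cast; ring]
    simp
  rw [this, abs_div, abs_mul, abs_of_pos Real.pi_pos]; simp

lemma norm_Gammaℂ_mul_sin_le (t : ℝ) :
    ‖Gammaℂ (2 + t * I) * sin (Real.pi * (2 + t * I) / 2)‖ ≤ 3 * (1 + |t|) ^ 2 := by
  refine le_trans ?_ (norm_Gammaℂ_two_add_mul_I_le t)
  rw [norm_mul]
  gcongr
  refine (norm_sin_le_exp_abs_im _).trans_eq ?_
  congr 1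
  have : ((Real.pi : ℂ) * (2 + t * I) / 2).im = Real.pi * t / 2 := by
    rw [show (Real.pi : ℂ) * (2 + t * I) / 2 = Real.pi + ((Real.pi * t / 2 : ℝ) : ℂ) * I by push_cast; ring]
    simp
  rw [this, abs_div, abs_mul, abs_of_pos Real.pi_pos]; simp

lemma exists_norm_inv_Gamma_le (a b : ℝ) : ∃ C : ℝ, 0 < C ∧ ∀ z : ℂ, a ≤ z.re → z.re ≤ b →
    1 ≤ |z.im| → ‖(Gamma z)⁻¹‖ ≤ C * Real.exp (Real.pi * |z.im|) := by
  obtain ⟨n, hn⟩ := exists_nat_gt b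
  have hcont : ContinuousOn Real.Gamma (Set.Icc (1 - b + n) (1 - a + n)) := by
    intro x hx
    refine (Real.differentiableAt_Gamma fun m ↦ ?_).continuousAt.continuousWithinAt
    have := hx.1
    have hm : (0 : ℝ) ≤ m := Nat.cast_nonneg m
    intro h; linarith
  obtain ⟨C, hC⟩ := isCompact_Icc.exists_bound_of_continuousOn hcont
  have shift : ∀ (k : ℕ) (z : ℂ), 1 ≤ |z.im| → ‖Gamma z‖ ≤ ‖Gamma (z + k)‖ := by
    intro k
    induction k with
    | zero => simp
    | succ k ih =>
      intro z hz
      refine (ih z hz).trans ?_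
      have h1 : 1 ≤ ‖z + k‖ := by
        refine le_trans ?_ (abs_im_le_norm _)
        simpa using hz
      have h0 : z + k ≠ 0 := by intro h; rw [h] at h1; simp at h1; linarith
      push_cast
      rw [← add_assoc, Gamma_add_one _ h0, norm_mul]
      exact le_mul_of_one_le_left (norm_nonneg _) h1
  refine ⟨|C| + 1, by positivity, fun z ha hb hz ↦ ?_⟩
  have hΓ : ‖Gamma (1 - z)‖ ≤ |C| + 1 := by
    refine (shift n (1 - z) (by simpa using hz)).trans ?_
    have hre : (1 - z + n : ℂ).re = 1 - z.re + n := by simp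
    refine (norm_Gamma_le_Gamma_re (by rw [hre]; linarith)).trans ?_
    rw [hre]
    have := hC (1 - z.re + n) ⟨by linarith, by linarith⟩
    have h2 := le_abs_self (Real.Gamma (1 - z.re + n))
    have h3 := le_abs_self C
    rw [Real.norm_eq_abs] at this
    linarith
  have hsin : sin (Real.pi * z) ≠ 0 := by
    rw [Ne, Complex.sin_eq_zero_iff]
    rintro ⟨k, hk⟩
    have : z = k := by
      have hp : (Real.pi : ℂ) ≠ 0 := by exact_mod_cast Real.pi_ne_zero
      field_simp at hk
      exact hk
    rw [this] at hz; simp at hz; linarith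
  have hrefl := Gamma_mul_Gamma_one_sub z
  have hp : (Real.pi : ℂ) ≠ 0 := by exact_mod_cast Real.pi_ne_zero
  have hne : Gamma z ≠ 0 := by
    intro h; rw [h, zero_mul] at hrefl
    exact div_ne_zero hp hsin hrefl.symm
  have e : (Gamma z)⁻¹ = Gamma (1 - z) * sin (Real.pi * z) / Real.pi := by
    rw [eq_div_iff hsin] at hrefl
    generalize sin (Real.pi * z) = S at *
    field_simp
    linear_combination -hrefl
  rw [e, norm_div, norm_mul, norm_real, Real.norm_of_nonneg Real.pi_pos.le]
  have hs := norm_sin_le_exp_abs_im (Real.pi * z)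
  have him : |((Real.pi : ℂ) * z).im| = Real.pi * |z.im| := by
    simp [abs_mul, abs_of_pos Real.pi_pos]
  rw [him] at hs
  refine (div_le_self (by positivity) (by linarith [Real.pi_gt_three])).trans ?_
  gcongr

lemma exists_norm_inv_Gammaℝ_le (a b : ℝ) : ∃ B : ℝ, 0 < B ∧ ∀ s : ℂ, a ≤ s.re → s.re ≤ b →
    2 ≤ |s.im| → ‖(Gammaℝ s)⁻¹‖ ≤ Real.exp (B * |s.im|) := by
  obtain ⟨C, hC, h⟩ := exists_norm_inv_Gamma_le (a / 2) (b / 2)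
  refine ⟨|Real.log C| + |Real.log Real.pi * b / 2| + Real.pi, by positivity, fun s ha hb hs ↦ ?_⟩
  have him : (s / 2).im = s.im / 2 := by simp
  have hre : (s / 2).re = s.re / 2 := by simp
  have h1 := h (s / 2) (by rw [hre]; linarith) (by rw [hre]; linarith) (by
    rw [him, abs_div]; simp; linarith)
  rw [Gammaℝ_def, mul_inv, norm_mul, ← cpow_neg, norm_cpow_eq_rpow_re_of_pos Real.pi_pos]
  have hre2 : (-(-s / 2)).re = s.re / 2 := by simp; ring
  rw [hre2]
  have hpi : Real.pi ^ (s.re / 2) ≤ Real.exp (|Real.log Real.pi * b / 2|) := by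
    rw [Real.rpow_def_of_pos Real.pi_pos]
    refine Real.exp_le_exp.2 ((le_abs_self _).trans' ?_)
    have := Real.log_pos (by linarith [Real.pi_gt_three] : 1 < Real.pi)
    nlinarith
  calc _ ≤ Real.exp (|Real.log Real.pi * b / 2|) * (C * Real.exp (Real.pi * |(s / 2).im|)) := by gcongr
    _ ≤ Real.exp (|Real.log Real.pi * b / 2|) * (Real.exp |Real.log C| * Real.exp (Real.pi * |(s / 2).im|)) := by
      gcongr
      calc C = Real.exp (Real.log C) := (Real.exp_log hC).symm
        _ ≤ _ := Real.exp_le_exp.2 (le_abs_self _)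
    _ ≤ _ := by
      rw [← Real.exp_add, ← Real.exp_add]
      refine Real.exp_le_exp.2 ?_
      rw [him, abs_div, abs_div, abs_two]
      have h8 := mul_le_mul_of_nonneg_left hs (abs_nonneg (Real.log C))
      have h9 := mul_le_mul_of_nonneg_left hs (abs_nonneg (Real.log Real.pi * b / 2))
      rw [abs_div, abs_two] at h9
      have := abs_nonneg (Real.log C)
      have := abs_nonneg (Real.log Real.pi * b)
      have := Real.pi_pos
      nlinarith

/-- The product of the archimedean Gamma factors for `r₁` real and `r₂` complex places. -/
def gammaFactor (r₁ r₂ : ℕ) (s : ℂ) : ℂ := Gammaℝ s ^ r₁ * Gammaℂ s ^ r₂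

lemma Gammaℂ_ne_zero_of_re_pos {s : ℂ} (hs : 0 < s.re) : Gammaℂ s ≠ 0 := by
  rw [← Gammaℝ_mul_Gammaℝ_add_one]
  exact mul_ne_zero (Gammaℝ_ne_zero_of_re_pos hs)
    (Gammaℝ_ne_zero_of_re_pos (by rw [add_re, one_re]; linarith))

lemma gammaFactor_ne_zero (r₁ r₂ : ℕ) {s : ℂ} (hs : 0 < s.re) : gammaFactor r₁ r₂ s ≠ 0 :=
  mul_ne_zero (pow_ne_zero _ (Gammaℝ_ne_zero_of_re_pos hs))
    (pow_ne_zero _ (Gammaℂ_ne_zero_of_re_pos hs))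

lemma differentiable_gammaFactor_inv (r₁ r₂ : ℕ) :
    Differentiable ℂ fun s ↦ (gammaFactor r₁ r₂ s)⁻¹ := by
  have : (fun s ↦ (gammaFactor r₁ r₂ s)⁻¹) = fun s ↦ (Gammaℝ s)⁻¹ ^ r₁ * (Gammaℂ s)⁻¹ ^ r₂ := by
    ext s; simp [gammaFactor, mul_comm]
  rw [this]
  exact (differentiable_Gammaℝ_inv.pow _).mul (differentiable_Gammaℂ_inv.pow _)

lemma norm_gammaFactor_div_le (r₁ r₂ : ℕ) (t : ℝ) :
    ‖gammaFactor r₁ r₂ (2 + t * I) * (gammaFactor r₁ r₂ (1 - (2 + t * I)))⁻¹‖ ≤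
      (3 * (1 + |t|) ^ 2) ^ (r₁ + 2 * r₂) := by
  set u : ℂ := 2 + t * I with hu
  have hure : u.re = 2 := by simp [hu]
  have hn : ∀ n : ℕ, u ≠ -n := by
    intro n h
    have := congrArg Complex.re h
    rw [hure] at this
    simp at this
    have : (0 : ℝ) ≤ n := Nat.cast_nonneg n
    linarith
  have hR : Gammaℝ u * (Gammaℝ (1 - u))⁻¹ = Gammaℂ u * cos (Real.pi * u / 2) := by
    rw [inv_Gammaℝ_one_sub hn]
    have := Gammaℝ_ne_zero_of_re_pos (s := u) (by rw [hure]; norm_num)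
    field_simp
  have hR2 : Gammaℝ (u + 1) * (Gammaℝ (2 - u))⁻¹ = Gammaℂ u * sin (Real.pi * u / 2) := by
    rw [inv_Gammaℝ_two_sub hn]
    have := Gammaℝ_ne_zero_of_re_pos (s := u + 1) (by simp [hure]; norm_num)
    field_simp
  have hC : Gammaℂ u * (Gammaℂ (1 - u))⁻¹ =
      (Gammaℂ u * cos (Real.pi * u / 2)) * (Gammaℂ u * sin (Real.pi * u / 2)) := by
    rw [← hR, ← hR2, ← Gammaℝ_mul_Gammaℝ_add_one u, ← Gammaℝ_mul_Gammaℝ_add_one (1 - u),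
      show 1 - u + 1 = 2 - u by ring, mul_inv]
    ring
  have e : gammaFactor r₁ r₂ u * (gammaFactor r₁ r₂ (1 - u))⁻¹ =
      (Gammaℝ u * (Gammaℝ (1 - u))⁻¹) ^ r₁ * (Gammaℂ u * (Gammaℂ (1 - u))⁻¹) ^ r₂ := by
    simp only [gammaFactor, mul_inv, mul_pow, inv_pow]; ring
  have b1 := norm_Gammaℂ_mul_cos_le t
  have b2 := norm_Gammaℂ_mul_sin_le t
  rw [e, hR, hC, norm_mul, norm_pow, norm_pow, pow_add, pow_mul]
  have h0 : (0 : ℝ) ≤ 3 * (1 + |t|) ^ 2 := by positivity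
  refine mul_le_mul (pow_le_pow_left₀ (norm_nonneg _) b1 _)
    (pow_le_pow_left₀ (by positivity) ?_ _) (by positivity) (by positivity)
  rw [norm_mul, pow_two (3 * (1 + |t|) ^ 2)]
  exact mul_le_mul b1 b2 (norm_nonneg _) h0

lemma exists_norm_inv_gammaFactor_le (r₁ r₂ : ℕ) : ∃ B : ℝ, 0 < B ∧ ∀ s : ℂ, -1 ≤ s.re →
    s.re ≤ 2 → 2 ≤ |s.im| → ‖(gammaFactor r₁ r₂ s)⁻¹‖ ≤ Real.exp (B * |s.im|) := by
  obtain ⟨B, hB, h⟩ := exists_norm_inv_Gammaℝ_le (-1) 3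
  refine ⟨B * r₁ + (2 * B) * r₂ + 1, by positivity, fun s h1 h2 h3 ↦ ?_⟩
  have a1 := h s h1 (by linarith) h3
  have a2 := h (s + 1) (by simp; linarith) (by simp; linarith) (by simpa using h3)
  have a3 : ‖(Gammaℂ s)⁻¹‖ ≤ Real.exp ((2 * B) * |s.im|) := by
    rw [← Gammaℝ_mul_Gammaℝ_add_one, mul_inv, norm_mul, mul_assoc, two_mul, Real.exp_add]
    simp only [add_im, one_im, add_zero] at a2
    gcongr
  rw [gammaFactor, mul_inv, ← inv_pow, ← inv_pow, norm_mul, norm_pow, norm_pow]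
  calc _ ≤ Real.exp (B * |s.im|) ^ r₁ * Real.exp ((2 * B) * |s.im|) ^ r₂ := by gcongr
    _ = Real.exp ((B * r₁ + (2 * B) * r₂) * |s.im|) := by
      rw [← Real.exp_nat_mul, ← Real.exp_nat_mul, ← Real.exp_add]; congr 1; ring
    _ ≤ _ := by
      refine Real.exp_le_exp.2 ?_
      have := abs_nonneg s.im
      nlinarith

/-- The data expressing that `Z` has a completed function with the functional equation of a
Dedekind zeta function of a field with `r₁` real places, `r₂` complex places, and
discriminant `± D`. -/
structure HasCompletion (r₁ r₂ : ℕ) (D : ℝ) (Z Λ₀ : ℂ → ℂ) (a b : ℂ) : Prop where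
  differentiable : Differentiable ℂ Λ₀
  bounded : ∀ x y : ℝ, ∃ C, ∀ s : ℂ, x ≤ s.re → s.re ≤ y → ‖Λ₀ s‖ ≤ C
  eq : ∀ s : ℂ, 1 < s.re → Λ₀ s - a / s - b / (1 - s) = gammaFactor r₁ r₂ s * Z s
  eq_one_sub : ∀ s : ℂ, 1 < s.re → Λ₀ (1 - s) - a / (1 - s) - b / s =
    (D : ℂ) ^ (s - 1 / 2) * (gammaFactor r₁ r₂ s * Z s)

section Completion

variable {r₁ r₂ : ℕ} {D : ℝ} {Z Λ₀ : ℂ → ℂ} {a b : ℂ}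

set_option maxHeartbeats 2000000 in
theorem HasCompletion.exists_entire (h : HasCompletion r₁ r₂ D Z Λ₀ a b)
    (hZ : ∀ s : ℂ, s ≠ 1 → DifferentiableAt ℂ Z s) (hD : 1 ≤ D) {M : ℝ} (hM : 0 ≤ M)
    (hZM : ∀ s : ℂ, 2 ≤ s.re → ‖Z s‖ ≤ M) :
    ∃ H : ℂ → ℂ, Differentiable ℂ H ∧ (∀ s, s ≠ 1 → H s = s * (1 - s) * Z s) ∧
      ∀ s : ℂ, -1 ≤ s.re → s.re ≤ 2 →
        ‖H s‖ ≤ M * D ^ (3 / 2 : ℝ) * 12 ^ (r₁ + 2 * r₂) * ‖s + 3‖ ^ (2 * (r₁ + 2 * r₂) + 2) := by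
  set n := r₁ + 2 * r₂ with hn
  have hD0 : 0 < D := by linarith
  let H : ℂ → ℂ := fun s ↦ (s * (1 - s) * Λ₀ s - a * (1 - s) - b * s) * (gammaFactor r₁ r₂ s)⁻¹
  have hHd : Differentiable ℂ H := by
    have := h.differentiable
    exact Differentiable.mul (by fun_prop) (differentiable_gammaFactor_inv r₁ r₂)
  have hHeq1 : ∀ s : ℂ, 1 < s.re → H s = s * (1 - s) * Z s := by
    intro s hs
    have hs0 : s ≠ 0 := by rintro rfl; simp at hs; linarith
    have hs1 : 1 - s ≠ 0 := by
      intro h; rw [sub_eq_zero] at h; rw [← h] at hs; simp at hs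
    have hg := gammaFactor_ne_zero r₁ r₂ (s := s) (by linarith)
    have := h.eq s hs
    have e : Z s = (Λ₀ s - a / s - b / (1 - s)) * (gammaFactor r₁ r₂ s)⁻¹ := by
      rw [this]; field_simp
    simp only [H]
    rw [e]
    field_simp
  have hHeq : ∀ s, s ≠ 1 → H s = s * (1 - s) * Z s := by
    have hU : IsOpen ({1}ᶜ : Set ℂ) := isOpen_compl_singleton
    have hconn : IsPreconnected ({1}ᶜ : Set ℂ) :=
      (isConnected_compl_singleton_of_one_lt_rank (by simp) 1).isPreconnected
    have a1 : AnalyticOnNhd ℂ H {1}ᶜ := hHd.differentiableOn.analyticOnNhd hU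
    have a2 : AnalyticOnNhd ℂ (fun s ↦ s * (1 - s) * Z s) {1}ᶜ := by
      refine DifferentiableOn.analyticOnNhd (fun s hs ↦ ?_) hU
      have := hZ s hs
      exact DifferentiableAt.differentiableWithinAt (by fun_prop)
    have hev : H =ᶠ[𝓝 2] fun s ↦ s * (1 - s) * Z s := by
      filter_upwards [(isOpen_lt continuous_const Complex.continuous_re).mem_nhds
        (show (1 : ℝ) < (2 : ℂ).re by simp)] with s hs
      exact hHeq1 s hs
    intro s hs
    exact a1.eqOn_of_preconnected_of_eventuallyEq a2 hconn (by simp) hev hs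
  refine ⟨H, hHd, hHeq, fun s hs1 hs2 ↦ ?_⟩
  have hnz : ∀ s : ℂ, -1 ≤ s.re → 1 ≤ ‖s + 3‖ := by
    intro s hs
    refine le_trans ?_ (abs_re_le_norm _)
    rw [add_re]; refine le_trans ?_ (le_abs_self _); simp; linarith
  have hnz' : ∀ s : ℂ, -1 ≤ s.re → s + 3 ≠ 0 := by
    intro s hs h0; have := hnz s hs; rw [h0] at this; simp at this; linarith
  set N := 2 * n + 2 with hN
  set C := M * D ^ (3 / 2 : ℝ) * 12 ^ n with hC
  have hD32 : 1 ≤ D ^ (3 / 2 : ℝ) := Real.one_le_rpow hD (by norm_num)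
  -- the right edge
  have hright : ∀ z : ℂ, z.re = 2 → ‖H z‖ ≤ C * ‖z + 3‖ ^ N := by
    intro z hz
    rw [hHeq1 z (by rw [hz]; norm_num), norm_mul, norm_mul]
    have h1 : ‖z‖ ≤ ‖z + 3‖ := by
      refine abs_le_of_sq_le_sq' ?_ (norm_nonneg _) |>.2
      rw [Complex.sq_norm, Complex.sq_norm, normSq_apply, normSq_apply]; simp [hz]; norm_num
    have h2 : ‖1 - z‖ ≤ ‖z + 3‖ := by
      refine abs_le_of_sq_le_sq' ?_ (norm_nonneg _) |>.2
      rw [Complex.sq_norm, Complex.sq_norm, normSq_apply, normSq_apply]; simp [hz]; norm_num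
    have h3 := hZM z hz.ge
    have h4 := hnz z (by rw [hz]; norm_num)
    calc ‖z‖ * ‖1 - z‖ * ‖Z z‖ ≤ ‖z + 3‖ * ‖z + 3‖ * M := by gcongr
      _ = M * 1 * 1 * ‖z + 3‖ ^ 2 := by ring
      _ ≤ C * ‖z + 3‖ ^ N := by
        rw [hC]
        gcongr
        · exact one_le_pow₀ (by norm_num)
        · omega
  -- the left edge
  have hleft : ∀ z : ℂ, z.re = -1 → ‖H z‖ ≤ C * ‖z + 3‖ ^ N := by
    intro z hz
    set t : ℝ := -z.im with ht
    have hzu : z = 1 - (2 + t * I) := by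
      apply Complex.ext <;> simp [hz, ht]; norm_num
    set u : ℂ := 2 + t * I with hu
    have hure : u.re = 2 := by simp [hu]
    have hu0 : u ≠ 0 := by intro h; rw [h] at hure; simp at hure
    have hu1 : 1 - u ≠ 0 := by
      intro h; rw [sub_eq_zero] at h; rw [← h] at hure; simp at hure
    have hfe := h.eq_one_sub u (by rw [hure]; norm_num)
    have e : H z = (1 - u) * u * ((D : ℂ) ^ (u - 1 / 2) * Z u) *
        (gammaFactor r₁ r₂ u * (gammaFactor r₁ r₂ (1 - u))⁻¹) := by
      simp only [H]
      rw [hzu]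
      have : (1 - u) * (1 - (1 - u)) * Λ₀ (1 - u) - a * (1 - (1 - u)) - b * (1 - u) =
        (1 - u) * u * (Λ₀ (1 - u) - a / (1 - u) - b / u) := by
        field_simp; ring
      rw [this, hfe]; ring
    have hnu : ‖u‖ = ‖z + 3‖ := by
      rw [← sq_eq_sq₀ (norm_nonneg _) (norm_nonneg _), Complex.sq_norm, Complex.sq_norm,
        normSq_apply, normSq_apply, hzu]; simp [hu]; norm_num
    have hnu1 : ‖1 - u‖ ≤ ‖z + 3‖ := by
      refine abs_le_of_sq_le_sq' ?_ (norm_nonneg _) |>.2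
      rw [Complex.sq_norm, Complex.sq_norm, normSq_apply, normSq_apply, hzu]; simp [hu]; norm_num
    have hDn : ‖(D : ℂ) ^ (u - 1 / 2)‖ = D ^ (3 / 2 : ℝ) := by
      rw [norm_cpow_eq_rpow_re_of_pos hD0]; congr 1; rw [sub_re, hure]; norm_num
    have h3 := hZM u hure.ge
    have h4 := hnz z (by rw [hz])
    have h5 : |t| ≤ ‖z + 3‖ := by
      rw [← hnu]; refine le_trans ?_ (abs_im_le_norm _); simp [hu]
    have h6 := norm_gammaFactor_div_le r₁ r₂ t
    have h7 : (3 * (1 + |t|) ^ 2) ^ n ≤ (12 * ‖z + 3‖ ^ 2) ^ n := by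
      refine pow_le_pow_left₀ (by positivity) ?_ n
      have : (1 + |t|) ^ 2 ≤ (2 * ‖z + 3‖) ^ 2 :=
        pow_le_pow_left₀ (by positivity) (by linarith) 2
      nlinarith
    rw [e, norm_mul, norm_mul, norm_mul, norm_mul, hDn, hnu]
    calc _ ≤ ‖z + 3‖ * ‖z + 3‖ * (D ^ (3 / 2 : ℝ) * M) * (12 * ‖z + 3‖ ^ 2) ^ n := by
          gcongr
          exact h6.trans h7
      _ = C * ‖z + 3‖ ^ N := by
        rw [hC, hN, mul_pow, pow_add, pow_mul]; ring
  let f : ℂ → ℂ := fun z ↦ H z / (z + 3) ^ N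
  have hedge : ∀ z : ℂ, -1 ≤ z.re → ‖H z‖ ≤ C * ‖z + 3‖ ^ N → ‖f z‖ ≤ C := by
    intro z hz hle
    simp only [f]
    rw [norm_div, norm_pow, div_le_iff₀ (by have := hnz z hz; positivity)]
    exact hle
  have key : ‖f s‖ ≤ C := by
    refine PhragmenLindelof.vertical_strip (a := -1) (b := 2) ?_ ?_
      (fun z hz ↦ hedge z hz.ge (hleft z hz))
      (fun z hz ↦ hedge z (by rw [hz]; norm_num) (hright z hz)) hs1 hs2
    · refine DifferentiableOn.diffContOnCl (fun z hz ↦ ?_)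
      have hz' : -1 ≤ z.re := by
        have := closure_mono (t := re ⁻¹' Set.Icc (-1) 2)
          (Set.preimage_mono Set.Ioo_subset_Icc_self) hz
        rw [(isClosed_Icc.preimage continuous_re).closure_eq] at this
        exact this.1
      exact ((hHd z).div (by fun_prop : DifferentiableAt ℂ (fun w ↦ (w + 3) ^ N) z)
        (pow_ne_zero _ (hnz' z hz'))).differentiableWithinAt
    · obtain ⟨B, hB, hγ⟩ := exists_norm_inv_gammaFactor_le r₁ r₂
      obtain ⟨L, hL⟩ := h.bounded (-1) 2
      refine ⟨1, ?_, B + 2, ?_⟩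
      · rw [lt_div_iff₀ (by norm_num)]; linarith [Real.pi_gt_three]
      refine Asymptotics.IsBigO.of_bound (25 * (|L| + ‖a‖ + ‖b‖)) ?_
      have hev : ∀ᶠ z : ℂ in comap (_root_.abs ∘ im) atTop ⊓ 𝓟 (re ⁻¹' Set.Ioo (-1) 2),
          2 ≤ |z.im| ∧ z ∈ re ⁻¹' Set.Ioo (-1 : ℝ) 2 :=
        ((eventually_ge_atTop 2).comap _).filter_mono inf_le_left |>.and
          ((eventually_principal.2 fun _ h ↦ h).filter_mono inf_le_right)
      filter_upwards [hev] with z ⟨hz, hzre⟩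
      have hz1 : -1 ≤ z.re := hzre.1.le
      have hz2 : z.re ≤ 2 := hzre.2.le
      have h4 := hnz z hz1
      have n1 : ‖z‖ ≤ 5 * Real.exp |z.im| := by
        have := norm_le_abs_re_add_abs_im z
        have h1 : |z.re| ≤ 2 := abs_le.2 ⟨by linarith, hz2⟩
        have := Real.add_one_le_exp |z.im|
        linarith
      have n2 : ‖1 - z‖ ≤ 5 * Real.exp |z.im| := by
        have := norm_le_abs_re_add_abs_im (1 - z)
        have h1 : |(1 - z).re| ≤ 2 := abs_le.2 ⟨by simp; linarith, by simp; linarith⟩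
        have h2 : |(1 - z).im| = |z.im| := by simp
        have := Real.add_one_le_exp |z.im|
        linarith
      have hE : 1 ≤ Real.exp |z.im| := Real.one_le_exp (abs_nonneg _)
      have n3 : ‖Λ₀ z‖ ≤ |L| := (hL z hz1 hz2).trans (le_abs_self _)
      have n4 : ‖z * (1 - z) * Λ₀ z - a * (1 - z) - b * z‖ ≤
          (25 * (|L| + ‖a‖ + ‖b‖)) * Real.exp |z.im| ^ 2 := by
        calc _ ≤ ‖z‖ * ‖1 - z‖ * ‖Λ₀ z‖ + ‖a‖ * ‖1 - z‖ + ‖b‖ * ‖z‖ := by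
              refine (norm_sub_le _ _).trans (add_le_add ((norm_sub_le _ _).trans ?_) (norm_mul_le _ _))
              rw [norm_mul, norm_mul, norm_mul]
          _ ≤ (5 * Real.exp |z.im|) * (5 * Real.exp |z.im|) * |L| +
              ‖a‖ * (25 * (Real.exp |z.im| * Real.exp |z.im|)) +
              ‖b‖ * (25 * (Real.exp |z.im| * Real.exp |z.im|)) := by
            gcongr
            · refine n2.trans ?_; nlinarith
            · refine n1.trans ?_; nlinarith
          _ = _ := by ring
      have n5 : ‖f z‖ ≤ ‖H z‖ := by
        simp only [f]
        rw [norm_div, norm_pow]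
        exact div_le_self (norm_nonneg _) (one_le_pow₀ h4)
      refine n5.trans ?_
      simp only [H]
      rw [norm_mul, Real.norm_of_nonneg (Real.exp_pos _).le]
      calc _ ≤ ((25 * (|L| + ‖a‖ + ‖b‖)) * Real.exp |z.im| ^ 2) * Real.exp (B * |z.im|) := by
            gcongr
            exact hγ z hz1 hz2 hz
        _ = (25 * (|L| + ‖a‖ + ‖b‖)) * Real.exp ((B + 2) * |z.im|) := by
          rw [mul_assoc, ← Real.exp_nat_mul, ← Real.exp_add]; congr 2; push_cast; ring
        _ ≤ _ := by
          gcongr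
          rw [one_mul]
          have := Real.add_one_le_exp |z.im|
          linarith
  simp only [f] at key
  rw [norm_div, norm_pow, div_le_iff₀ (by have := hnz s hs1; positivity)] at key
  exact key

end Completion

lemma natCast_zeroOrder_le {f : ℂ → ℂ} {ρ : ℂ} (hf : AnalyticAt ℂ f ρ) :
    (zeroOrder f ρ : ℕ∞) ≤ analyticOrderAt f ρ := by
  rw [natCast_le_analyticOrderAt_iff_iteratedDeriv_eq_zero hf]
  intro i hi
  by_contra h
  exact Nat.notMem_of_lt_sInf hi h

lemma sum_zeroOrder_le {Z H : ℂ → ℂ} (hZ : ∀ s : ℂ, s ≠ 1 → DifferentiableAt ℂ Z s)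
    (hH : Differentiable ℂ H) (hHZ : ∀ s, s ≠ 1 → H s = s * (1 - s) * Z s) {c : ℂ} {M : ℝ}
    (hM : 1 ≤ M) (hc : H c ≠ 0) (hb : ∀ z, ‖z - c‖ ≤ 5 / 2 → ‖H z‖ ≤ M) (S : Finset ℂ)
    (hS : ∀ ρ ∈ S, ρ ≠ 1 ∧ ‖ρ - c‖ ≤ 21 / 10) :
    ∑ ρ ∈ S, (zeroOrder Z ρ : ℝ) ≤ Real.log (M / ‖H c‖) / Real.log ((5 / 2) / (21 / 10)) := by
  have hHa : AnalyticOnNhd ℂ H Set.univ := hH.differentiableOn.analyticOnNhd isOpen_univ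
  have h1 := AnalyticOnNhd.sum_divisor_le (c := c) (r := 21 / 10) (R := 5 / 2) (M := M) (f := H)
    (by norm_num) (by norm_num [abs_of_pos]) hM (hHa.mono (Set.subset_univ _)) hc ?_
  swap
  · intro z hz
    rw [mem_sphere_iff_norm, abs_of_pos (by norm_num)] at hz
    exact hb z hz.le
  refine le_trans ?_ h1
  set U := Metric.closedBall c |(21 / 10 : ℝ)| with hU
  have hHU : AnalyticOnNhd ℂ H U := hHa.mono (Set.subset_univ _)
  have hfin := (MeromorphicOn.divisor H U).finiteSupport (isCompact_closedBall _ _)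
  have hord : ∀ ρ ∈ S, (zeroOrder Z ρ : ℤ) ≤ MeromorphicOn.divisor H U ρ := by
    intro ρ hρ
    obtain ⟨hρ1, hρc⟩ := hS ρ hρ
    have hρU : ρ ∈ U := by
      rw [hU, mem_closedBall_iff_norm, abs_of_pos (by norm_num)]; exact hρc
    rw [MeromorphicOn.AnalyticOnNhd.divisor_apply hHU hρU]
    have hZa : AnalyticAt ℂ Z ρ := by
      have hd : DifferentiableOn ℂ Z {1}ᶜ := fun s hs ↦ (hZ s hs).differentiableWithinAt
      exact hd.analyticOnNhd isOpen_compl_singleton ρ hρ1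
    have hev : H =ᶠ[𝓝 ρ] (fun s ↦ s * (1 - s)) * Z := by
      filter_upwards [isOpen_compl_singleton.mem_nhds hρ1] with s hs
      exact hHZ s hs
    have hle : (zeroOrder Z ρ : ℕ∞) ≤ analyticOrderAt H ρ := by
      rw [analyticOrderAt_congr hev, analyticOrderAt_mul (by fun_prop) hZa]
      exact (natCast_zeroOrder_le hZa).trans le_add_self
    have htop : analyticOrderAt H ρ ≠ ⊤ := by
      refine hHa.analyticOrderAt_ne_top_of_isPreconnected isPreconnected_univ
        (Set.mem_univ c) (Set.mem_univ ρ) ?_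
      rw [(hHa c (Set.mem_univ c)).analyticOrderAt_eq_zero.2 hc]
      simp
    obtain ⟨m, hm⟩ := ENat.ne_top_iff_exists.1 htop
    rw [← hm] at hle ⊢
    have : zeroOrder Z ρ ≤ m := by exact_mod_cast hle
    simpa using this
  have hnn : 0 ≤ MeromorphicOn.divisor H U := MeromorphicOn.AnalyticOnNhd.divisor_nonneg hHU
  have : (∑ ρ ∈ S, (zeroOrder Z ρ : ℤ)) ≤ ∑ᶠ u, MeromorphicOn.divisor H U u := by
    rw [finsum_eq_sum_of_support_subset (s := hfin.toFinset ∪ S) _ (by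
      intro x hx; simp only [Finset.coe_union, Set.Finite.coe_toFinset]; exact Or.inl hx)]
    exact (Finset.sum_le_sum hord).trans
      (Finset.sum_le_sum_of_subset_of_nonneg Finset.subset_union_right fun i _ _ ↦ hnn i)
  exact_mod_cast this

/-- The zeros of a function with the functional equation of a Dedekind zeta function in a unit
interval are few, when the function is bounded from above and below near `re s = 2`. -/
theorem HasCompletion.exists_sum_zeroOrder_le {A : ℝ} (hA : 1 ≤ A) : ∃ C : ℝ, 0 < C ∧
    ∀ (r₁ r₂ n : ℕ) (D : ℝ) (Z Λ₀ : ℂ → ℂ) (a b : ℂ), HasCompletion r₁ r₂ D Z Λ₀ a b →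
      r₁ + 2 * r₂ = n → 1 ≤ n → 1 ≤ D → (∀ s : ℂ, s ≠ 1 → DifferentiableAt ℂ Z s) →
      (∀ s : ℂ, 2 ≤ s.re → ‖Z s‖ ≤ A ^ n) → (∀ s : ℂ, 2 ≤ s.re → 1 ≤ A ^ n * ‖Z s‖) →
      ∀ T : ℝ, 2 ≤ T → ∀ S : Finset ℂ,
        (∀ ρ ∈ S, Z ρ = 0 ∧ 0 < ρ.re ∧ ρ.re < 1 ∧ T ≤ |ρ.im| ∧ |ρ.im| ≤ T + 1) →
        ∑ ρ ∈ S, (zeroOrder Z ρ : ℝ) ≤ C * (Real.log D + n * Real.log T) := by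
  set L := Real.log ((5 / 2) / (21 / 10)) with hL
  have hLpos : 0 < L := Real.log_pos (by norm_num)
  have hlA : 0 ≤ Real.log A := Real.log_nonneg hA
  have hl2 : 0 < Real.log 2 := Real.log_pos (by norm_num)
  have hl12 : 0 ≤ Real.log 12 := Real.log_nonneg (by norm_num)
  set K := 3 / 2 + 16 + (2 * Real.log A + Real.log 12) / Real.log 2 with hK
  have hKpos : 0 < K := by positivity
  refine ⟨2 * (K / L), by positivity, ?_⟩
  intro r₁ r₂ n D Z Λ₀ a b hcomp hn hn1 hD hZ hup hlow T hT S hS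
  obtain ⟨H, hHd, hHZ, hHb⟩ := hcomp.exists_entire hZ hD (M := A ^ n) (by positivity) hup
  rw [hn] at hHb
  have hD32 : 1 ≤ D ^ (3 / 2 : ℝ) := Real.one_le_rpow hD (by norm_num)
  have hAn : 1 ≤ A ^ n := one_le_pow₀ hA
  have h12 : (1 : ℝ) ≤ 12 ^ n := one_le_pow₀ (by norm_num)
  set B := A ^ n * D ^ (3 / 2 : ℝ) * 12 ^ n * (T + 8) ^ (2 * n + 2) with hB
  have hT8 : 1 ≤ T + 8 := by linarith
  have hB1 : 1 ≤ B := one_le_mul_of_one_le_of_one_le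
    (one_le_mul_of_one_le_of_one_le (one_le_mul_of_one_le_of_one_le hAn hD32) h12)
    (one_le_pow₀ hT8)
  have key : ∀ τ : ℝ, |τ| = T + 1 / 2 → ∀ S : Finset ℂ,
      (∀ ρ ∈ S, 0 < ρ.re ∧ ρ.re < 1 ∧ |ρ.im - τ| ≤ 1 / 2) →
      ∑ ρ ∈ S, (zeroOrder Z ρ : ℝ) ≤ K / L * (Real.log D + n * Real.log T) := by
    intro τ hτ S hS
    set c : ℂ := 2 + τ * I with hc
    have hcre : c.re = 2 := by simp [hc]
    have hcim : c.im = τ := by simp [hc]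
    have hcn : ‖c‖ ≤ T + 5 / 2 := by
      have := norm_le_abs_re_add_abs_im c
      rw [hcre, hcim, hτ, abs_of_pos (by norm_num : (0 : ℝ) < 2)] at this
      linarith
    have hc1 : c ≠ 1 := by intro h; rw [h] at hcre; simp at hcre
    have hb : ∀ z, ‖z - c‖ ≤ 5 / 2 → ‖H z‖ ≤ B := by
      intro z hz
      have hre : |z.re - 2| ≤ 5 / 2 := by
        have := (abs_re_le_norm (z - c)).trans hz
        rwa [sub_re, hcre] at this
      rw [abs_le] at hre
      have him : |z.im - τ| ≤ 5 / 2 := by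
        have := (abs_im_le_norm (z - c)).trans hz
        rwa [sub_im, hcim] at this
      have hzn : ‖z‖ ≤ T + 5 := by
        calc ‖z‖ = ‖(z - c) + c‖ := by ring_nf
          _ ≤ _ := norm_add_le _ _
          _ ≤ _ := by linarith
      have hz3 : ‖z + 3‖ ≤ T + 8 := by
        refine (norm_add_le _ _).trans ?_
        simp; linarith
      have hz1 : ‖1 - z‖ ≤ T + 8 := by
        refine (norm_sub_le _ _).trans ?_
        simp; linarith
      rcases le_total z.re 2 with h2 | h2
      · refine (hHb z (by linarith) h2).trans ?_
        rw [hB]; gcongr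
      · have hz1' : z ≠ 1 := by rintro rfl; norm_num at h2
        rw [hHZ z hz1', norm_mul, norm_mul]
        calc ‖z‖ * ‖1 - z‖ * ‖Z z‖ ≤ (T + 8) * (T + 8) * A ^ n := by
              gcongr
              · linarith
              · exact hup z h2
          _ = A ^ n * 1 * 1 * (T + 8) ^ 2 := by ring
          _ ≤ B := by
            rw [hB]
            have : (T + 8) ^ 2 ≤ (T + 8) ^ (2 * n + 2) := pow_le_pow_right₀ hT8 (by omega)
            gcongr
    have hHc : 1 ≤ A ^ n * ‖H c‖ := by
      have h1 := hlow c hcre.ge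
      rw [hHZ c hc1, norm_mul, norm_mul]
      have h2 : 1 ≤ ‖c‖ := by
        refine le_trans ?_ (abs_re_le_norm c); rw [hcre]; norm_num
      have h3 : 1 ≤ ‖1 - c‖ := by
        refine le_trans ?_ (abs_re_le_norm _); rw [sub_re, hcre]; norm_num
      calc 1 ≤ 1 * 1 * (A ^ n * ‖Z c‖) := by linarith
        _ ≤ ‖c‖ * ‖1 - c‖ * (A ^ n * ‖Z c‖) := by gcongr
        _ = _ := by ring
    have hHc0 : 0 < ‖H c‖ := by
      by_contra h
      have : ‖H c‖ = 0 := le_antisymm (not_lt.1 h) (norm_nonneg _)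
      rw [this] at hHc; linarith
    have hsum := sum_zeroOrder_le hZ hHd hHZ hB1 (norm_pos_iff.1 hHc0) hb S ?_
    swap
    · intro ρ hρ
      obtain ⟨h1, h2, h3⟩ := hS ρ hρ
      refine ⟨by rintro rfl; simp at h2, ?_⟩
      refine abs_le_of_sq_le_sq' ?_ (by norm_num) |>.2
      rw [Complex.sq_norm, normSq_apply, sub_re, sub_im, hcre, hcim]
      rw [abs_le] at h3
      nlinarith
    refine hsum.trans ?_
    rw [div_mul_eq_mul_div]
    refine div_le_div_of_nonneg_right ?_ hLpos.le
    have e1 : Real.log (B / ‖H c‖) ≤ Real.log (B * A ^ n) := by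
      refine Real.log_le_log (by positivity) ?_
      rw [div_le_iff₀ hHc0]
      nlinarith
    refine e1.trans ?_
    have hlT8 : Real.log (T + 8) ≤ 4 * Real.log T := by
      have : (4 : ℝ) * Real.log T = Real.log (T ^ 4) := by rw [Real.log_pow]; norm_num
      rw [this]
      refine Real.log_le_log (by linarith) ?_
      nlinarith [mul_self_nonneg (T - 2), pow_le_pow_left₀ (by norm_num) hT 3]
    have hlT : Real.log 2 ≤ Real.log T := Real.log_le_log (by norm_num) hT
    have hlD : 0 ≤ Real.log D := Real.log_nonneg hD
    rw [hB, Real.log_mul (by positivity) (by positivity),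
      Real.log_mul (by positivity) (by positivity), Real.log_mul (by positivity) (by positivity),
      Real.log_mul (by positivity) (by positivity), Real.log_pow, Real.log_pow, Real.log_pow,
      Real.log_rpow (by linarith)]
    have hn1' : (1 : ℝ) ≤ n := by exact_mod_cast hn1
    have e2 : (((2 * n + 2 : ℕ)) : ℝ) * Real.log (T + 8) ≤ 16 * (n * Real.log T) := by
      push_cast
      have : Real.log T ≥ 0 := by linarith
      have h8 : 0 ≤ Real.log (T + 8) := Real.log_nonneg hT8
      calc (2 * (n : ℝ) + 2) * Real.log (T + 8) ≤ (4 * n) * (4 * Real.log T) := by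
            gcongr; linarith
        _ = _ := by ring
    have e3 : (n : ℝ) * (2 * Real.log A + Real.log 12) ≤
        (2 * Real.log A + Real.log 12) / Real.log 2 * (n * Real.log T) := by
      rw [div_mul_eq_mul_div, le_div_iff₀ hl2]
      have : (n : ℝ) * (2 * Real.log A + Real.log 12) * Real.log 2 ≤
        (n : ℝ) * (2 * Real.log A + Real.log 12) * Real.log T := by gcongr
      linarith
    have hq : 0 ≤ (2 * Real.log A + Real.log 12) / Real.log 2 := by positivity
    have hnT : 0 ≤ n * Real.log T := by
      have : 0 ≤ Real.log T := by linarith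
      positivity
    rw [hK]
    nlinarith [mul_nonneg hq hlD]
  have hlog0 : 0 ≤ Real.log T := Real.log_nonneg (by linarith)
  rw [← Finset.sum_filter_add_sum_filter_not S (fun ρ ↦ 0 ≤ ρ.im)]
  have k1 := key (T + 1 / 2) (abs_of_pos (by linarith)) (S.filter fun ρ ↦ 0 ≤ ρ.im) ?_
  · have k2 := key (-(T + 1 / 2)) (by rw [abs_neg, abs_of_pos (by linarith)])
      (S.filter fun ρ ↦ ¬ 0 ≤ ρ.im) ?_
    · linarith
    · intro ρ hρ
      rw [Finset.mem_filter] at hρ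
      obtain ⟨-, h1, h2, h3, h4⟩ := hS ρ hρ.1
      rw [abs_of_neg (not_le.1 hρ.2)] at h3 h4
      exact ⟨h1, h2, abs_le.2 ⟨by linarith, by linarith⟩⟩
  · intro ρ hρ
    rw [Finset.mem_filter] at hρ
    obtain ⟨-, h1, h2, h3, h4⟩ := hS ρ hρ.1
    rw [abs_of_nonneg hρ.2] at h3 h4
    exact ⟨h1, h2, abs_le.2 ⟨by linarith, by linarith⟩⟩

/-- The nonzero ideals all of whose prime divisors lie in `F`. -/
def smoothIdeals {R : Type*} [CommRing R] (F : Finset (Ideal R)) : Set (Ideal R) :=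
  {I | I ≠ ⊥ ∧ ∀ P, Prime P → P ∣ I → P ∈ F}

section Smooth

variable {R : Type*} [CommRing R] [IsDedekindDomain R]

lemma smoothIdeals_empty : smoothIdeals (∅ : Finset (Ideal R)) = {1} := by
  ext I
  simp only [smoothIdeals, Finset.notMem_empty, imp_false, Set.mem_ofPred_eq, Set.mem_singleton_iff]
  constructor
  · rintro ⟨h1, h2⟩
    by_contra h
    obtain ⟨P, hP, hPI⟩ := WfDvdMonoid.exists_irreducible_factor
      (fun hu ↦ h (Ideal.one_eq_top (R := R) ▸ Ideal.isUnit_iff.1 hu)) h1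
    exact h2 P hP.prime hPI
  · rintro rfl
    exact ⟨one_ne_zero, fun P hP h ↦ hP.not_isUnit (isUnit_of_dvd_one h)⟩

lemma bijective_pow_mul_smoothIdeals {F : Finset (Ideal R)} {P : Ideal R} (hP : Prime P)
    (hPF : P ∉ F) :
    ∃ e : ℕ × smoothIdeals F ≃ smoothIdeals (insert P F),
      ∀ x, (e x : Ideal R) = P ^ x.1 * x.2 := by
  have hmem : ∀ x : ℕ × smoothIdeals F, P ^ x.1 * x.2 ∈ smoothIdeals (insert P F) := by
    rintro ⟨k, I, hI0, hI⟩
    refine ⟨mul_ne_zero (pow_ne_zero _ hP.ne_zero) hI0, fun Q hQ hQd ↦ ?_⟩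
    rcases hQ.dvd_or_dvd hQd with h | h
    · have := hQ.dvd_of_dvd_pow h
      rw [Finset.mem_insert]
      left
      exact associated_iff_eq.1 ((hQ.dvd_prime_iff_associated hP).1 this)
    · exact Finset.mem_insert_of_mem (hI Q hQ h)
  have hnd : ∀ I : smoothIdeals F, ¬ P ∣ (I : Ideal R) := fun I h ↦ hPF (I.2.2 P hP h)
  refine ⟨Equiv.ofBijective (fun x ↦ ⟨P ^ x.1 * x.2, hmem x⟩) ⟨?_, ?_⟩, fun x ↦ rfl⟩
  · rintro ⟨k, I⟩ ⟨l, J⟩ h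
    have h : P ^ k * (I : Ideal R) = P ^ l * J := congrArg Subtype.val h
    have aux : ∀ (k l : ℕ) (I J : smoothIdeals F), P ^ k * (I : Ideal R) = P ^ l * J →
        ¬ k < l := by
      intro k l I J h hkl
      obtain ⟨m, rfl⟩ := Nat.exists_eq_add_of_lt hkl
      rw [add_assoc, pow_add, mul_assoc] at h
      have := mul_left_cancel₀ (pow_ne_zero _ hP.ne_zero) h
      refine hnd I ?_
      rw [this, pow_succ', mul_assoc]
      exact dvd_mul_right _ _
    have hkl : k = l := le_antisymm (not_lt.1 (aux _ _ _ _ h.symm)) (not_lt.1 (aux _ _ _ _ h))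
    subst hkl
    have := mul_left_cancel₀ (pow_ne_zero _ hP.ne_zero) h
    exact Prod.ext rfl (Subtype.ext this)
  · rintro ⟨I, hI0, hI⟩
    obtain ⟨c, hc, hPc⟩ := (FiniteMultiplicity.of_prime_left hP hI0).exists_eq_pow_mul_and_not_dvd
    refine ⟨⟨multiplicity P I, c, ?_, ?_⟩, Subtype.ext hc.symm⟩
    · rintro rfl
      exact hI0 (by rw [hc]; exact mul_zero _)
    · intro Q hQ hQc
      have : Q ∈ insert P F := hI Q hQ (by rw [hc]; exact hQc.mul_left _)
      rcases Finset.mem_insert.1 this with rfl | h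
      · exact absurd hQc hPc
      · exact h

lemma hasSum_smoothIdeals (f : Ideal R →* ℂ) (F : Finset (Ideal R))
    (hF : ∀ P ∈ F, Prime P ∧ ‖f P‖ < 1) :
    (Summable fun I : smoothIdeals F ↦ ‖f I‖) ∧
      HasSum (fun I : smoothIdeals F ↦ f I) (∏ P ∈ F, (1 - f P)⁻¹) := by
  induction F using Finset.induction_on with
  | empty =>
    have : Unique (smoothIdeals (∅ : Finset (Ideal R))) := by
      rw [smoothIdeals_empty]; infer_instance
    have h1 : ((default : smoothIdeals (∅ : Finset (Ideal R))) : Ideal R) = 1 := by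
      have h := (default : smoothIdeals (∅ : Finset (Ideal R))).2
      exact Set.mem_singleton_iff.1 (Set.ext_iff.1 smoothIdeals_empty _ |>.1 h)
    refine ⟨(hasSum_unique _).summable, ?_⟩
    have := hasSum_unique (fun I : smoothIdeals (∅ : Finset (Ideal R)) ↦ f I)
    rwa [h1, map_one] at this
  | insert P F hPF ih =>
    obtain ⟨ih1, ih2⟩ := ih fun Q hQ ↦ hF Q (Finset.mem_insert_of_mem hQ)
    obtain ⟨hP, hP1⟩ := hF P (Finset.mem_insert_self P F)
    obtain ⟨e, he⟩ := bijective_pow_mul_smoothIdeals hP hPF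
    have hg : Summable fun k : ℕ ↦ ‖f P ^ k‖ := by
      simpa only [norm_pow] using summable_geometric_of_lt_one (norm_nonneg _) hP1
    have hfe : ∀ x, f (e x) = f P ^ x.1 * f x.2 := fun x ↦ by rw [he, map_mul, map_pow]
    constructor
    · rw [← e.summable_iff]
      refine (hg.mul_of_nonneg ih1 (fun _ ↦ norm_nonneg _) fun _ ↦ norm_nonneg _).congr fun x ↦ ?_
      rw [Function.comp_apply, hfe, norm_mul]
    · rw [← e.hasSum_iff, Finset.prod_insert hPF]
      have h := tsum_mul_tsum_of_summable_norm hg ih1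
      rw [tsum_geometric_of_norm_lt_one hP1, ih2.tsum_eq] at h
      rw [h]
      have e2 : (fun I : smoothIdeals (insert P F) ↦ f I) ∘ e = fun x ↦ f P ^ x.1 * f x.2 :=
        funext hfe
      rw [e2]
      exact (summable_mul_of_summable_norm hg ih1).hasSum

end Smooth

section NumberField

variable (K : Type) [Field K] [NumberField K]

lemma card_filter_under_le (F : Finset (Ideal (𝓞 K))) (hF : ∀ P ∈ F, Prime P) (p : ℕ) :
    (F.filter fun P ↦ Ideal.absNorm (Ideal.under ℤ P) = p).card ≤ Module.finrank ℚ K := by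
  rcases (F.filter fun P ↦ Ideal.absNorm (Ideal.under ℤ P) = p).eq_empty_or_nonempty with h | ⟨P, hP⟩
  · rw [h]; simp
  rw [Finset.mem_filter] at hP
  have hPprime : P.IsPrime := Ideal.isPrime_of_prime (hF P hP.1)
  have : NeZero P := ⟨(hF P hP.1).ne_zero⟩
  have hp : p.Prime := hP.2 ▸ Nat.absNorm_under_prime P
  have hp0 : Ideal.span {(p : ℤ)} ≠ ⊥ := by simpa using hp.ne_zero
  have : (Ideal.span {(p : ℤ)}).IsMaximal :=
    have := Fact.mk hp
    Int.ideal_span_isMaximal_of_prime p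
  refine le_trans (Finset.card_le_card fun Q hQ ↦ ?_)
    (Ideal.card_primesOverFinset_le_finrank (𝓞 K) ℚ K hp0)
  rw [Finset.mem_filter] at hQ
  rw [IsDedekindDomain.mem_primesOverFinset_iff hp0]
  refine ⟨Ideal.isPrime_of_prime (hF Q hQ.1), ⟨?_⟩⟩
  rw [← hQ.2, Int.ideal_span_absNorm_eq_self]

lemma sum_absNorm_rpow_le {σ : ℝ} (hσ : 1 < σ) (F : Finset (Ideal (𝓞 K)))
    (hF : ∀ P ∈ F, Prime P) :
    ∑ P ∈ F, (Ideal.absNorm P : ℝ) ^ (-σ) ≤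
      Module.finrank ℚ K * ∑' m : ℕ, (m : ℝ) ^ (-σ) := by
  have hs : Summable fun m : ℕ ↦ (m : ℝ) ^ (-σ) := by
    rw [Real.summable_nat_rpow]; linarith
  set g : Ideal (𝓞 K) → ℕ := fun P ↦ Ideal.absNorm (Ideal.under ℤ P) with hg
  have h1 : ∀ P ∈ F, (Ideal.absNorm P : ℝ) ^ (-σ) ≤ (g P : ℝ) ^ (-σ) := by
    intro P hP
    have hPprime : P.IsPrime := Ideal.isPrime_of_prime (hF P hP)
    have : NeZero P := ⟨(hF P hP).ne_zero⟩
    have hp : (g P).Prime := Nat.absNorm_under_prime P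
    refine Real.rpow_le_rpow_of_nonpos (by exact_mod_cast hp.pos) ?_ (by linarith)
    have := Int.absNorm_under_dvd_absNorm P
    exact_mod_cast Nat.le_of_dvd
      (Nat.pos_of_ne_zero fun h ↦ (hF P hP).ne_zero (Ideal.absNorm_eq_zero_iff.1 h)) this
  calc _ ≤ ∑ P ∈ F, (g P : ℝ) ^ (-σ) := Finset.sum_le_sum h1
    _ = ∑ p ∈ F.image g, ∑ P ∈ F.filter (fun P ↦ g P = p), (g P : ℝ) ^ (-σ) :=
      (Finset.sum_fiberwise_of_maps_to (fun P hP ↦ Finset.mem_image_of_mem g hP) _).symm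
    _ ≤ ∑ p ∈ F.image g, Module.finrank ℚ K * (p : ℝ) ^ (-σ) := by
      refine Finset.sum_le_sum fun p _ ↦ ?_
      rw [Finset.sum_congr rfl (g := fun _ ↦ (p : ℝ) ^ (-σ))
        (fun P hP ↦ by rw [(Finset.mem_filter.1 hP).2]), Finset.sum_const, nsmul_eq_mul]
      have := card_filter_under_le K F hF p
      gcongr
    _ = Module.finrank ℚ K * ∑ p ∈ F.image g, (p : ℝ) ^ (-σ) := by rw [Finset.mul_sum]
    _ ≤ _ := by
      gcongr
      exact hs.sum_le_tsum _ fun _ _ ↦ by positivity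

/-- The completely multiplicative function `I ↦ N(I)^(-s)`. -/
def absNormCpow (s : ℂ) : Ideal (𝓞 K) →* ℂ where
  toFun I := (Ideal.absNorm I : ℂ) ^ (-s)
  map_one' := by simp
  map_mul' I J := by
    rw [map_mul, Nat.cast_mul, natCast_mul_natCast_cpow]

lemma two_le_absNorm {P : Ideal (𝓞 K)} (hP : Prime P) : 2 ≤ Ideal.absNorm P := by
  have h0 : Ideal.absNorm P ≠ 0 := fun h ↦ hP.ne_zero (Ideal.absNorm_eq_zero_iff.1 h)
  have h1 : Ideal.absNorm P ≠ 1 := fun h ↦ hP.not_isUnit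
    (Ideal.isUnit_iff.2 (Ideal.absNorm_eq_one_iff.1 h))
  omega

lemma norm_absNorm_cpow {I : Ideal (𝓞 K)} (hI : I ≠ ⊥) (s : ℂ) :
    ‖(Ideal.absNorm I : ℂ) ^ (-s)‖ = (Ideal.absNorm I : ℝ) ^ (-s.re) := by
  rw [norm_natCast_cpow_of_pos, neg_re]
  exact Nat.pos_of_ne_zero fun h ↦ hI (Ideal.absNorm_eq_zero_iff.1 h)

lemma absNorm_rpow_lt {P : Ideal (𝓞 K)} (hP : Prime P) {σ : ℝ} (hσ : 1 < σ) :
    (Ideal.absNorm P : ℝ) ^ (-σ) ≤ 1 / 2 := by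
  have h2 : (2 : ℝ) ≤ Ideal.absNorm P := by exact_mod_cast two_le_absNorm K hP
  calc (Ideal.absNorm P : ℝ) ^ (-σ) ≤ (2 : ℝ) ^ (-σ) :=
        Real.rpow_le_rpow_of_nonpos (by norm_num) h2 (by linarith)
    _ ≤ (2 : ℝ) ^ (-1 : ℝ) := Real.rpow_le_rpow_of_exponent_le (by norm_num) (by linarith)
    _ = 1 / 2 := by rw [Real.rpow_neg_one]; norm_num

lemma sum_absNorm_le {σ : ℝ} (hσ : 1 < σ) (S : Finset {I : Ideal (𝓞 K) // I ≠ ⊥}) :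
    ∑ I ∈ S, (Ideal.absNorm I.1 : ℝ) ^ (-σ) ≤
      Real.exp (2 * (Module.finrank ℚ K * ∑' m : ℕ, (m : ℝ) ^ (-σ))) := by
  set F : Finset (Ideal (𝓞 K)) :=
    S.biUnion fun I ↦ (UniqueFactorizationMonoid.normalizedFactors I.1).toFinset with hF
  have hFp : ∀ P ∈ F, Prime P := by
    intro P hP
    simp only [hF, Finset.mem_biUnion, Multiset.mem_toFinset] at hP
    obtain ⟨I, -, h⟩ := hP
    exact UniqueFactorizationMonoid.prime_of_normalized_factor P h
  have hsmooth : ∀ I ∈ S, I.1 ∈ smoothIdeals F := by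
    refine fun I hI ↦ ⟨I.2, fun P hP hPI ↦ ?_⟩
    simp only [hF, Finset.mem_biUnion, Multiset.mem_toFinset]
    exact ⟨I, hI, (UniqueFactorizationMonoid.mem_normalizedFactors_iff I.2).2 ⟨hP, hPI⟩⟩
  have hnorm : ∀ P ∈ F, absNormCpow K σ P = ((Ideal.absNorm P : ℝ) ^ (-σ) : ℝ) := by
    intro P hP
    rw [ofReal_cpow (Nat.cast_nonneg _)]; simp [absNormCpow]
  have hlt : ∀ P ∈ F, Prime P ∧ ‖absNormCpow K σ P‖ < 1 := by
    refine fun P hP ↦ ⟨hFp P hP, ?_⟩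
    rw [hnorm P hP, norm_real, Real.norm_of_nonneg (by positivity)]
    linarith [absNorm_rpow_lt K (hFp P hP) hσ]
  obtain ⟨h1, h2⟩ := hasSum_smoothIdeals (absNormCpow K σ) F hlt
  have h3 : (fun I : smoothIdeals F ↦ absNormCpow K σ I) =
      fun I ↦ (((Ideal.absNorm I.1 : ℝ) ^ (-σ) : ℝ) : ℂ) := by
    ext I
    rw [ofReal_cpow (Nat.cast_nonneg _)]; simp [absNormCpow]
  have h4 : ∏ P ∈ F, (1 - absNormCpow K σ P)⁻¹ =
      ((∏ P ∈ F, (1 - (Ideal.absNorm P : ℝ) ^ (-σ))⁻¹ : ℝ) : ℂ) := by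
    rw [ofReal_prod]
    refine Finset.prod_congr rfl fun P hP ↦ ?_
    rw [hnorm P hP]; push_cast; rfl
  rw [h3, h4, hasSum_ofReal] at h2
  calc ∑ I ∈ S, (Ideal.absNorm I.1 : ℝ) ^ (-σ)
      = ∑ I ∈ S.attach.map ⟨fun I ↦ (⟨I.1.1, hsmooth I.1 I.2⟩ : smoothIdeals F), fun I J h ↦ by
          exact Subtype.ext (Subtype.ext (Subtype.mk.inj h))⟩, (Ideal.absNorm I.1 : ℝ) ^ (-σ) := by
        rw [Finset.sum_map, ← Finset.sum_attach]; rfl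
    _ ≤ ∏ P ∈ F, (1 - (Ideal.absNorm P : ℝ) ^ (-σ))⁻¹ :=
        sum_le_hasSum _ (fun _ _ ↦ by positivity) h2
    _ ≤ ∏ P ∈ F, Real.exp (2 * (Ideal.absNorm P : ℝ) ^ (-σ)) := by
        have hx : ∀ P ∈ F, 0 < 1 - (Ideal.absNorm P : ℝ) ^ (-σ) := fun P hP ↦ by
          linarith [absNorm_rpow_lt K (hFp P hP) hσ]
        refine Finset.prod_le_prod (fun P hP ↦ (inv_pos.2 (hx P hP)).le) fun P hP ↦ ?_
        have h5 := absNorm_rpow_lt K (hFp P hP) hσ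
        have h6 : 0 ≤ (Ideal.absNorm P : ℝ) ^ (-σ) := by positivity
        set x := (Ideal.absNorm P : ℝ) ^ (-σ)
        rw [inv_le_iff_one_le_mul₀ (hx P hP)]
        have := Real.add_one_le_exp (2 * x)
        nlinarith
    _ = Real.exp (2 * ∑ P ∈ F, (Ideal.absNorm P : ℝ) ^ (-σ)) := by
        rw [← Real.exp_sum, Finset.mul_sum]
    _ ≤ _ := by
        have := sum_absNorm_rpow_le K hσ F hFp
        gcongr

lemma summable_absNorm_rpow {σ : ℝ} (hσ : 1 < σ) :
    Summable fun I : {I : Ideal (𝓞 K) // I ≠ ⊥} ↦ (Ideal.absNorm I.1 : ℝ) ^ (-σ) :=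
  summable_of_sum_le (fun _ ↦ by positivity) (sum_absNorm_le K hσ)

lemma summable_absNorm_cpow {s : ℂ} (hs : 1 < s.re) :
    Summable fun I : {I : Ideal (𝓞 K) // I ≠ ⊥} ↦ ‖(Ideal.absNorm I.1 : ℂ) ^ (-s)‖ :=
  (summable_absNorm_rpow K hs).congr fun I ↦ (norm_absNorm_cpow K I.2 s).symm

lemma norm_tsum_absNorm_cpow_le {s : ℂ} (hs : 2 ≤ s.re) :
    ‖∑' I : {I : Ideal (𝓞 K) // I ≠ ⊥}, (Ideal.absNorm I.1 : ℂ) ^ (-s)‖ ≤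
      Real.exp (2 * ∑' m : ℕ, (m : ℝ) ^ (-2 : ℝ)) ^ Module.finrank ℚ K := by
  refine (norm_tsum_le_tsum_norm (summable_absNorm_cpow K (by linarith))).trans ?_
  rw [← Real.exp_nat_mul]
  refine (Summable.tsum_le_of_sum_le (summable_absNorm_cpow K (by linarith)) fun S ↦ ?_).trans
    (le_of_eq (congrArg Real.exp (by ring :
      2 * (Module.finrank ℚ K * ∑' m : ℕ, (m : ℝ) ^ (-2 : ℝ)) = _)))
  refine le_trans (Finset.sum_le_sum fun I _ ↦ ?_) (sum_absNorm_le K (σ := 2) (by norm_num) S)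
  rw [norm_absNorm_cpow K I.2]
  have : 0 < Ideal.absNorm I.1 :=
    Nat.pos_of_ne_zero fun h ↦ I.2 (Ideal.absNorm_eq_zero_iff.1 h)
  exact Real.rpow_le_rpow_of_exponent_le (by exact_mod_cast this) (by linarith)

lemma one_le_mul_norm_tsum_absNorm_cpow {s : ℂ} (hs : 2 ≤ s.re) :
    1 ≤ Real.exp (2 * ∑' m : ℕ, (m : ℝ) ^ (-2 : ℝ)) ^ Module.finrank ℚ K *
      ‖∑' I : {I : Ideal (𝓞 K) // I ≠ ⊥}, (Ideal.absNorm I.1 : ℂ) ^ (-s)‖ := by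
  set E := Real.exp (2 * ∑' m : ℕ, (m : ℝ) ^ (-2 : ℝ)) ^ Module.finrank ℚ K with hE
  set g : {I : Ideal (𝓞 K) // I ≠ ⊥} → ℂ := fun I ↦ (Ideal.absNorm I.1 : ℂ) ^ (-s) with hg
  let toIdeals : Finset {P : Ideal (𝓞 K) // Prime P} → Finset (Ideal (𝓞 K)) :=
    fun F ↦ F.map (Function.Embedding.subtype _)
  have hprime : ∀ F, ∀ P ∈ toIdeals F, Prime P := by
    intro F P hP
    obtain ⟨Q, -, rfl⟩ := Finset.mem_map.1 hP
    exact Q.2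
  have hsm : ∀ P : Ideal (𝓞 K), Prime P →
      ‖absNormCpow K s P‖ ≤ (Ideal.absNorm P : ℝ) ^ (-2 : ℝ) := by
    intro P hP
    refine (norm_absNorm_cpow K hP.ne_zero s).le.trans ?_
    have : 1 ≤ Ideal.absNorm P := by linarith [two_le_absNorm K hP]
    exact Real.rpow_le_rpow_of_exponent_le (by exact_mod_cast this) (by linarith)
  have hlim : Tendsto (fun F : Finset {P : Ideal (𝓞 K) // Prime P} ↦
      ∑' I, (if I.1 ∈ smoothIdeals (toIdeals F) then g I else 0)) atTop (𝓝 (∑' I, g I)) := by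
    refine tendsto_tsum_of_dominated_convergence (bound := fun I ↦ ‖g I‖)
      (summable_absNorm_cpow K (by linarith)) (fun I ↦ ?_) (.of_forall fun F I ↦ ?_)
    · refine tendsto_const_nhds.congr' ?_
      set F₀ : Finset {P : Ideal (𝓞 K) // Prime P} :=
        (UniqueFactorizationMonoid.normalizedFactors I.1).toFinset.subtype _ with hF₀
      filter_upwards [eventually_ge_atTop F₀] with F hF
      rw [if_pos]
      refine ⟨I.2, fun P hP hPI ↦ Finset.mem_map.2 ⟨⟨P, hP⟩, hF ?_, rfl⟩⟩
      rw [hF₀, Finset.mem_subtype, Multiset.mem_toFinset]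
      exact (UniqueFactorizationMonoid.mem_normalizedFactors_iff I.2).2 ⟨hP, hPI⟩
    · split_ifs <;> simp
  have hbound : ∀ F : Finset {P : Ideal (𝓞 K) // Prime P},
      1 ≤ E * ‖∑' I, (if I.1 ∈ smoothIdeals (toIdeals F) then g I else 0)‖ := by
    intro F
    have hlt : ∀ P ∈ toIdeals F, Prime P ∧ ‖absNormCpow K s P‖ < 1 := fun P hP ↦
      ⟨hprime F P hP, by
        linarith [hsm P (hprime F P hP), absNorm_rpow_lt K (hprime F P hP) one_lt_two]⟩
    obtain ⟨-, h2⟩ := hasSum_smoothIdeals (absNormCpow K s) _ hlt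
    have e1 : ∑' I, (if I.1 ∈ smoothIdeals (toIdeals F) then g I else 0) =
        ∏ P ∈ toIdeals F, (1 - absNormCpow K s P)⁻¹ := by
      rw [← h2.tsum_eq]
      let i : smoothIdeals (toIdeals F) → {I : Ideal (𝓞 K) // I ≠ ⊥} := fun I ↦ ⟨I.1, I.2.1⟩
      have hi : Function.Injective i := fun I J h ↦ by
        exact Subtype.ext (Subtype.mk.inj h)
      rw [← hi.tsum_eq]
      · refine tsum_congr fun I ↦ ?_
        rw [if_pos (show (i I).1 ∈ _ from I.2)]; rfl
      · intro I hI
        rw [Function.mem_support] at hI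
        have : I.1 ∈ smoothIdeals (toIdeals F) := by
          by_contra h
          exact hI (if_neg h)
        exact ⟨⟨I.1, this⟩, rfl⟩
    rw [e1, norm_prod]
    have e2 : ∀ P ∈ toIdeals F, Real.exp (-(Ideal.absNorm P : ℝ) ^ (-2 : ℝ)) ≤
        ‖(1 - absNormCpow K s P)⁻¹‖ := by
      intro P hP
      have hP' := hprime F P hP
      rw [norm_inv, Real.exp_neg]
      have h0 : 0 < ‖1 - absNormCpow K s P‖ := by
        have := norm_sub_norm_le (1 : ℂ) (absNormCpow K s P)
        rw [norm_one] at this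
        linarith [(hlt P hP).2]
      refine inv_anti₀ h0 ?_
      have h1 := norm_sub_le (1 : ℂ) (absNormCpow K s P)
      rw [norm_one] at h1
      linarith [hsm P hP', Real.add_one_le_exp ((Ideal.absNorm P : ℝ) ^ (-2 : ℝ))]
    have e3 := Finset.prod_le_prod (fun P _ ↦ (Real.exp_pos _).le) e2
    have hE0 : 0 < E := by positivity
    refine le_trans ?_ (mul_le_mul_of_nonneg_left e3 hE0.le)
    rw [← Real.exp_sum, hE, ← Real.exp_nat_mul, ← Real.exp_add]
    refine Real.one_le_exp ?_
    rw [Finset.sum_neg_distrib]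
    have h5 := sum_absNorm_rpow_le K (σ := 2) (by norm_num) (toIdeals F) (hprime F)
    have h6 : 0 ≤ ∑ P ∈ toIdeals F, (Ideal.absNorm P : ℝ) ^ (-2 : ℝ) :=
      Finset.sum_nonneg fun _ _ ↦ by positivity
    nlinarith
  exact ge_of_tendsto' ((hlim.norm).const_mul E) hbound

end NumberField

section Tiling

variable {ι : Type*} [Fintype ι]

/-- The half-open unit box in `ι → ℝ`. -/
def unitBox (ι : Type*) : Set (ι → ℝ) := {x | ∀ i, x i ∈ Set.Ioc (0 : ℝ) 1}

/-- The real vector underlying an integral vector. -/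
def intVec {ι : Type*} (m : ι → ℤ) : ι → ℝ := fun i ↦ m i

lemma measurableSet_unitBox : MeasurableSet (unitBox ι) :=
  MeasurableSet.univ_pi' fun _ ↦ measurableSet_Ioc

lemma volume_unitBox : volume (unitBox ι) = 1 := by
  have : unitBox ι = Set.univ.pi fun _ ↦ Set.Ioc (0 : ℝ) 1 := by
    ext x; simp [unitBox]
  rw [this, volume_pi_pi]
  simp

lemma iUnion_preimage_unitBox :
    ⋃ m : ι → ℤ, (fun x ↦ x - intVec m) ⁻¹' unitBox ι = Set.univ := by
  refine Set.eq_univ_of_forall fun x ↦ Set.mem_iUnion.2 ⟨fun i ↦ ⌈x i⌉ - 1, fun i ↦ ?_⟩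
  have h₁ := Int.ceil_lt_add_one (x i)
  have h₂ := Int.le_ceil (x i)
  simp only [Pi.sub_apply, intVec, Set.mem_Ioc]
  push_cast
  constructor <;> linarith

lemma pairwise_disjoint_preimage_unitBox :
    Pairwise (Function.onFun Disjoint
      fun m : ι → ℤ ↦ (fun x ↦ x - intVec m) ⁻¹' unitBox ι) := by
  intro m m' hm
  refine Set.disjoint_left.2 fun x hx hx' ↦ hm (funext fun i ↦ ?_)
  have h₁ := hx i
  have h₂ := hx' i
  simp only [Pi.sub_apply, intVec, Set.mem_Ioc] at h₁ h₂
  have h₃ : (m i : ℝ) < m' i + 1 := by linarith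
  have h₄ : (m' i : ℝ) < m i + 1 := by linarith
  norm_cast at h₃ h₄
  omega

lemma measurableSet_preimage_unitBox (m : ι → ℤ) :
    MeasurableSet ((fun x ↦ x - intVec m) ⁻¹' unitBox ι) :=
  measurableSet_unitBox.preimage (by fun_prop)

lemma lintegral_eq_tsum_unitBox {h : (ι → ℝ) → ENNReal} (hh : Measurable h) :
    ∫⁻ x, h x = ∑' m : ι → ℤ, ∫⁻ x in unitBox ι, h (x + intVec m) := by
  rw [← setLIntegral_univ, ← iUnion_preimage_unitBox, lintegral_iUnion
    measurableSet_preimage_unitBox pairwise_disjoint_preimage_unitBox]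
  refine tsum_congr fun m ↦ ?_
  have := (measurePreserving_sub_right (volume : Measure (ι → ℝ))
    (intVec m)).setLIntegral_comp_preimage measurableSet_unitBox
    (f := fun x ↦ h (x + intVec m)) (by fun_prop)
  simpa using this

lemma hasSum_integral_unitBox {h : (ι → ℝ) → ℂ} (hh : Integrable h) :
    HasSum (fun m : ι → ℤ ↦ ∫ x in unitBox ι, h (x + intVec m)) (∫ x, h x) := by
  have := hasSum_integral_iUnion (f := h) (μ := volume) measurableSet_preimage_unitBox
    pairwise_disjoint_preimage_unitBox (by rw [iUnion_preimage_unitBox]; simpa using hh)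
  rw [iUnion_preimage_unitBox, setIntegral_univ] at this
  have hm : (fun m : ι → ℤ ↦ ∫ x in unitBox ι, h (x + intVec m)) =
      fun m ↦ ∫ x in (fun x ↦ x - intVec m) ⁻¹' unitBox ι, h x := by
    funext m
    have := (measurePreserving_sub_right (volume : Measure (ι → ℝ))
      (intVec m)).setIntegral_preimage_emb
      (MeasurableEquiv.subRight (intVec m)).measurableEmbedding
      (fun x ↦ h (x + intVec m)) (unitBox ι)
    simpa using this.symm
  rwa [hm]

end Tiling

section Poisson

variable {ι : Type*} [Fintype ι]

lemma tsum_comp_add_intVec (f : (ι → ℝ) → ℂ) (k : ι → ℤ) (x : ι → ℝ) :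
    ∑' m : ι → ℤ, f (x + intVec k + intVec m) = ∑' m : ι → ℤ, f (x + intVec m) := by
  rw [← (Equiv.addLeft k).tsum_eq fun m : ι → ℤ ↦ f (x + intVec m)]
  refine tsum_congr fun m ↦ congrArg f ?_
  ext i
  simp [intVec, add_assoc]

/-- The Poisson summation formula on `ι → ℝ`. -/
theorem tsum_eq_tsum_integral_of_summable {f : (ι → ℝ) → ℂ} (hf : Continuous f)
    (hfi : Integrable f)
    (hbd : ∀ R : ℝ, ∃ u : (ι → ℤ) → ℝ, Summable u ∧ ∀ m x, ‖x‖ ≤ R → ‖f (x + intVec m)‖ ≤ u m)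
    (hs : Summable fun k : ι → ℤ ↦
      ∫ x, cexp (-(2 * Real.pi * I * ∑ i, (k i : ℂ) * x i)) * f x) :
    ∑' m : ι → ℤ, f (intVec m) =
      ∑' k : ι → ℤ, ∫ x, cexp (-(2 * Real.pi * I * ∑ i, (k i : ℂ) * x i)) * f x := by
  set F : (ι → ℝ) → ℂ := fun x ↦ ∑' m : ι → ℤ, f (x + intVec m) with hF
  have hFc : Continuous F := by
    rw [continuous_iff_continuousAt]
    intro x
    obtain ⟨u, hu, hu'⟩ := hbd (‖x‖ + 1)
    have : ContinuousOn F (Metric.ball x 1) := by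
      refine continuousOn_tsum (fun m ↦ by fun_prop) hu fun m y hy ↦ hu' m y ?_
      have h₁ : ‖y - x‖ < 1 := by simpa [dist_eq_norm] using hy
      have h₂ := norm_le_norm_add_norm_sub' y x
      linarith
    exact this.continuousAt (Metric.ball_mem_nhds x one_pos)
  set q : (ι → ℝ) → UnitAddTorus ι := Pi.map fun _ x ↦ (x : UnitAddCircle)
  have hq : IsOpenQuotientMap q := IsOpenQuotientMap.piMap fun _ ↦
    QuotientAddGroup.isOpenQuotientMap_mk
  have hlift : ∀ x y, q x = q y → F x = F y := by
    intro x y hxy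
    have : ∀ i, ∃ k : ℤ, x i = y i + k := by
      intro i
      have := congrFun hxy i
      simp only [q, Pi.map_apply] at this
      obtain ⟨k, hk⟩ := (QuotientAddGroup.eq_iff_sub_mem.mp this : _ ∈ AddSubgroup.zmultiples _)
      exact ⟨k, by simp at hk; linarith⟩
    choose k hk using this
    have : x = y + intVec k := funext hk
    rw [this, hF]
    exact tsum_comp_add_intVec f k y
  let F' : C(UnitAddTorus ι, ℂ) := ⟨fun x ↦ F (Function.surjInv hq.surjective x), by
    rw [hq.isQuotientMap.continuous_iff]
    exact hFc.congr fun x ↦ hlift _ _ (Function.surjInv_eq hq.surjective _).symm⟩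
  have hF' : ∀ x, F' (q x) = F x := fun x ↦ hlift _ _ (Function.surjInv_eq hq.surjective _)
  have hcoeff : ∀ k : ι → ℤ, UnitAddTorus.mFourierCoeff F' k =
      ∫ x, cexp (-(2 * Real.pi * I * ∑ i, (k i : ℂ) * x i)) * f x := by
    intro k
    have hbox : {x : ι → ℝ | ∀ i, x i ∈ Set.Ioc ((0 : ι → ℝ) i) ((0 : ι → ℝ) i + 1)} =
        unitBox ι := by simp [unitBox]
    set e : (ι → ℝ) → ℂ := fun x ↦ cexp (-(2 * Real.pi * I * ∑ i, (k i : ℂ) * x i)) with he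
    have he1 : ∀ x, ‖e x‖ = 1 := by
      intro x
      rw [he, norm_exp]
      simp [Complex.mul_re, Complex.mul_im]
    have hec : Continuous e := by fun_prop
    have hem : ∀ x m, e (x + intVec m) = e x := by
      intro x m
      have : -(2 * Real.pi * I * ∑ i, (k i : ℂ) * ((x + intVec m) i : ℝ)) =
          -(2 * Real.pi * I * ∑ i, (k i : ℂ) * x i) +
          ((-∑ i, k i * m i : ℤ) : ℂ) * (2 * Real.pi * I) := by
        simp only [intVec, Pi.add_apply]
        push_cast
        simp only [mul_add, Finset.sum_add_distrib]
        ring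
      simp only [he, this, Complex.exp_add, Complex.exp_int_mul_two_pi_mul_I, mul_one]
    have hInt : Integrable fun x ↦ e x * f x :=
      hfi.bdd_mul hec.aestronglyMeasurable (.of_forall fun x ↦ (he1 x).le)
    rw [UnitAddTorus.mFourierCoeff_eq_integral _ k 0, hbox, ← (hasSum_integral_unitBox hInt).tsum_eq]
    obtain ⟨u, hu, hu'⟩ := hbd 1
    have hb1 : ∀ m, ∀ x ∈ unitBox ι, ‖e (x + intVec m) * f (x + intVec m)‖ ≤ u m := by
      intro m x hx
      rw [norm_mul, he1, one_mul]
      refine hu' m x ((pi_norm_le_iff_of_nonneg zero_le_one).2 fun i ↦ ?_)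
      rw [Real.norm_eq_abs, abs_le]
      exact ⟨by linarith [(hx i).1], (hx i).2⟩
    have hvol : volume.real (unitBox ι) = 1 := by simp [Measure.real, volume_unitBox]
    have hion : ∀ m, IntegrableOn (fun x ↦ e (x + intVec m) * f (x + intVec m)) (unitBox ι) :=
      fun m ↦ (hInt.comp_add_right (intVec m)).integrableOn
    rw [integral_tsum_of_summable_integral_norm hion]
    · refine setIntegral_congr_fun measurableSet_unitBox fun x _ ↦ ?_
      have h1 : UnitAddTorus.mFourier (-k) (fun i ↦ (x i : UnitAddCircle)) = e x := by
        simp only [UnitAddTorus.mFourier, ContinuousMap.coe_mk, fourier_coe_apply, he,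
          ← Complex.exp_sum]
        congr 1
        rw [Finset.mul_sum, ← Finset.sum_neg_distrib]
        refine Finset.sum_congr rfl fun i _ ↦ ?_
        push_cast [Pi.neg_apply]
        ring
      have h2 : F' (fun i ↦ (x i : UnitAddCircle)) = F x := hF' x
      simp only [h1, h2, hF, hem, smul_eq_mul]
      rw [tsum_mul_left]
    · refine hu.of_nonneg_of_le (fun m ↦ integral_nonneg fun _ ↦ norm_nonneg _) fun m ↦ ?_
      calc _ ≤ ∫ x in unitBox ι, u m :=
            setIntegral_mono_on (hion m).norm (by simp [volume_unitBox]) measurableSet_unitBox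
              (hb1 m)
        _ = u m := by simp [hvol]
  have := UnitAddTorus.hasSum_mFourier_series_apply_of_summable (f := F')
    (by simpa only [← hcoeff] using hs) 0
  have h0 : F' 0 = ∑' m : ι → ℤ, f (intVec m) := by
    have : (0 : UnitAddTorus ι) = q 0 := by ext; simp [q]
    rw [this, hF', hF]
    simp
  rw [← h0, ← this.tsum_eq]
  refine tsum_congr fun k ↦ ?_
  rw [hcoeff]
  have : UnitAddTorus.mFourier k 0 = 1 := by simp [UnitAddTorus.mFourier]
  rw [this, smul_eq_mul, mul_one]

end Poisson

section Gaussian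

variable {ι : Type*} [Fintype ι]

open Matrix

lemma summable_exp_neg_mul_sum_sq {c : ℝ} (hc : 0 < c) :
    Summable fun m : ι → ℤ ↦ Real.exp (-c * ∑ i, (m i : ℝ) ^ 2) := by
  have h1 : Summable fun k : ℤ ↦ Real.exp (-c * (k : ℝ) ^ 2) := by
    have := summable_pow_mul_jacobiTheta₂_term_bound 0 (T := c / Real.pi) (by positivity) 0
    refine this.congr fun k ↦ ?_
    simp only [pow_zero, one_mul]
    congr 1
    field_simp
    simp
  refine summable_of_sum_le (c := ∏ _i : ι, ∑' k : ℤ, Real.exp (-c * (k : ℝ) ^ 2))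
    (fun _ ↦ (Real.exp_pos _).le) fun S ↦ ?_
  calc _ ≤ ∑ m ∈ Fintype.piFinset fun i : ι ↦ S.image fun m : ι → ℤ ↦ m i,
        Real.exp (-c * ∑ i, (m i : ℝ) ^ 2) := by
        refine Finset.sum_le_sum_of_subset_of_nonneg (fun m hm ↦ ?_)
          fun _ _ _ ↦ (Real.exp_pos _).le
        exact Fintype.mem_piFinset.2 fun i ↦ Finset.mem_image_of_mem _ hm
    _ = ∏ i : ι, ∑ k ∈ S.image fun m : ι → ℤ ↦ m i, Real.exp (-c * (k : ℝ) ^ 2) := by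
        rw [Finset.prod_univ_sum]
        simp only [Finset.mul_sum, Real.exp_sum]
    _ ≤ _ := Finset.prod_le_prod (fun _ _ ↦ Finset.sum_nonneg fun _ _ ↦ (Real.exp_pos _).le)
        fun i _ ↦ h1.sum_le_tsum _ fun _ _ ↦ (Real.exp_pos _).le

lemma exists_mul_sum_sq_le {A : Matrix ι ι ℝ} (hA : IsUnit A.det) :
    ∃ c, 0 < c ∧ ∀ x : ι → ℝ, c * ∑ i, x i ^ 2 ≤ ∑ i, (A *ᵥ x) i ^ 2 := by
  have hcs : ∀ (B : Matrix ι ι ℝ) (x : ι → ℝ),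
      ∑ i, (B *ᵥ x) i ^ 2 ≤ (∑ i, ∑ j, B i j ^ 2) * ∑ j, x j ^ 2 := by
    intro B x
    rw [Finset.sum_mul]
    exact Finset.sum_le_sum fun i _ ↦ Finset.sum_mul_sq_le_sq_mul_sq _ _ _
  set M := ∑ i, ∑ j, A⁻¹ i j ^ 2
  have hM : 0 ≤ M := by positivity
  refine ⟨1 / (M + 1), by positivity, fun x ↦ ?_⟩
  have := hcs A⁻¹ (A *ᵥ x)
  rw [mulVec_mulVec, nonsing_inv_mul _ hA, one_mulVec] at this
  rw [one_div, inv_mul_le_iff₀ (by positivity)]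
  have : 0 ≤ ∑ i, (A *ᵥ x) i ^ 2 := by positivity
  linarith

lemma integral_exp_gaussian {A : Matrix ι ι ℝ} (hA : IsUnit A.det) (k : ι → ℤ) :
    ∫ x, cexp (-(2 * Real.pi * I * ∑ i, (k i : ℂ) * x i)) *
        cexp (-Real.pi * ∑ i, ((A *ᵥ x) i : ℂ) ^ 2) =
      (|A.det|⁻¹ * Real.exp (-Real.pi * ∑ i, (A⁻¹ᵀ *ᵥ intVec k) i ^ 2) : ℝ) := by
  set w := A⁻¹ᵀ *ᵥ intVec k
  set g : (ι → ℝ) → ℂ := fun y ↦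
    cexp (-(Real.pi : ℂ) * ∑ i, (y i : ℂ) ^ 2 + ∑ i, (-(2 * Real.pi * I * w i)) * y i) with hg
  have h1 : ∀ x, cexp (-(2 * Real.pi * I * ∑ i, (k i : ℂ) * x i)) *
        cexp (-Real.pi * ∑ i, ((A *ᵥ x) i : ℂ) ^ 2) = g (A.toLin' x) := by
    intro x
    rw [hg, ← Complex.exp_add, add_comm]
    simp only [toLin'_apply]
    congr 2
    have : ∑ i, (k i : ℝ) * x i = ∑ i, w i * (A *ᵥ x) i := by
      change intVec k ⬝ᵥ x = w ⬝ᵥ (A *ᵥ x)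
      rw [dotProduct_mulVec, ← mulVec_transpose, mulVec_mulVec, ← transpose_mul,
        nonsing_inv_mul _ hA, transpose_one, one_mulVec]
    have : ∑ i, (k i : ℂ) * x i = ∑ i, (w i : ℂ) * ((A *ᵥ x) i : ℝ) := by exact_mod_cast this
    rw [this, Finset.mul_sum, ← Finset.sum_neg_distrib]
    exact Finset.sum_congr rfl fun i _ ↦ by ring
  have hdet : LinearMap.det A.toLin' ≠ 0 := by rw [LinearMap.det_toLin']; exact hA.ne_zero
  have h2 := Real.map_linearMap_volume_pi_eq_smul_volume_pi hdet
  have hgc : Continuous g := by fun_prop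
  have hm : Measurable A.toLin' := A.toLin'.continuous_of_finiteDimensional.measurable
  calc _ = ∫ x, g (A.toLin' x) := integral_congr_ae (.of_forall h1)
    _ = ∫ y, g y ∂(volume.map A.toLin') :=
      (integral_map hm.aemeasurable hgc.aestronglyMeasurable).symm
    _ = _ := by
      rw [h2, integral_smul_measure, LinearMap.det_toLin', hg,
        GaussianFourier.integral_cexp_neg_mul_sum_add (by simpa using Real.pi_pos)]
      have hpi : (Real.pi : ℂ) ≠ 0 := by exact_mod_cast Real.pi_ne_zero
      rw [div_self hpi, Complex.one_cpow, one_mul, ENNReal.toReal_ofReal (abs_nonneg _)]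
      push_cast
      rw [abs_inv, Complex.real_smul]
      push_cast
      congr 2
      rw [Finset.sum_div, Finset.mul_sum]
      refine Finset.sum_congr rfl fun i _ ↦ ?_
      field_simp
      ring_nf
      simp

lemma summable_exp_gaussian {A : Matrix ι ι ℝ} (hA : IsUnit A.det) :
    Summable fun m : ι → ℤ ↦ Real.exp (-Real.pi * ∑ i, (A *ᵥ intVec m) i ^ 2) := by
  obtain ⟨c, hc, hcA⟩ := exists_mul_sum_sq_le hA
  refine (summable_exp_neg_mul_sum_sq (c := Real.pi * c)
      (by positivity)).of_nonneg_of_le (fun _ ↦ (Real.exp_pos _).le) fun k ↦ ?_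
  rw [Real.exp_le_exp]
  have := mul_le_mul_of_nonneg_left (hcA (intVec k)) Real.pi_pos.le
  simp only [intVec] at this ⊢
  linarith

theorem tsum_exp_gaussian {A : Matrix ι ι ℝ} (hA : IsUnit A.det) :
    ∑' m : ι → ℤ, Real.exp (-Real.pi * ∑ i, (A *ᵥ intVec m) i ^ 2) =
      |A.det|⁻¹ * ∑' m : ι → ℤ, Real.exp (-Real.pi * ∑ i, (A⁻¹ᵀ *ᵥ intVec m) i ^ 2) := by
  obtain ⟨c, hc, hcA⟩ := exists_mul_sum_sq_le hA
  set f : (ι → ℝ) → ℂ := fun x ↦ cexp (-Real.pi * ∑ i, ((A *ᵥ x) i : ℂ) ^ 2) with hf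
  have hfr : ∀ x, f x = (Real.exp (-Real.pi * ∑ i, (A *ᵥ x) i ^ 2) : ℝ) := fun x ↦ by
    rw [hf]; push_cast; rfl
  have hlin : Continuous fun x ↦ A *ᵥ x := (Matrix.mulVecLin A).continuous_of_finiteDimensional
  have hfc : Continuous f := by
    rw [hf]
    have : ∀ i, Continuous fun x ↦ (A *ᵥ x) i := fun i ↦ (continuous_apply i).comp hlin
    fun_prop
  have hfn : ∀ x, ‖f x‖ ≤ Real.exp (-(Real.pi * c) * ∑ i, x i ^ 2) := by
    intro x
    rw [hfr, Complex.norm_real, Real.norm_of_nonneg (Real.exp_pos _).le, Real.exp_le_exp]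
    have := mul_le_mul_of_nonneg_left (hcA x) Real.pi_pos.le
    linarith
  have hfi : Integrable f := by
    have h := GaussianFourier.integrable_cexp_neg_mul_sum_add (b := ((Real.pi * c : ℝ) : ℂ))
      (by rw [ofReal_re]; positivity) (0 : ι → ℂ)
    refine h.mono hfc.aestronglyMeasurable (.of_forall fun x ↦ (hfn x).trans ?_)
    rw [norm_exp, Real.exp_le_exp]
    apply le_of_eq
    have : (-((Real.pi * c : ℝ) : ℂ) * ∑ i, (x i : ℂ) ^ 2 + ∑ i, (0 : ι → ℂ) i * x i) =
      ((-(Real.pi * c) * ∑ i, x i ^ 2 : ℝ) : ℂ) := by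
      push_cast; simp
    rw [this, ofReal_re]
  have hbd : ∀ R : ℝ, ∃ u : (ι → ℤ) → ℝ, Summable u ∧
      ∀ m x, ‖x‖ ≤ R → ‖f (x + intVec m)‖ ≤ u m := by
    intro R
    refine ⟨fun m ↦ Real.exp (Real.pi * c * (Fintype.card ι * R ^ 2)) *
      Real.exp (-(Real.pi * c / 2) * ∑ i, (m i : ℝ) ^ 2),
      (summable_exp_neg_mul_sum_sq (by positivity)).mul_left _, fun m x hx ↦ (hfn _).trans ?_⟩
    beta_reduce
    rw [← Real.exp_add, Real.exp_le_exp]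
    have : (1 / 2) * ∑ i, (m i : ℝ) ^ 2 - Fintype.card ι * R ^ 2 ≤
        ∑ i, (x + intVec m) i ^ 2 := by
      have : (Fintype.card ι * R ^ 2 : ℝ) = ∑ _i : ι, R ^ 2 := by simp
      rw [this, Finset.mul_sum, ← Finset.sum_sub_distrib]
      refine Finset.sum_le_sum fun i _ ↦ ?_
      have h1 : |x i| ≤ R := (norm_le_pi_norm x i).trans hx
      have h2 : x i ^ 2 ≤ R ^ 2 := sq_le_sq' (by linarith [neg_abs_le (x i)])
        ((le_abs_self _).trans h1)
      simp only [Pi.add_apply, intVec]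
      nlinarith [sq_nonneg ((m i : ℝ) / 2 + x i), sq_nonneg ((m i : ℝ) + 2 * x i)]
    have := mul_le_mul_of_nonneg_left this (mul_pos Real.pi_pos hc).le
    linarith
  have hs : Summable fun k : ι → ℤ ↦
      |A.det|⁻¹ * Real.exp (-Real.pi * ∑ i, (A⁻¹ᵀ *ᵥ intVec k) i ^ 2) :=
    (summable_exp_gaussian (by
      rw [det_transpose]; exact isUnit_nonsing_inv_det A hA)).mul_left _
  have key := tsum_eq_tsum_integral_of_summable hfc hfi hbd (by
    simp only [hf, integral_exp_gaussian hA]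
    exact_mod_cast hs)
  simp only [hf, integral_exp_gaussian hA] at key
  rw [← tsum_mul_left]
  have h2 : ∀ m : ι → ℤ, f (intVec m) =
    ((Real.exp (-Real.pi * ∑ i, (A *ᵥ intVec m) i ^ 2) : ℝ) : ℂ) := fun m ↦ hfr _
  simp only [hf] at h2
  simp only [h2] at key
  exact_mod_cast key

end Gaussian

/-- The Gaussian `exp (-π x)`, as an extended nonnegative real. -/
def gaussE (x : ℝ) : ENNReal := ENNReal.ofReal (Real.exp (-Real.pi * x))

section

open Matrix
open scoped MatrixOrder ComplexConjugate

variable {ι : Type*} [Fintype ι]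

theorem tsum_gaussE_of_posDef {G G' : Matrix ι ι ℝ} (hG : G.PosDef) (hGG' : G * G' = 1) :
    ∑' m : ι → ℤ, gaussE (intVec m ⬝ᵥ G *ᵥ intVec m) =
      ENNReal.ofReal (√G.det)⁻¹ * ∑' m : ι → ℤ, gaussE (intVec m ⬝ᵥ G' *ᵥ intVec m) := by
  obtain ⟨A, hA⟩ : ∃ A : Matrix ι ι ℝ, G = Aᵀ * A := by
    obtain ⟨B, hB⟩ := CStarAlgebra.nonneg_iff_eq_star_mul_self.mp hG.posSemidef.nonneg
    exact ⟨B, by rw [hB, star_eq_conjTranspose, conjTranspose_eq_transpose_of_trivial]⟩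
  have hdet : G.det = A.det ^ 2 := by rw [hA, det_mul, det_transpose, sq]
  have hA' : IsUnit A.det := by
    have := hG.det_pos
    rw [hdet] at this
    exact isUnit_iff_ne_zero.2 fun h ↦ by simp [h] at this
  have hG' : G' = A⁻¹ * A⁻¹ᵀ := by
    rw [← inv_eq_right_inv hGG', hA, Matrix.mul_inv_rev, transpose_nonsing_inv]
  have hq : ∀ (B : Matrix ι ι ℝ) (x : ι → ℝ), x ⬝ᵥ (Bᵀ * B) *ᵥ x = ∑ i, (B *ᵥ x) i ^ 2 := by
    intro B x
    rw [← mulVec_mulVec, dotProduct_mulVec, vecMul_transpose]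
    simp [dotProduct, sq]
  have h2 : ∀ x, x ⬝ᵥ G' *ᵥ x = ∑ i, (A⁻¹ᵀ *ᵥ x) i ^ 2 := fun x ↦ by
    rw [← hq, transpose_transpose, hG']
  have hB' : IsUnit (A⁻¹ᵀ).det := by
    rw [det_transpose]; exact isUnit_nonsing_inv_det A hA'
  simp only [h2, hA, hq, gaussE]
  rw [← hA, hdet, Real.sqrt_sq_eq_abs, ← ENNReal.ofReal_tsum_of_nonneg
    (fun _ ↦ (Real.exp_pos _).le) (summable_exp_gaussian hA'),
    ← ENNReal.ofReal_tsum_of_nonneg (fun _ ↦ (Real.exp_pos _).le) (summable_exp_gaussian hB'),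
    ← ENNReal.ofReal_mul (by positivity), tsum_exp_gaussian hA']

end

section

variable (K : Type) [Field K] [NumberField K]

variable {K}

/-- The quadratic form `∑ y_v |x|_v ^ 2` on `K`, the sum over complex embeddings. -/
def placeForm (y : InfinitePlace K → ℝ) (x : K) : ℝ := ∑ v, v.mult * (y v * v x ^ 2)

lemma sum_embeddings (f : InfinitePlace K → ℝ) :
    ∑ φ : K →+* ℂ, f (InfinitePlace.mk φ) = ∑ v, v.mult * f v := by
  rw [← Finset.sum_fiberwise_of_maps_to (s := Finset.univ) (t := Finset.univ)
    (g := InfinitePlace.mk) (fun _ _ ↦ Finset.mem_univ _)]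
  refine Finset.sum_congr rfl fun v _ ↦ ?_
  rw [Finset.sum_congr rfl (g := fun _ ↦ f v) (by simp +contextual), Finset.sum_const,
    InfinitePlace.card_filter_mk_eq, nsmul_eq_mul]

lemma prod_embeddings (f : InfinitePlace K → ℝ) :
    ∏ φ : K →+* ℂ, f (InfinitePlace.mk φ) = ∏ v, f v ^ v.mult := by
  rw [← Finset.prod_fiberwise_of_maps_to (s := Finset.univ) (t := Finset.univ)
    (g := InfinitePlace.mk) (fun _ _ ↦ Finset.mem_univ _)]
  refine Finset.prod_congr rfl fun v _ ↦ ?_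
  rw [Finset.prod_congr rfl (g := fun _ ↦ f v) (by simp +contextual), Finset.prod_const,
    InfinitePlace.card_filter_mk_eq]

open Matrix
open scoped ComplexConjugate

variable {ι : Type*} [Fintype ι]

/-- The Gram matrix of `placeForm y`. -/
def placeGram (y : InfinitePlace K → ℝ) (b : ι → K) : Matrix ι ι ℝ :=
  .of fun i j ↦ ∑ φ : K →+* ℂ, y (InfinitePlace.mk φ) * (conj (φ (b i)) * φ (b j)).re

lemma ofReal_placeGram (y : InfinitePlace K → ℝ) (b : ι → K) (i j : ι) :
    (placeGram y b i j : ℂ) =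
      ∑ φ : K →+* ℂ, conj (φ (b i)) * y (InfinitePlace.mk φ) * φ (b j) := by
  set f : (K →+* ℂ) → ℂ := fun φ ↦ conj (φ (b i)) * y (InfinitePlace.mk φ) * φ (b j) with hf
  have hre : placeGram y b i j = (∑ φ, f φ).re := by
    rw [placeGram, of_apply, Complex.re_sum]
    refine Finset.sum_congr rfl fun φ _ ↦ ?_
    rw [hf, ← Complex.re_ofReal_mul]
    congr 1
    ring
  rw [hre]
  refine (Complex.conj_eq_iff_re.mp ?_)
  rw [map_sum]
  refine Fintype.sum_equiv (ComplexEmbedding.involutive_conjugate K).toPerm _ _ fun φ ↦ ?_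
  simp [hf, ComplexEmbedding.conjugate_coe_eq, InfinitePlace.mk_conjugate_eq]

lemma dotProduct_placeGram (y : InfinitePlace K → ℝ) (b : ι → K) (x : ι → ℝ) :
    x ⬝ᵥ placeGram y b *ᵥ x =
      ∑ φ : K →+* ℂ, y (InfinitePlace.mk φ) * ‖∑ i, (x i : ℂ) * φ (b i)‖ ^ 2 := by
  have h1 : ∀ φ : K →+* ℂ, ((y (InfinitePlace.mk φ) * ‖∑ i, (x i : ℂ) * φ (b i)‖ ^ 2 : ℝ) : ℂ) =
      ∑ i, ∑ j, (x i : ℂ) * x j * (conj (φ (b i)) * y (InfinitePlace.mk φ) * φ (b j)) := by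
    intro φ
    push_cast
    rw [← Complex.conj_mul', map_sum, Finset.sum_mul_sum, Finset.mul_sum]
    refine Finset.sum_congr rfl fun i _ ↦ ?_
    rw [Finset.mul_sum]
    refine Finset.sum_congr rfl fun j _ ↦ ?_
    rw [map_mul, Complex.conj_ofReal]
    ring
  rw [← Complex.ofReal_inj, Complex.ofReal_sum, Finset.sum_congr rfl fun φ _ ↦ h1 φ,
    Finset.sum_comm]
  simp only [dotProduct, mulVec, Complex.ofReal_sum, Complex.ofReal_mul, ofReal_placeGram]
  refine Finset.sum_congr rfl fun i _ ↦ ?_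
  rw [Finset.sum_comm, Finset.mul_sum]
  refine Finset.sum_congr rfl fun j _ ↦ ?_
  rw [Finset.sum_mul, Finset.mul_sum]
  refine Finset.sum_congr rfl fun φ _ ↦ by ring

lemma placeForm_eq (y : InfinitePlace K → ℝ) (b : ι → K) (m : ι → ℤ) :
    placeForm y (∑ i, m i • b i) = intVec m ⬝ᵥ placeGram y b *ᵥ intVec m := by
  rw [dotProduct_placeGram, placeForm, ← sum_embeddings]
  refine Finset.sum_congr rfl fun φ _ ↦ ?_
  rw [InfinitePlace.apply, map_sum]
  simp [intVec]

/-- The matrix of a basis under the complex embeddings. -/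
def embMatrix (e : ι ≃ (K →+* ℂ)) (b : ι → K) : Matrix ι ι ℂ := .of fun j i ↦ e j (b i)

lemma exists_equiv_embeddings (b : Module.Basis ι ℚ K) : Nonempty (ι ≃ (K →+* ℂ)) :=
  ⟨Fintype.equivOfCardEq (by rw [Embeddings.card, Module.finrank_eq_card_basis b])⟩

lemma map_placeGram (e : ι ≃ (K →+* ℂ)) (y : InfinitePlace K → ℝ) (b : ι → K) :
    (placeGram y b).map ofReal = (embMatrix e b)ᴴ *
      diagonal (fun i ↦ (y (InfinitePlace.mk (e i)) : ℂ)) * embMatrix e b := by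
  ext i j
  rw [map_apply, ofReal_placeGram, mul_apply, ← e.sum_comp]
  simp [mul_diagonal, embMatrix]

lemma embMatrix_transpose_mul (e : ι ≃ (K →+* ℂ)) (b b' : ι → K) (i j : ι) :
    ((embMatrix e b)ᵀ * embMatrix e b') i j = (Algebra.trace ℚ K (b i * b' j) : ℂ) := by
  have := trace_eq_sum_embeddings (K := ℚ) ℂ (x := b i * b' j)
  rw [eq_ratCast] at this
  rw [this, mul_apply, ← (e.trans (RingHom.equivRatAlgHom K ℂ)).sum_comp]
  simp [embMatrix]

lemma norm_det_embMatrix_sq (e : ι ≃ (K →+* ℂ)) (b : Module.Basis ι ℚ K) :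
    ‖(embMatrix e b).det‖ ^ 2 = |(Algebra.discr ℚ b : ℝ)| := by
  have h : (embMatrix e b).det ^ 2 = ((Algebra.discr ℚ b : ℝ) : ℂ) := by
    have : (embMatrix e b)ᵀ * embMatrix e b =
        ((algebraMap ℚ ℂ).mapMatrix (Algebra.traceMatrix ℚ b)) := by
      ext i j
      rw [embMatrix_transpose_mul]
      simp [Algebra.traceMatrix, Algebra.traceForm_apply]
    rw [sq]
    nth_rewrite 1 [← det_transpose]
    rw [← det_mul, this, ← RingHom.map_det, Algebra.discr_def]
    simp
  rw [← norm_pow, h, Complex.norm_real, Real.norm_eq_abs]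

lemma det_embMatrix_ne_zero (e : ι ≃ (K →+* ℂ)) (b : Module.Basis ι ℚ K) :
    (embMatrix e b).det ≠ 0 := by
  intro h
  have := norm_det_embMatrix_sq e b
  rw [h, norm_zero, zero_pow two_ne_zero, eq_comm, abs_eq_zero] at this
  exact Algebra.discr_not_zero_of_basis ℚ b (by exact_mod_cast this)

lemma posDef_placeGram {y : InfinitePlace K → ℝ} (hy : ∀ v, 0 < y v) (b : Module.Basis ι ℚ K) :
    (placeGram y b).PosDef := by
  obtain ⟨e⟩ := exists_equiv_embeddings b
  refine PosDef.of_dotProduct_mulVec_pos ?_ fun x hx ↦ ?_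
  · ext i j
    rw [conjTranspose_apply, star_trivial, ← Complex.ofReal_inj, ← Complex.conj_ofReal,
      ofReal_placeGram, ofReal_placeGram, map_sum]
    refine Finset.sum_congr rfl fun φ _ ↦ ?_
    simp
    ring
  · rw [star_trivial, dotProduct_placeGram]
    refine lt_of_le_of_ne (Finset.sum_nonneg fun φ _ ↦ by have := hy (.mk φ); positivity) ?_
    intro h
    rw [eq_comm, Finset.sum_eq_zero_iff_of_nonneg
      (fun φ _ ↦ by have := hy (.mk φ); positivity)] at h
    refine hx ?_
    have hE : embMatrix e b *ᵥ (fun i ↦ (x i : ℂ)) = 0 := by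
      ext j
      have := h (e j) (Finset.mem_univ _)
      have h' := (hy (.mk (e j))).ne'
      simp only [mul_eq_zero, h', false_or, pow_eq_zero_iff two_ne_zero, norm_eq_zero] at this
      simpa [embMatrix, mulVec, dotProduct, mul_comm] using this
    have := eq_zero_of_mulVec_eq_zero (det_embMatrix_ne_zero e b) hE
    ext i
    simpa using congrFun this i

lemma det_placeGram (y : InfinitePlace K → ℝ) (b : Module.Basis ι ℚ K) :
    (placeGram y b).det = |(Algebra.discr ℚ b : ℝ)| * ∏ v, y v ^ v.mult := by
  obtain ⟨e⟩ := exists_equiv_embeddings b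
  have h : ((placeGram y b).det : ℂ) = ((placeGram y b).map ofReal).det :=
    RingHom.map_det ofRealHom _
  rw [← Complex.ofReal_inj, h, map_placeGram e, det_mul, det_mul, det_conjTranspose, det_diagonal,
    ← norm_det_embMatrix_sq e, ← prod_embeddings, ← e.prod_comp]
  push_cast
  rw [← Complex.conj_mul']
  simp only [RCLike.star_def]
  ring

lemma placeGram_mul {y : InfinitePlace K → ℝ} (hy : ∀ v, 0 < y v) {b b' : Module.Basis ι ℚ K}
    (hb : ∀ i j, Algebra.trace ℚ K (b i * b' j) = if i = j then 1 else 0) :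
    placeGram y b * placeGram y⁻¹ b' = 1 := by
  obtain ⟨e⟩ := exists_equiv_embeddings b
  have h1 : (embMatrix e b)ᵀ * embMatrix e b' = 1 := by
    ext i j
    rw [embMatrix_transpose_mul, hb, one_apply]
    split_ifs <;> simp
  have h2 : embMatrix e b * (embMatrix e b')ᵀ = 1 := by
    rw [← transpose_inj, transpose_mul, transpose_transpose, transpose_one]
    exact mul_eq_one_comm.mp h1
  have h3 : (embMatrix e b)ᴴ * (embMatrix e b').map conj = 1 := by
    have := congrArg (fun A : Matrix ι ι ℂ ↦ A.map conj) h1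
    simp only [Matrix.map_mul] at this
    rw [Matrix.map_one _ (map_zero _) (map_one _)] at this
    exact this
  have h4 : (placeGram y⁻¹ b').map ofReal = (embMatrix e b')ᵀ *
      diagonal (fun i ↦ ((y (InfinitePlace.mk (e i)))⁻¹ : ℂ)) * (embMatrix e b').map conj := by
    have h := congrArg (fun A : Matrix ι ι ℂ ↦ A.map conj) (map_placeGram e y⁻¹ b')
    have h5 : ((placeGram y⁻¹ b').map ofReal).map conj = (placeGram y⁻¹ b').map ofReal := by
      ext i j; simp
    simp only [h5, Matrix.map_mul] at h
    rw [h]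
    congr 2
    · ext i j; simp [embMatrix]
    · ext i j; by_cases hij : i = j <;> simp [hij]
  have h6 : diagonal (fun i ↦ (y (InfinitePlace.mk (e i)) : ℂ)) *
      diagonal (fun i ↦ ((y (InfinitePlace.mk (e i)))⁻¹ : ℂ)) = 1 := by
    rw [diagonal_mul_diagonal, ← diagonal_one]
    congr 1
    ext i
    exact mul_inv_cancel₀ (by exact_mod_cast (hy _).ne')
  refine Matrix.map_injective Complex.ofReal_injective ?_
  beta_reduce
  have hmul := Matrix.map_mul (f := ofRealHom) (L := placeGram y b) (M := placeGram y⁻¹ b')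
  refine hmul.trans ?_
  change (placeGram y b).map ofReal * (placeGram y⁻¹ b').map ofReal = _
  rw [map_placeGram e, h4, Matrix.map_one _ ofReal_zero ofReal_one]
  calc _ = (embMatrix e b)ᴴ * (diagonal (fun i ↦ (y (InfinitePlace.mk (e i)) : ℂ)) *
      (embMatrix e b * (embMatrix e b')ᵀ) * diagonal (fun i ↦ ((y (InfinitePlace.mk (e i)))⁻¹ : ℂ)))
        * (embMatrix e b').map conj := by simp only [Matrix.mul_assoc]
    _ = 1 := by rw [h2, Matrix.mul_one, h6, Matrix.mul_one, h3]

theorem tsum_gaussE_placeForm {y : InfinitePlace K → ℝ} (hy : ∀ v, 0 < y v)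
    {b b' : Module.Basis ι ℚ K}
    (hb : ∀ i j, Algebra.trace ℚ K (b i * b' j) = if i = j then 1 else 0) :
    ∑' m : ι → ℤ, gaussE (placeForm y (∑ i, m i • b i)) =
      ENNReal.ofReal (√(|(Algebra.discr ℚ b : ℝ)| * ∏ v, y v ^ v.mult))⁻¹ *
        ∑' m : ι → ℤ, gaussE (placeForm y⁻¹ (∑ i, m i • b' i)) := by
  simp only [placeForm_eq, ← det_placeGram]
  exact tsum_gaussE_of_posDef (posDef_placeGram hy b) (placeGram_mul hy hb)

end

section

open scoped nonZeroDivisors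

variable {K : Type} [Field K] [NumberField K]

/-- The theta series of a fractional ideal with scaling parameters `y`. -/
def thetaE (I : (FractionalIdeal (𝓞 K)⁰ K)ˣ) (y : InfinitePlace K → ℝ) : ENNReal :=
  ∑' x : {x : K // x ∈ (I : FractionalIdeal (𝓞 K)⁰ K)}, gaussE (placeForm y x)

/-- The dual of an invertible fractional ideal with respect to the trace form. -/
def dualIdeal (I : (FractionalIdeal (𝓞 K)⁰ K)ˣ) : (FractionalIdeal (𝓞 K)⁰ K)ˣ :=
  Units.mk0 (FractionalIdeal.dual ℤ ℚ (I : FractionalIdeal (𝓞 K)⁰ K))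
    (FractionalIdeal.dual_ne_zero ℤ ℚ I.ne_zero)

lemma thetaE_eq_tsum {ι : Type*} [Fintype ι] (I : (FractionalIdeal (𝓞 K)⁰ K)ˣ)
    (b : Module.Basis ι ℚ K)
    (hb : ∀ x, x ∈ Submodule.span ℤ (Set.range b) ↔ x ∈ (I : FractionalIdeal (𝓞 K)⁰ K))
    (y : InfinitePlace K → ℝ) :
    thetaE I y = ∑' m : ι → ℤ, gaussE (placeForm y (∑ i, m i • b i)) := by
  have hmem : ∀ m : ι → ℤ, ∑ i, m i • b i ∈ (I : FractionalIdeal (𝓞 K)⁰ K) := fun m ↦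
    (hb _).1 (Submodule.sum_mem _ fun i _ ↦ Submodule.smul_mem _ _
      (Submodule.subset_span ⟨i, rfl⟩))
  have hli : LinearIndependent ℤ b := b.linearIndependent.restrict_scalars' ℤ
  let e : (ι → ℤ) ≃ {x : K // x ∈ (I : FractionalIdeal (𝓞 K)⁰ K)} :=
    Equiv.ofBijective (fun m ↦ ⟨∑ i, m i • b i, hmem m⟩) <| by
      constructor
      · intro m m' h
        have h' := Subtype.ext_iff.1 h
        funext i
        have := Fintype.linearIndependent_iff.1 hli (fun i ↦ m i - m' i)
          (by simpa [sub_smul, sub_eq_zero] using h') i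
        exact sub_eq_zero.1 this
      · rintro ⟨x, hx⟩
        obtain ⟨c, hc⟩ := (Submodule.mem_span_range_iff_exists_fun ℤ).1 ((hb x).2 hx)
        exact ⟨c, Subtype.ext hc⟩
  exact (e.tsum_eq (fun x ↦ gaussE (placeForm y x))).symm

lemma absNorm_mul_absNorm_dualIdeal (I : (FractionalIdeal (𝓞 K)⁰ K)ˣ) :
    FractionalIdeal.absNorm (I : FractionalIdeal (𝓞 K)⁰ K) *
      FractionalIdeal.absNorm (dualIdeal I : FractionalIdeal (𝓞 K)⁰ K) *
        (discr K).natAbs = 1 := by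
  have h1 : ((dualIdeal I : (FractionalIdeal (𝓞 K)⁰ K)ˣ) : FractionalIdeal (𝓞 K)⁰ K) =
    FractionalIdeal.dual ℤ ℚ (1 : FractionalIdeal (𝓞 K)⁰ K) * (I : FractionalIdeal (𝓞 K)⁰ K)⁻¹ :=
      FractionalIdeal.dual_eq_mul_inv ℤ ℚ _
  have h2 : ((differentIdeal ℤ (𝓞 K) : Ideal (𝓞 K)) : FractionalIdeal (𝓞 K)⁰ K) =
      (FractionalIdeal.dual ℤ ℚ (1 : FractionalIdeal (𝓞 K)⁰ K))⁻¹ := coeIdeal_differentIdeal ..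
  have h3 : FractionalIdeal.dual ℤ ℚ (1 : FractionalIdeal (𝓞 K)⁰ K) *
      ((differentIdeal ℤ (𝓞 K) : Ideal (𝓞 K)) : FractionalIdeal (𝓞 K)⁰ K) = 1 := by
    rw [h2]
    exact mul_inv_cancel₀ (FractionalIdeal.dual_ne_zero ℤ ℚ one_ne_zero)
  rw [← NumberField.absNorm_differentIdeal K (𝓞 K), ← FractionalIdeal.coeIdeal_absNorm (K := K),
    ← map_mul, ← map_mul, h1]
  rw [mul_comm (FractionalIdeal.dual _ _ _), ← mul_assoc, mul_inv_cancel₀ I.ne_zero, one_mul, h3,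
    map_one]

lemma discr_basisOfFractionalIdeal (I : (FractionalIdeal (𝓞 K)⁰ K)ˣ) :
    Algebra.discr ℚ (basisOfFractionalIdeal K I) =
      FractionalIdeal.absNorm (I : FractionalIdeal (𝓞 K)⁰ K) ^ 2 * discr K := by
  have hcard : Fintype.card (Module.Free.ChooseBasisIndex ℤ (𝓞 K)) =
      Fintype.card (Module.Free.ChooseBasisIndex ℤ I) := by
    rw [← Module.finrank_eq_card_basis (integralBasis K),
      ← Module.finrank_eq_card_basis (basisOfFractionalIdeal K I)]
  let e := Fintype.equivOfCardEq hcard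
  rw [← det_basisOfFractionalIdeal_eq_absNorm K I e, sq_abs, coe_discr,
    Module.Basis.det_apply]
  have h := Algebra.discr_of_matrix_vecMul (A := ℚ) (integralBasis K)
    ((integralBasis K).toMatrix ((basisOfFractionalIdeal K I).reindex e.symm))
  rw [← h, ← Algebra.discr_reindex ℚ (basisOfFractionalIdeal K I) e.symm]
  congr 1
  rw [← Module.Basis.coe_reindex]
  funext i
  rw [Matrix.vecMul]
  simp only [dotProduct, Matrix.map_apply]
  rw [← (integralBasis K).sum_toMatrix_smul_self ((basisOfFractionalIdeal K I).reindex e.symm) i]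
  refine Finset.sum_congr rfl fun j _ ↦ ?_
  rw [Algebra.smul_def, mul_comm]

theorem thetaE_eq_mul_thetaE_dualIdeal (I : (FractionalIdeal (𝓞 K)⁰ K)ˣ)
    {y : InfinitePlace K → ℝ} (hy : ∀ v, 0 < y v) :
    thetaE I y = ENNReal.ofReal (√((FractionalIdeal.absNorm
      (I : FractionalIdeal (𝓞 K)⁰ K) : ℝ) ^ 2 * (discr K).natAbs * ∏ v, y v ^ v.mult))⁻¹ *
        thetaE (dualIdeal I) y⁻¹ := by
  set b := basisOfFractionalIdeal K I
  have hb : ∀ x, x ∈ Submodule.span ℤ (Set.range b) ↔ x ∈ (I : FractionalIdeal (𝓞 K)⁰ K) :=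
    fun x ↦ mem_span_basisOfFractionalIdeal K
  have hb' : ∀ x, x ∈ Submodule.span ℤ (Set.range b.traceDual) ↔
      x ∈ (dualIdeal I : FractionalIdeal (𝓞 K)⁰ K) := by
    intro x
    have h := Submodule.traceDual_span_of_basis ℤ
      ((I : FractionalIdeal (𝓞 K)⁰ K) : Submodule (𝓞 K) K) b
      (Submodule.ext fun x ↦ (hb x).symm)
    rw [← h, dualIdeal, Units.val_mk0, Submodule.restrictScalars_mem,
      ← FractionalIdeal.coe_dual ℤ ℚ I.ne_zero]
    rfl
  rw [thetaE_eq_tsum I b hb, thetaE_eq_tsum (dualIdeal I) b.traceDual hb',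
    tsum_gaussE_placeForm hy (b := b) (b' := b.traceDual)
      (fun i j ↦ by rw [Module.Basis.trace_mul_traceDual]), discr_basisOfFractionalIdeal]
  congr 5
  push_cast
  rw [abs_mul, abs_of_nonneg (sq_nonneg _), Nat.cast_natAbs]
  push_cast
  rfl

end

section

variable (K : Type) [Field K] [NumberField K]

/-- The real span of the logarithmic embeddings of the fundamental units. -/
def unitLog : (Fin (Units.rank K) → ℝ) →ₗ[ℝ] (InfinitePlace K → ℝ) where
  toFun a v := ∑ i, a i * Real.log (v (Units.fundSystem K i : K))
  map_add' a b := by ext v; simp [add_mul, Finset.sum_add_distrib]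
  map_smul' c a := by ext v; simp [Finset.mul_sum, mul_assoc]

variable {K}

lemma unitLog_apply (a : Fin (Units.rank K) → ℝ) (v : InfinitePlace K) :
    unitLog K a v = ∑ i, a i * Real.log (v (Units.fundSystem K i : K)) := rfl

lemma sum_mult_mul_unitLog (a : Fin (Units.rank K) → ℝ) :
    ∑ v : InfinitePlace K, v.mult * unitLog K a v = 0 := by
  simp only [unitLog_apply, Finset.mul_sum]
  rw [Finset.sum_comm]
  refine Finset.sum_eq_zero fun i _ ↦ ?_
  rw [← mul_zero (a i), ← Units.sum_mult_mul_log (Units.fundSystem K i), Finset.mul_sum]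
  exact Finset.sum_congr rfl fun v _ ↦ by ring

variable (K) in
/-- The parametrization `(τ, a) ↦ τ + ∑ i, a i * log |ηᵢ|` of the logarithmic space. -/
def logParam : (ℝ × (Fin (Units.rank K) → ℝ)) →ₗ[ℝ] (InfinitePlace K → ℝ) :=
  LinearMap.coprod (LinearMap.pi fun _ ↦ LinearMap.id) (unitLog K)

lemma logParam_apply (p : ℝ × (Fin (Units.rank K) → ℝ)) (v : InfinitePlace K) :
    logParam K p v = p.1 + unitLog K p.2 v := by
  simp [logParam]

lemma sum_mult_mul_logParam (p : ℝ × (Fin (Units.rank K) → ℝ)) :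
    ∑ v : InfinitePlace K, v.mult * logParam K p v = Module.finrank ℚ K * p.1 := by
  simp only [logParam_apply, mul_add, Finset.sum_add_distrib, sum_mult_mul_unitLog, add_zero]
  rw [← Finset.sum_mul, ← InfinitePlace.sum_mult_eq]
  push_cast
  rfl

open mixedEmbedding.fundamentalCone in
lemma logParam_surjective : Function.Surjective (logParam K) := by
  intro z
  obtain ⟨c, hc⟩ : ∃ c : InfinitePlace K → ℝ, ∑ w, c w • mixedEmbedding.fundamentalCone.completeBasis K w =
      fun v : InfinitePlace K ↦ v.mult * z v :=
    ⟨fun w ↦ (mixedEmbedding.fundamentalCone.completeBasis K).repr _ w,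
      (mixedEmbedding.fundamentalCone.completeBasis K).sum_repr _⟩
  refine ⟨(c Units.dirichletUnitTheorem.w₀,
    fun i ↦ c (mixedEmbedding.fundamentalCone.equivFinRank i)), ?_⟩
  funext v
  have hv := congrFun hc v
  have hm : (v.mult : ℝ) ≠ 0 := InfinitePlace.mult_coe_ne_zero
  rw [Fintype.sum_eq_add_sum_subtype_ne _ Units.dirichletUnitTheorem.w₀] at hv
  rw [Pi.add_apply, Finset.sum_apply] at hv
  rw [← mul_right_inj' hm, ← hv, logParam_apply, mul_add, unitLog_apply, Finset.mul_sum]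
  congr 1
  · rw [completeBasis_apply_of_eq, Pi.smul_apply, smul_eq_mul, mul_comm]
  · rw [← equivFinRank.sum_comp]
    refine Finset.sum_congr rfl fun i _ ↦ ?_
    rw [completeBasis_apply_of_ne, Pi.smul_apply, smul_eq_mul, expMap_symm_apply,
      Equiv.symm_apply_apply, mixedEmbedding.normAtAllPlaces_apply,
      mixedEmbedding.normAtPlace_apply]
    ring

variable (K) in
/-- `logParam` as a continuous linear equivalence. -/
def logEquiv : (ℝ × (Fin (Units.rank K) → ℝ)) ≃L[ℝ] (InfinitePlace K → ℝ) :=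
  (LinearEquiv.ofBijective (logParam K) (by
    refine ⟨?_, logParam_surjective⟩
    rw [LinearMap.injective_iff_surjective_of_finrank_eq_finrank]
    · exact logParam_surjective
    · have : 0 < Fintype.card (InfinitePlace K) := Fintype.card_pos
      have h2 : Units.rank K = Fintype.card (InfinitePlace K) - 1 := by rw [Units.rank]
      rw [Module.finrank_prod, Module.finrank_self, Module.finrank_fintype_fun_eq_card,
        Module.finrank_fintype_fun_eq_card, Fintype.card_fin]
      lia)).toContinuousLinearEquiv

lemma logEquiv_apply (p : ℝ × (Fin (Units.rank K) → ℝ)) (v : InfinitePlace K) :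
    logEquiv K p v = p.1 + unitLog K p.2 v := logParam_apply p v

lemma sum_mult_mul_logEquiv (p : ℝ × (Fin (Units.rank K) → ℝ)) :
    ∑ v : InfinitePlace K, v.mult * logEquiv K p v = Module.finrank ℚ K * p.1 :=
  sum_mult_mul_logParam p

variable (K) in
lemma exists_map_logEquiv : ∃ c : NNReal, c ≠ 0 ∧
    Measure.map (logEquiv K) volume = c • (volume : Measure (InfinitePlace K → ℝ)) := by
  have : Measure.IsAddHaarMeasure (volume : Measure (ℝ × (Fin (Units.rank K) → ℝ))) :=
    inferInstanceAs (Measure.IsAddHaarMeasure ((volume : Measure ℝ).prod volume))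
  have : Measure.IsAddHaarMeasure (Measure.map (logEquiv K)
    (volume : Measure (ℝ × (Fin (Units.rank K) → ℝ)))) :=
      (logEquiv K).isAddHaarMeasure_map _
  refine ⟨_, ?_, Measure.isAddLeftInvariant_eq_smul _ _⟩
  exact (Measure.addHaarScalarFactor_pos_of_isAddHaarMeasure _ _).ne'

lemma exists_log_eq (x : Kˣ) : ∃ a : Fin (Units.rank K) → ℝ, ∀ v : InfinitePlace K,
    Real.log (v (x : K)) =
      (Module.finrank ℚ K : ℝ)⁻¹ * Real.log |(Algebra.norm ℚ (x : K) : ℝ)| + unitLog K a v := by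
  obtain ⟨p, hp⟩ := (logEquiv K).surjective fun v ↦ Real.log (v (x : K))
  have h1 := sum_mult_mul_logEquiv p
  have hn : (Module.finrank ℚ K : ℝ) ≠ 0 := by exact_mod_cast Module.finrank_pos.ne'
  have h2 : Real.log |(Algebra.norm ℚ (x : K) : ℝ)| =
      ∑ v : InfinitePlace K, v.mult * Real.log (v (x : K)) := by
    rw [← Rat.cast_abs, ← InfinitePlace.prod_eq_abs_norm, Real.log_prod]
    · simp [Real.log_pow]
    · intro v _
      exact pow_ne_zero _ ((map_ne_zero _).2 x.ne_zero)
  refine ⟨p.2, fun v ↦ ?_⟩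
  rw [hp] at h1
  rw [h2, h1, inv_mul_cancel_left₀ hn, ← logEquiv_apply, hp]

variable (K) in
/-- The parametrization of units by a root of unity and an exponent vector. -/
def unitsEquiv : Units.torsion K × (Fin (Units.rank K) → ℤ) ≃ (𝓞 K)ˣ :=
  Equiv.ofBijective (fun p ↦ p.1 * ∏ i, Units.fundSystem K i ^ p.2 i) <| by
    constructor
    · intro p q h
      exact (Units.exist_unique_eq_mul_prod K _).unique rfl h
    · intro u
      obtain ⟨p, hp, -⟩ := Units.exist_unique_eq_mul_prod K u
      exact ⟨p, hp.symm⟩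

lemma log_unitsEquiv (p : Units.torsion K × (Fin (Units.rank K) → ℤ)) (v : InfinitePlace K) :
    Real.log (v (unitsEquiv K p : K)) = unitLog K (intVec p.2) v := by
  have h1 : v ((p.1 : (𝓞 K)ˣ) : K) = 1 := (Units.mem_torsion K).1 p.1.2 v
  have h2 : ((unitsEquiv K p : (𝓞 K)ˣ) : K) =
      ((p.1 : (𝓞 K)ˣ) : K) * ∏ i, ((Units.fundSystem K i : (𝓞 K)ˣ) : K) ^ p.2 i := by
    let f : (𝓞 K)ˣ →* K := (algebraMap (𝓞 K) K : 𝓞 K →* K).comp (Units.coeHom (𝓞 K))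
    change f (p.1 * ∏ i, Units.fundSystem K i ^ p.2 i) = _
    rw [map_mul, map_prod]
    exact congrArg _ (Finset.prod_congr rfl fun i _ ↦ Units.coe_zpow _ _)
  rw [h2, map_mul, h1, one_mul, map_prod, Real.log_prod, unitLog_apply]
  · exact Finset.sum_congr rfl fun i _ ↦ by rw [map_zpow₀, Real.log_zpow]; rfl
  · intro i _
    rw [map_zpow₀]
    exact zpow_ne_zero _ ((map_ne_zero _).2 (Units.coe_ne_zero _))

end

section

open scoped nonZeroDivisors

variable {K : Type} [Field K] [NumberField K]

lemma tsum_option_ennreal {α : Type*} (f : Option α → ENNReal) :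
    ∑' o, f o = f none + ∑' a, f (some a) := by
  rw [← (Equiv.optionEquivSumPUnit.{0} α).symm.tsum_eq, ENNReal.summable.tsum_sum ENNReal.summable,
    add_comm]
  simp

/-- Nonzero elements of a fractional ideal `I` are grouped according to the integral ideal `J` with
`(x) = I * J`. -/
def optionSigmaEquiv (I : (FractionalIdeal (𝓞 K)⁰ K)ˣ) :
    Option (Σ J : (Ideal (𝓞 K))⁰,
      {x : Kˣ // toPrincipalIdeal (𝓞 K) K x = I * FractionalIdeal.mk0 K J}) ≃
    {x : K // x ∈ (I : FractionalIdeal (𝓞 K)⁰ K)} :=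
  Equiv.ofBijective
    (fun o ↦ o.elim ⟨0, FractionalIdeal.zero_mem _⟩ fun p ↦ ⟨(p.2.1 : K), by
      have h := toPrincipalIdeal_eq_iff.1 p.2.2
      have h1 : (p.2.1 : K) ∈ FractionalIdeal.spanSingleton (𝓞 K)⁰ (p.2.1 : K) :=
        FractionalIdeal.mem_spanSingleton_self _ _
      rw [h, Units.val_mul, FractionalIdeal.coe_mk0] at h1
      have h2 : (I : FractionalIdeal (𝓞 K)⁰ K) * ((p.1 : Ideal (𝓞 K)) : FractionalIdeal (𝓞 K)⁰ K)
          ≤ (I : FractionalIdeal (𝓞 K)⁰ K) * 1 :=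
        mul_le_mul_right FractionalIdeal.coeIdeal_le_one _
      rw [mul_one] at h2
      exact h2 h1⟩) <| by
  constructor
  · rintro (_ | ⟨J, x, hx⟩) (_ | ⟨J', x', hx'⟩) h
    · rfl
    · exact absurd (Subtype.ext_iff.1 h).symm x'.ne_zero
    · exact absurd (Subtype.ext_iff.1 h) x.ne_zero
    · obtain rfl : x = x' := Units.ext (Subtype.ext_iff.1 h)
      have hJ : FractionalIdeal.mk0 K J = FractionalIdeal.mk0 K J' :=
        mul_left_cancel (hx.symm.trans hx')
      have hJ' : ((J : Ideal (𝓞 K)) : FractionalIdeal (𝓞 K)⁰ K) = (J' : Ideal (𝓞 K)) := by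
        rw [← FractionalIdeal.coe_mk0, ← FractionalIdeal.coe_mk0, hJ]
      obtain rfl : J = J' := Subtype.ext (FractionalIdeal.coeIdeal_injective hJ')
      rfl
  · rintro ⟨x, hx⟩
    by_cases h0 : x = 0
    · exact ⟨none, Subtype.ext h0.symm⟩
    · have h1 : FractionalIdeal.spanSingleton (𝓞 K)⁰ x ≤ (I : FractionalIdeal (𝓞 K)⁰ K) :=
        FractionalIdeal.spanSingleton_le_iff_mem.2 hx
      have h2 : (I : FractionalIdeal (𝓞 K)⁰ K)⁻¹ * FractionalIdeal.spanSingleton (𝓞 K)⁰ x ≤ 1 := by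
        rw [← inv_mul_cancel₀ I.ne_zero]
        exact mul_le_mul_right h1 _
      obtain ⟨J, hJ⟩ := FractionalIdeal.le_one_iff_exists_coeIdeal.1 h2
      have h3 : FractionalIdeal.spanSingleton (𝓞 K)⁰ x =
          (I : FractionalIdeal (𝓞 K)⁰ K) * (J : FractionalIdeal (𝓞 K)⁰ K) := by
        rw [hJ, mul_inv_cancel_left₀ I.ne_zero]
      have hJ0 : J ∈ (Ideal (𝓞 K))⁰ := by
        rw [mem_nonZeroDivisors_iff_ne_zero]
        rintro rfl
        refine h0 (FractionalIdeal.spanSingleton_eq_zero_iff.1 (h3.trans ?_))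
        simp
      exact ⟨some ⟨⟨J, hJ0⟩, Units.mk0 x h0, toPrincipalIdeal_eq_iff.2 (by
        rw [Units.val_mul, FractionalIdeal.coe_mk0]; exact h3)⟩, rfl⟩

lemma tsum_fractionalIdeal (I : (FractionalIdeal (𝓞 K)⁰ K)ˣ) (g : K → ENNReal) :
    ∑' x : {x : K // x ∈ (I : FractionalIdeal (𝓞 K)⁰ K)}, g x =
      g 0 + ∑' J : (Ideal (𝓞 K))⁰,
        ∑' x : {x : Kˣ // toPrincipalIdeal (𝓞 K) K x = I * FractionalIdeal.mk0 K J}, g x.1 := by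
  rw [← (optionSigmaEquiv I).tsum_eq, tsum_option_ennreal, ENNReal.tsum_sigma']
  rfl

lemma tsum_generators {A : (FractionalIdeal (𝓞 K)⁰ K)ˣ} {x₀ : Kˣ}
    (hx₀ : toPrincipalIdeal (𝓞 K) K x₀ = A) (g : K → ENNReal) :
    ∑' x : {x : Kˣ // toPrincipalIdeal (𝓞 K) K x = A}, g x.1 =
      ∑' u : (𝓞 K)ˣ, g ((u : K) * x₀) := by
  have hu : ∀ u : (𝓞 K)ˣ, FractionalIdeal.spanSingleton (𝓞 K)⁰ ((u : K) * x₀) =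
      FractionalIdeal.spanSingleton (𝓞 K)⁰ (x₀ : K) := fun u ↦
    (FractionalIdeal.spanSingleton_eq_spanSingleton.2
      ⟨u, by rw [Units.smul_def, Algebra.smul_def]⟩).symm
  have h0 := toPrincipalIdeal_eq_iff.1 hx₀
  let e : (𝓞 K)ˣ ≃ {x : Kˣ // toPrincipalIdeal (𝓞 K) K x = A} :=
    Equiv.ofBijective (fun u ↦ ⟨Units.mk0 ((u : K) * x₀)
      (mul_ne_zero (Units.coe_ne_zero u) x₀.ne_zero),
        toPrincipalIdeal_eq_iff.2 ((hu u).trans h0)⟩) <| by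
      constructor
      · intro u u' h
        have h' : (u : K) * x₀ = u' * x₀ := congrArg Units.val (Subtype.ext_iff.1 h)
        exact NumberField.Units.coe_injective K (mul_right_cancel₀ x₀.ne_zero h')
      · rintro ⟨x, hx⟩
        obtain ⟨u, hu⟩ := FractionalIdeal.spanSingleton_eq_spanSingleton.1
          (h0.trans (toPrincipalIdeal_eq_iff.1 hx).symm)
        rw [Units.smul_def, Algebra.smul_def] at hu
        exact ⟨u, Subtype.ext (Units.ext hu)⟩
  exact (e.tsum_eq (fun x ↦ g x.1)).symm

end

section

open scoped nonZeroDivisors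

variable {K : Type} [Field K] [NumberField K]

/-- The Gaussian in logarithmic coordinates. -/
def gaussLog (z : InfinitePlace K → ℝ) : ENNReal :=
  gaussE (∑ v : InfinitePlace K, v.mult * Real.exp (2 * z v))

lemma measurable_gaussLog : Measurable (gaussLog : (InfinitePlace K → ℝ) → ENNReal) := by
  unfold gaussLog gaussE
  fun_prop

lemma continuous_unitLog : Continuous (unitLog K) := (unitLog K).continuous_of_finiteDimensional

lemma measurable_gaussLog_comp (τ : InfinitePlace K → ℝ) (c : ℝ) :
    Measurable fun a ↦ gaussLog fun v ↦ τ v + c * unitLog K a v := by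
  refine measurable_gaussLog.comp (measurable_pi_lambda _ fun v ↦ ?_)
  have : Measurable fun a ↦ unitLog K a v :=
    ((continuous_apply v).comp continuous_unitLog).measurable
  fun_prop

variable (K) in
/-- The integral of the Gaussian over the logarithmic norm-one hyperplane, translated by `τ`. -/
def phi (τ : ℝ) : ENNReal :=
  ∫⁻ a : Fin (Units.rank K) → ℝ, gaussLog (fun v ↦ τ + unitLog K a v)

lemma lintegral_gaussLog {ε : ℝ} (hε : ε = 1 ∨ ε = -1) (τ : ℝ) (a₀ : Fin (Units.rank K) → ℝ) :
    ∫⁻ a, gaussLog (fun v ↦ τ + unitLog K a₀ v + ε * unitLog K a v) = phi K τ := by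
  have h : ∀ a : Fin (Units.rank K) → ℝ,
      (fun v ↦ τ + unitLog K a₀ v + ε * unitLog K a v) =
      fun v ↦ τ + unitLog K (ε • a + a₀) v := by
    intro a
    funext v
    simp
    ring
  simp only [h]
  have h1 : ∫⁻ a, gaussLog (fun v ↦ τ + unitLog K (ε • a + a₀) v) =
      ∫⁻ a : Fin (Units.rank K) → ℝ, gaussLog (fun v ↦ τ + unitLog K (a + a₀) v) := by
    rcases hε with rfl | rfl
    · simp
    · simp only [neg_smul, one_smul]
      exact lintegral_neg_eq_self (fun a : Fin (Units.rank K) → ℝ ↦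
        gaussLog (fun v ↦ τ + unitLog K (a + a₀) v))
  rw [h1]
  exact lintegral_add_right_eq_self (fun a : Fin (Units.rank K) → ℝ ↦
    gaussLog (fun v ↦ τ + unitLog K a v)) a₀

lemma gaussE_placeForm_zero (y : InfinitePlace K → ℝ) : gaussE (placeForm y 0) = 1 := by
  simp [gaussE, placeForm]

lemma gaussE_placeForm_exp (z : InfinitePlace K → ℝ) {x : K} (hx : x ≠ 0) :
    gaussE (placeForm (fun v ↦ Real.exp (2 * z v)) x) =
      gaussLog fun v ↦ z v + Real.log (v x) := by
  unfold placeForm gaussLog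
  congr 1
  refine Finset.sum_congr rfl fun v _ ↦ ?_
  have : 0 < v x := (InfinitePlace.pos_iff).2 hx
  rw [mul_add, Real.exp_add, ← Nat.cast_ofNat (n := 2), Real.exp_nat_mul (Real.log _),
    Real.exp_log this]

/-- The group of ideal classes of `K`. -/
abbrev IdealClass (K : Type) [Field K] [NumberField K] : Type :=
  (FractionalIdeal (𝓞 K)⁰ K)ˣ ⧸ (toPrincipalIdeal (𝓞 K) K).range

/-- The class of an invertible fractional ideal. -/
abbrev idealClass (I : (FractionalIdeal (𝓞 K)⁰ K)ˣ) : IdealClass K := QuotientGroup.mk I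

lemma setLIntegral_tsum_generators {ε : ℝ} (hε : ε = 1 ∨ ε = -1) (τ : ℝ)
    (I : (FractionalIdeal (𝓞 K)⁰ K)ˣ) :
    ∫⁻ a in unitBox (Fin (Units.rank K)),
        ∑' x : {x : Kˣ // toPrincipalIdeal (𝓞 K) K x = I},
          gaussE (placeForm (fun v ↦ Real.exp (2 * (τ + ε * unitLog K a v))) (x.1 : K)) =
      if idealClass I = 1 then Units.torsionOrder K *
        phi K (τ + (Module.finrank ℚ K : ℝ)⁻¹ *
          Real.log (FractionalIdeal.absNorm (I : FractionalIdeal (𝓞 K)⁰ K))) else 0 := by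
  split_ifs with hI
  · obtain ⟨x₀, hx₀⟩ := (QuotientGroup.eq_one_iff I).1 hI
    obtain ⟨a₀, ha₀⟩ := exists_log_eq x₀
    have hnorm : |(Algebra.norm ℚ (x₀ : K) : ℝ)| =
        FractionalIdeal.absNorm (I : FractionalIdeal (𝓞 K)⁰ K) := by
      rw [← toPrincipalIdeal_eq_iff.1 hx₀, FractionalIdeal.absNorm_span_singleton]
      push_cast
      rfl
    set σ := (Module.finrank ℚ K : ℝ)⁻¹ *
          Real.log (FractionalIdeal.absNorm (I : FractionalIdeal (𝓞 K)⁰ K)) with hσ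
    set H : (Fin (Units.rank K) → ℝ) → ENNReal :=
      fun a ↦ gaussLog (fun v ↦ τ + σ + unitLog K a₀ v + ε * unitLog K a v) with hH
    have hHm : Measurable H := measurable_gaussLog_comp _ _
    have key : ∀ a (p : Units.torsion K × (Fin (Units.rank K) → ℤ)),
        gaussE (placeForm (fun v ↦ Real.exp (2 * (τ + ε * unitLog K a v)))
          ((unitsEquiv K p : K) * x₀)) = H (a + ε • intVec p.2) := by
      intro a p
      have hε2 : ε * ε = 1 := by rcases hε with rfl | rfl <;> norm_num
      rw [gaussE_placeForm_exp _ (mul_ne_zero (Units.coe_ne_zero _) x₀.ne_zero)]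
      congr 1
      funext v
      rw [map_mul, Real.log_mul ((map_ne_zero _).2 (Units.coe_ne_zero _))
        ((map_ne_zero _).2 x₀.ne_zero), log_unitsEquiv, ha₀, hnorm, map_add, map_smul,
        Pi.add_apply, Pi.smul_apply, smul_eq_mul, mul_add, ← mul_assoc ε ε, hε2]
      ring
    let e : (Fin (Units.rank K) → ℤ) ≃ (Fin (Units.rank K) → ℤ) :=
      if ε = 1 then Equiv.refl _ else Equiv.neg _
    have he : ∀ m, ε • intVec (e m) = intVec m := by
      intro m
      rcases hε with rfl | rfl
      · simp [e]
      · have : ¬ (-1 : ℝ) = 1 := by norm_num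
        funext i
        simp [e, this, intVec]
    refine (lintegral_congr fun a ↦ tsum_generators hx₀ (fun x ↦ gaussE (placeForm _ x))).trans ?_
    calc _ = ∫⁻ a in unitBox (Fin (Units.rank K)),
          ∑' (_ : Units.torsion K), ∑' m : Fin (Units.rank K) → ℤ, H (a + intVec m) := by
          refine lintegral_congr fun a ↦ ?_
          rw [← (unitsEquiv K).tsum_eq, ENNReal.tsum_prod']
          refine tsum_congr fun ζ ↦ ?_
          rw [← e.tsum_eq]
          refine tsum_congr fun m ↦ ?_
          rw [key]
          simp only [he]
      _ = Units.torsionOrder K * ∑' m : Fin (Units.rank K) → ℤ,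
            ∫⁻ a in unitBox (Fin (Units.rank K)), H (a + intVec m) := by
          have hcard : (ENat.card (Units.torsion K) : ENNReal) = Units.torsionOrder K := by
            rw [Units.torsionOrder, ENat.card_eq_coe_natCard]
            rfl
          simp only [ENNReal.tsum_const, hcard]
          rw [lintegral_const_mul _ (by fun_prop), lintegral_tsum (by fun_prop)]
      _ = _ := by
          rw [← lintegral_eq_tsum_unitBox hHm, hH, lintegral_gaussLog hε]
  · have : IsEmpty {x : Kˣ // toPrincipalIdeal (𝓞 K) K x = I} :=
      ⟨fun x ↦ hI ((QuotientGroup.eq_one_iff I).2 ⟨x.1, x.2⟩)⟩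
    simp

variable (K) in
lemma countable_numberField : Countable K :=
  (Module.finBasis ℚ K).equivFun.toEquiv.countable_iff.2 inferInstance

variable (K) in
lemma countable_units : Countable Kˣ :=
  have := countable_numberField K
  Units.val_injective.countable

variable (K) in
lemma countable_ideal : Countable (Ideal (𝓞 K)) := by
  have := countable_numberField K
  have : Countable (𝓞 K) := RingOfIntegers.coe_injective.countable
  refine Function.Surjective.countable (f := fun s : Finset (𝓞 K) ↦ Ideal.span (s : Set (𝓞 K))) ?_
  exact fun I ↦ (isNoetherian_def.1 inferInstance) I

theorem setLIntegral_thetaE {ε : ℝ} (hε : ε = 1 ∨ ε = -1) (τ : ℝ)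
    (I : (FractionalIdeal (𝓞 K)⁰ K)ˣ) :
    ∫⁻ a in unitBox (Fin (Units.rank K)),
        thetaE I (fun v ↦ Real.exp (2 * (τ + ε * unitLog K a v))) =
      1 + ∑' J : (Ideal (𝓞 K))⁰, if idealClass (I * FractionalIdeal.mk0 K J) = 1 then
        Units.torsionOrder K * phi K (τ + (Module.finrank ℚ K : ℝ)⁻¹ *
          Real.log (FractionalIdeal.absNorm (I : FractionalIdeal (𝓞 K)⁰ K) *
            Ideal.absNorm (J : Ideal (𝓞 K)))) else 0 := by
  have := countable_units K
  have := countable_ideal K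
  unfold thetaE
  have hm : ∀ x : Kˣ, Measurable fun a ↦
      gaussE (placeForm (fun v ↦ Real.exp (2 * (τ + ε * unitLog K a v))) (x : K)) := by
    intro x
    simp only [gaussE_placeForm_exp _ x.ne_zero]
    convert measurable_gaussLog_comp (fun v ↦ τ + Real.log (v (x : K))) ε using 4
    ring
  refine (lintegral_congr fun a ↦
    tsum_fractionalIdeal I (fun x ↦ gaussE (placeForm _ x))).trans ?_
  simp only [gaussE_placeForm_zero]
  rw [lintegral_add_left measurable_const]
  rw [lintegral_tsum fun J ↦ (Measurable.tsum fun x ↦ hm _).aemeasurable]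
  simp only [setLIntegral_tsum_generators hε]
  congr 1
  · simp [volume_unitBox]
  · refine tsum_congr fun J ↦ ?_
    rw [Units.val_mul, map_mul, FractionalIdeal.coe_mk0, FractionalIdeal.coeIdeal_absNorm]
    push_cast
    rfl

end

section

open scoped nonZeroDivisors

variable {K : Type} [Field K] [NumberField K]

instance : Finite (IdealClass K) := Finite.of_equiv _ (ClassGroup.equiv (R := 𝓞 K) K).toEquiv

instance : Fintype (IdealClass K) := Fintype.ofFinite _

lemma absNorm_units_pos (I : (FractionalIdeal (𝓞 K)⁰ K)ˣ) :
    0 < (FractionalIdeal.absNorm (I : FractionalIdeal (𝓞 K)⁰ K) : ℝ) := by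
  rw [Rat.cast_pos]
  exact lt_of_le_of_ne (FractionalIdeal.absNorm_nonneg _)
    (Ne.symm (mt FractionalIdeal.absNorm_eq_zero_iff.1 I.ne_zero))

lemma absNorm_ideal_pos (J : (Ideal (𝓞 K))⁰) : 0 < (Ideal.absNorm (J : Ideal (𝓞 K)) : ℝ) :=
  Nat.cast_pos.2 (Ideal.absNorm_pos_of_nonZeroDivisors J)

variable (K) in
/-- The sum over all ideal classes of the averaged theta functions, in logarithmic scale. -/
def classTheta (τ : ℝ) : ENNReal :=
  Fintype.card (IdealClass K) + Units.torsionOrder K * ∑' J : (Ideal (𝓞 K))⁰,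
    phi K (τ + (Module.finrank ℚ K : ℝ)⁻¹ * Real.log (Ideal.absNorm (J : Ideal (𝓞 K))))

/-- The average over units of the theta function of `I`. -/
def avgTheta (ε τ : ℝ) (I : (FractionalIdeal (𝓞 K)⁰ K)ˣ) : ENNReal :=
  ∫⁻ a in unitBox (Fin (Units.rank K)), thetaE I (fun v ↦ Real.exp (2 * (τ + ε * unitLog K a v)))

lemma sum_avgTheta {ε : ℝ} (hε : ε = 1 ∨ ε = -1) (τ : ℝ)
    {r : IdealClass K → (FractionalIdeal (𝓞 K)⁰ K)ˣ}
    (hr : Function.Bijective fun C ↦ idealClass (r C)) :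
    ∑ C, avgTheta ε (τ - (Module.finrank ℚ K : ℝ)⁻¹ *
      Real.log (FractionalIdeal.absNorm (r C : FractionalIdeal (𝓞 K)⁰ K))) (r C) =
      classTheta K τ := by
  have h1 : ∀ (C : IdealClass K) (J : (Ideal (𝓞 K))⁰),
      τ - (Module.finrank ℚ K : ℝ)⁻¹ *
        Real.log (FractionalIdeal.absNorm (r C : FractionalIdeal (𝓞 K)⁰ K)) +
      (Module.finrank ℚ K : ℝ)⁻¹ *
          Real.log (FractionalIdeal.absNorm (r C : FractionalIdeal (𝓞 K)⁰ K) *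
            Ideal.absNorm (J : Ideal (𝓞 K))) =
      τ + (Module.finrank ℚ K : ℝ)⁻¹ * Real.log (Ideal.absNorm (J : Ideal (𝓞 K))) := by
    intro C J
    rw [Real.log_mul (absNorm_units_pos _).ne' (absNorm_ideal_pos J).ne']
    ring
  simp only [avgTheta, setLIntegral_thetaE hε, h1]
  rw [Finset.sum_add_distrib, classTheta]
  congr 1
  · simp
  · rw [← ENNReal.tsum_mul_left]
    rw [← tsum_fintype (L := .unconditional _), ENNReal.tsum_comm]
    refine tsum_congr fun J ↦ ?_
    obtain ⟨C, hC⟩ := hr.2 (idealClass (FractionalIdeal.mk0 K J))⁻¹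
    rw [tsum_eq_single C]
    · rw [if_pos]
      rw [idealClass, QuotientGroup.mk_mul]
      exact mul_eq_one_iff_eq_inv.2 hC
    · intro C' hC'
      rw [if_neg]
      intro h
      rw [idealClass, QuotientGroup.mk_mul] at h
      exact hC' (hr.1 ((mul_eq_one_iff_eq_inv.1 h).trans hC.symm))

lemma avgTheta_eq (τ : ℝ) (I : (FractionalIdeal (𝓞 K)⁰ K)ˣ) :
    avgTheta 1 (τ - (Module.finrank ℚ K : ℝ)⁻¹ *
      Real.log (FractionalIdeal.absNorm (I : FractionalIdeal (𝓞 K)⁰ K))) I =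
    ENNReal.ofReal (√((discr K).natAbs) * Real.exp (Module.finrank ℚ K * τ))⁻¹ *
      avgTheta (-1) (-τ - (Module.finrank ℚ K : ℝ)⁻¹ * Real.log (discr K).natAbs -
        (Module.finrank ℚ K : ℝ)⁻¹ * Real.log
          (FractionalIdeal.absNorm (dualIdeal I : FractionalIdeal (𝓞 K)⁰ K))) (dualIdeal I) := by
  have hn : (Module.finrank ℚ K : ℝ) ≠ 0 := Nat.cast_ne_zero.2 Module.finrank_pos.ne'
  have hN := absNorm_units_pos I
  have hN' := absNorm_units_pos (dualIdeal I)
  have hD : (0 : ℝ) < (discr K).natAbs := by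
    exact_mod_cast Int.natAbs_pos.2 (discr_ne_zero K)
  have hprod : (FractionalIdeal.absNorm (I : FractionalIdeal (𝓞 K)⁰ K) : ℝ) *
      FractionalIdeal.absNorm (dualIdeal I : FractionalIdeal (𝓞 K)⁰ K) *
      (discr K).natAbs = 1 := by
    exact_mod_cast absNorm_mul_absNorm_dualIdeal I
  have hlog : Real.log (FractionalIdeal.absNorm (I : FractionalIdeal (𝓞 K)⁰ K)) +
      Real.log (FractionalIdeal.absNorm (dualIdeal I : FractionalIdeal (𝓞 K)⁰ K)) +
      Real.log (discr K).natAbs = 0 := by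
    rw [← Real.log_mul hN.ne' hN'.ne', ← Real.log_mul (mul_pos hN hN').ne' hD.ne', hprod,
      Real.log_one]
  set N := (FractionalIdeal.absNorm (I : FractionalIdeal (𝓞 K)⁰ K) : ℝ)
  set τ' := τ - (Module.finrank ℚ K : ℝ)⁻¹ * Real.log N with hτ'
  unfold avgTheta
  rw [← lintegral_const_mul']
  swap
  · exact ENNReal.ofReal_ne_top
  refine lintegral_congr fun a ↦ ?_
  rw [thetaE_eq_mul_thetaE_dualIdeal I (fun v ↦ Real.exp_pos _)]
  congr 3
  · have : ∏ v : InfinitePlace K, Real.exp (2 * (τ' + 1 * unitLog K a v)) ^ v.mult =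
        Real.exp (Module.finrank ℚ K * τ) ^ 2 * (N ^ 2)⁻¹ := by
      rw [Finset.prod_congr rfl fun v _ ↦ (Real.exp_nat_mul _ v.mult).symm, ← Real.exp_sum]
      have h2 : ∑ v : InfinitePlace K, (v.mult : ℝ) * (2 * (τ' + 1 * unitLog K a v)) =
          2 * (Module.finrank ℚ K * τ) + - (2 * Real.log N) := by
        have h3 := sum_mult_mul_unitLog (K := K) a
        have h4 : ∑ v : InfinitePlace K, (v.mult : ℝ) = Module.finrank ℚ K := by
          exact_mod_cast InfinitePlace.sum_mult_eq
        calc _ = 2 * τ' * ∑ v : InfinitePlace K, (v.mult : ℝ) +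
              2 * ∑ v : InfinitePlace K, (v.mult : ℝ) * unitLog K a v := by
              rw [Finset.mul_sum, Finset.mul_sum, ← Finset.sum_add_distrib]
              exact Finset.sum_congr rfl fun v _ ↦ by ring
          _ = _ := by
              rw [h3, h4, hτ']
              field_simp
              ring
      have h5 : ∀ x, Real.exp (2 * x) = Real.exp x ^ 2 := fun x ↦ by
        rw [two_mul, Real.exp_add, sq]
      rw [h2, Real.exp_add, Real.exp_neg, h5, h5, Real.exp_log hN]
    rw [this, show N ^ 2 * ((discr K).natAbs : ℝ) *
      (Real.exp (Module.finrank ℚ K * τ) ^ 2 * (N ^ 2)⁻¹) =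
      (discr K).natAbs * Real.exp (Module.finrank ℚ K * τ) ^ 2 by field_simp,
      Real.sqrt_mul hD.le, Real.sqrt_sq (Real.exp_pos _).le]
  · funext v
    rw [Pi.inv_apply, ← Real.exp_neg]
    congr 1
    have : (Module.finrank ℚ K : ℝ)⁻¹ * (Real.log N +
      Real.log (FractionalIdeal.absNorm (dualIdeal I : FractionalIdeal (𝓞 K)⁰ K)) +
      Real.log (discr K).natAbs) = 0 := by rw [hlog, mul_zero]
    rw [hτ']
    linear_combination 2 * this

lemma idealClass_dualIdeal_bijective :
    Function.Bijective fun C : IdealClass K ↦ idealClass (dualIdeal C.out) := by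
  have h : ∀ C : IdealClass K,
      idealClass (dualIdeal C.out) = idealClass (dualIdeal (1 : (FractionalIdeal (𝓞 K)⁰ K)ˣ)) * C⁻¹ := by
    intro C
    have h1 : dualIdeal C.out = dualIdeal 1 * C.out⁻¹ := by
      ext1
      simp only [dualIdeal, Units.val_mk0, Units.val_mul, Units.val_inv_eq_inv_val, Units.val_one]
      exact FractionalIdeal.dual_eq_mul_inv ℤ ℚ C.out.1
    rw [h1, idealClass, QuotientGroup.mk_mul, QuotientGroup.mk_inv]
    congr 2
    exact QuotientGroup.out_eq' C
  simp only [h]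
  exact (Group.mulLeft_bijective _).comp inv_involutive.bijective

theorem classTheta_functional_equation (τ : ℝ) :
    classTheta K τ =
      ENNReal.ofReal (√((discr K).natAbs) * Real.exp (Module.finrank ℚ K * τ))⁻¹ *
        classTheta K (-τ - (Module.finrank ℚ K : ℝ)⁻¹ * Real.log (discr K).natAbs) := by
  have h1 : Function.Bijective fun C : IdealClass K ↦ idealClass C.out := by
    have : (fun C : IdealClass K ↦ idealClass C.out) = id :=
      funext fun C ↦ QuotientGroup.out_eq' C
    rw [this]
    exact Function.bijective_id
  rw [← sum_avgTheta (Or.inl rfl) τ h1,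
    ← sum_avgTheta (Or.inr rfl) _ (idealClass_dualIdeal_bijective (K := K)), Finset.mul_sum]
  exact Finset.sum_congr rfl fun C _ ↦ avgTheta_eq τ C.out

end

section

lemma cpow_exp_sub_one (x : ℝ) (s : ℂ) :
    (Real.exp x : ℂ) * ((Real.exp x : ℂ) ^ (s - 1)) = cexp (s * x) := by
  have h : (Real.exp x : ℂ) ≠ 0 := by simp
  rw [cpow_def_of_ne_zero h, ← ofReal_log (Real.exp_pos x).le, Real.log_exp, ofReal_exp,
    ← Complex.exp_add]
  congr 1
  ring

lemma mellin_eq_integral_exp (f : ℝ → ℂ) (s : ℂ) :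
    mellin f s = ∫ x : ℝ, cexp (s * x) * f (Real.exp x) := by
  rw [mellin, ← Real.range_exp, ← Set.image_univ,
    integral_image_eq_integral_abs_deriv_smul MeasurableSet.univ
      (fun x _ ↦ (Real.hasDerivAt_exp x).hasDerivWithinAt) Real.exp_injective.injOn,
    setIntegral_univ]
  refine integral_congr_ae (Eventually.of_forall fun x ↦ ?_)
  simp only [abs_of_pos (Real.exp_pos _), Complex.real_smul, smul_eq_mul]
  rw [← mul_assoc, cpow_exp_sub_one]

lemma mellinConvergent_iff_integrable_exp (f : ℝ → ℂ) (s : ℂ) :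
    MellinConvergent f s ↔ Integrable fun x : ℝ ↦ cexp (s * x) * f (Real.exp x) := by
  rw [MellinConvergent, ← Real.range_exp, ← Set.image_univ,
    integrableOn_image_iff_integrableOn_abs_deriv_smul MeasurableSet.univ
      (fun x _ ↦ (Real.hasDerivAt_exp x).hasDerivWithinAt) Real.exp_injective.injOn,
    integrableOn_univ]
  refine integrable_congr (Eventually.of_forall fun x ↦ ?_)
  simp only [abs_of_pos (Real.exp_pos _), Complex.real_smul, smul_eq_mul]
  rw [← mul_assoc, cpow_exp_sub_one]

lemma mellinConvergent_exp_neg_mul {r : ℝ} (hr : 0 < r) {s : ℂ} (hs : 0 < s.re) :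
    MellinConvergent (fun t : ℝ ↦ cexp (-(r * t))) s := by
  have h : MellinConvergent (fun t : ℝ ↦ cexp (-t)) s := by
    have := Complex.GammaIntegral_convergent hs
    refine this.congr_fun (fun t _ ↦ ?_) measurableSet_Ioi
    simp [mul_comm]
  have h2 := (MellinConvergent.comp_mul_left (f := fun t : ℝ ↦ cexp (-t)) (s := s) hr).2 h
  simpa using h2

lemma mellin_exp_neg_mul {r : ℝ} (hr : 0 < r) {s : ℂ} (hs : 0 < s.re) :
    mellin (fun t : ℝ ↦ cexp (-(r * t))) s = (1 / r) ^ s * Gamma s :=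
  integral_cpow_mul_exp_neg_mul_Ioi hs hr

/-- The local factor at a place with multiplicity `m` of the Mellin transform of a Gaussian. -/
def localGauss (m : ℕ) (s : ℂ) (z : ℝ) : ℂ :=
  cexp (s * m * z) * cexp (-(Real.pi * m * Real.exp (2 * z)))

lemma localGauss_eq (m : ℕ) (s : ℂ) (z : ℝ) :
    localGauss m s z = (fun w : ℝ ↦ cexp (s * m / 2 * w) *
      cexp (-((Real.pi * m : ℝ) * Real.exp w))) (2 * z) := by
  simp only [localGauss]
  push_cast
  congr 2
  ring

lemma re_mul_natCast_div_two {m : ℕ} (hm : m ≠ 0) {s : ℂ} (hs : 0 < s.re) :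
    0 < (s * m / 2).re := by
  have : (0 : ℝ) < m := Nat.cast_pos.2 (Nat.pos_of_ne_zero hm)
  have h : s * m / 2 = s * ((m / 2 : ℝ) : ℂ) := by push_cast; ring
  rw [h, Complex.re_mul_ofReal]
  positivity

lemma integrable_localGauss {m : ℕ} (hm : m ≠ 0) {s : ℂ} (hs : 0 < s.re) :
    Integrable (localGauss m s) := by
  have hm' : (0 : ℝ) < m := Nat.cast_pos.2 (Nat.pos_of_ne_zero hm)
  have h := (mellinConvergent_iff_integrable_exp _ _).1
    (mellinConvergent_exp_neg_mul (mul_pos Real.pi_pos hm') (re_mul_natCast_div_two hm hs))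
  exact (h.comp_mul_left' two_ne_zero).congr
    (Eventually.of_forall fun z ↦ (localGauss_eq m s z).symm)

lemma integral_localGauss {m : ℕ} (hm : m ≠ 0) {s : ℂ} (hs : 0 < s.re) :
    ∫ z, localGauss m s z =
      (1 / 2) * ((1 / (Real.pi * m : ℝ)) ^ (s * m / 2) * Gamma (s * m / 2)) := by
  have hm' : (0 : ℝ) < m := Nat.cast_pos.2 (Nat.pos_of_ne_zero hm)
  have h := mellin_exp_neg_mul (mul_pos Real.pi_pos hm') (re_mul_natCast_div_two hm hs)
  rw [mellin_eq_integral_exp] at h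
  simp only [localGauss_eq]
  rw [Measure.integral_comp_mul_left (fun w : ℝ ↦ cexp (s * m / 2 * w) *
      cexp (-((Real.pi * m : ℝ) * Real.exp w))) 2, h]
  rw [abs_of_pos (by norm_num : (0 : ℝ) < 2⁻¹), Complex.real_smul]
  norm_num

lemma integral_localGauss_one {s : ℂ} (hs : 0 < s.re) :
    ∫ z, localGauss 1 s z = (1 / 2) * Gammaℝ s := by
  rw [integral_localGauss one_ne_zero hs, Gammaℝ_def, neg_div, cpow_neg,
    one_div ((Real.pi * (1 : ℕ) : ℝ) : ℂ), inv_cpow]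
  · simp
  · rw [Complex.arg_ofReal_of_nonneg (by positivity)]
    exact Real.pi_pos.ne

lemma integral_localGauss_two {s : ℂ} (hs : 0 < s.re) :
    ∫ z, localGauss 2 s z = (1 / 4) * Gammaℂ s := by
  rw [integral_localGauss two_ne_zero hs, Gammaℂ_def, cpow_neg,
    one_div ((Real.pi * (2 : ℕ) : ℝ) : ℂ), inv_cpow]
  · push_cast
    rw [mul_div_cancel_right₀ _ (two_ne_zero' ℂ), mul_comm (Real.pi : ℂ) 2]
    ring
  · rw [Complex.arg_ofReal_of_nonneg (by positivity)]
    exact Real.pi_pos.ne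

end

section

open scoped nonZeroDivisors

variable {K : Type} [Field K] [NumberField K]

lemma toReal_gaussLog (z : InfinitePlace K → ℝ) : (gaussLog z).toReal =
    Real.exp (-Real.pi * ∑ v : InfinitePlace K, v.mult * Real.exp (2 * z v)) := by
  rw [gaussLog, gaussE, ENNReal.toReal_ofReal (Real.exp_pos _).le]

lemma prod_localGauss (s : ℂ) (z : InfinitePlace K → ℝ) :
    ∏ v : InfinitePlace K, localGauss v.mult s (z v) =
      cexp (s * (∑ v : InfinitePlace K, v.mult * z v : ℝ)) * (gaussLog z).toReal := by
  simp only [localGauss]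
  rw [Finset.prod_mul_distrib, ← Complex.exp_sum, ← Complex.exp_sum, toReal_gaussLog, ofReal_exp]
  push_cast
  rw [Finset.mul_sum, Finset.mul_sum]
  congr 2
  · exact Finset.sum_congr rfl fun v _ ↦ by ring
  · exact Finset.sum_congr rfl fun v _ ↦ by ring

lemma prod_integral_localGauss {s : ℂ} (hs : 0 < s.re) :
    ∏ v : InfinitePlace K, ∫ z, localGauss v.mult s z =
      ((1 / 2) ^ InfinitePlace.nrRealPlaces K * (1 / 4) ^ InfinitePlace.nrComplexPlaces K) *
        gammaFactor (InfinitePlace.nrRealPlaces K) (InfinitePlace.nrComplexPlaces K) s := by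
  have h : ∀ v : InfinitePlace K, ∫ z, localGauss v.mult s z =
      if v.IsReal then (1 / 2) * Gammaℝ s else (1 / 4) * Gammaℂ s := by
    intro v
    rw [InfinitePlace.mult]
    split_ifs
    · exact integral_localGauss_one hs
    · exact integral_localGauss_two hs
  simp only [h]
  rw [Finset.prod_ite, Finset.prod_const, Finset.prod_const, ← Fintype.card_subtype,
    ← Fintype.card_subtype, gammaFactor, mul_pow, mul_pow]
  simp only [InfinitePlace.not_isReal_iff_isComplex]
  rw [InfinitePlace.nrRealPlaces, InfinitePlace.nrComplexPlaces]
  ring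

variable (K) in
/-- The Gaussian on `ℝ × (Fin r → ℝ)` twisted by a character. -/
def twistedGauss (s : ℂ) (p : ℝ × (Fin (Units.rank K) → ℝ)) : ℂ :=
  cexp (s * Module.finrank ℚ K * p.1) * (gaussLog fun v ↦ p.1 + unitLog K p.2 v).toReal

lemma twistedGauss_eq (s : ℂ) (p : ℝ × (Fin (Units.rank K) → ℝ)) :
    twistedGauss K s p = ∏ v : InfinitePlace K, localGauss v.mult s (logEquiv K p v) := by
  rw [prod_localGauss, sum_mult_mul_logEquiv, twistedGauss]
  push_cast
  rw [mul_assoc]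
  congr 4

lemma integrable_twistedGauss {s : ℂ} (hs : 0 < s.re) : Integrable (twistedGauss K s) := by
  obtain ⟨c, -, hc⟩ := exists_map_logEquiv K
  have h1 : Integrable (fun z : InfinitePlace K → ℝ ↦
      ∏ v : InfinitePlace K, localGauss v.mult s (z v)) volume :=
    Integrable.fintype_prod_dep fun v ↦ integrable_localGauss InfinitePlace.mult_ne_zero hs
  have h2 := h1.smul_measure_nnreal (c := c)
  rw [← hc] at h2
  have h3 := ((logEquiv K).toHomeomorph.measurableEmbedding.integrable_map_iff).1 h2
  exact h3.congr (Eventually.of_forall fun p ↦ (twistedGauss_eq s p).symm)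

variable (K) in
lemma exists_integral_twistedGauss : ∃ κ : ℝ, 0 < κ ∧ ∀ s : ℂ, 0 < s.re →
    ∫ p, twistedGauss K s p = κ *
      gammaFactor (InfinitePlace.nrRealPlaces K) (InfinitePlace.nrComplexPlaces K) s := by
  obtain ⟨c, hc0, hc⟩ := exists_map_logEquiv K
  refine ⟨c * ((1 / 2) ^ InfinitePlace.nrRealPlaces K *
    (1 / 4) ^ InfinitePlace.nrComplexPlaces K), ?_, fun s hs ↦ ?_⟩
  · have : 0 < (c : ℝ) := NNReal.coe_pos.2 (pos_iff_ne_zero.2 hc0)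
    positivity
  · simp only [twistedGauss_eq]
    have h := (logEquiv K).toHomeomorph.measurableEmbedding.integral_map (μ := volume)
      (fun z : InfinitePlace K → ℝ ↦ ∏ v : InfinitePlace K, localGauss v.mult s (z v))
    refine h.symm.trans ?_
    change ∫ z, _ ∂(Measure.map (logEquiv K) volume) = _
    rw [hc, integral_smul_nnreal_measure, integral_fintype_prod_volume_eq_prod,
      prod_integral_localGauss hs, NNReal.smul_def, Complex.real_smul]
    push_cast
    ring

lemma integral_twistedGauss (s : ℂ) (τ : ℝ) :
    ∫ a, twistedGauss K s (τ, a) = cexp (s * Module.finrank ℚ K * τ) * (phi K τ).toReal := by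
  simp only [twistedGauss]
  rw [integral_const_mul, integral_complex_ofReal, integral_toReal]
  · rfl
  · have := measurable_gaussLog_comp (K := K) (fun _ ↦ τ) 1
    simp only [one_mul] at this
    exact this.aemeasurable
  · exact Eventually.of_forall fun a ↦ ENNReal.ofReal_lt_top

variable (K) in
/-- The function `phi` in multiplicative coordinates. -/
def phiMul (u : ℝ) : ℝ := (phi K ((Module.finrank ℚ K : ℝ)⁻¹ * Real.log u)).toReal

lemma phiMul_exp (s : ℂ) (x : ℝ) : cexp (s * x) * phiMul K (Real.exp x) =
    (fun τ : ℝ ↦ cexp (s * Module.finrank ℚ K * τ) * (phi K τ).toReal)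
      ((Module.finrank ℚ K : ℝ)⁻¹ * x) := by
  have hn : (Module.finrank ℚ K : ℂ) ≠ 0 := Nat.cast_ne_zero.2 Module.finrank_pos.ne'
  simp only [phiMul, Real.log_exp]
  push_cast
  congr 2
  field_simp

lemma mellinConvergent_phiMul {s : ℂ} (hs : 0 < s.re) :
    MellinConvergent (fun u ↦ (phiMul K u : ℂ)) s := by
  rw [mellinConvergent_iff_integrable_exp]
  simp only [phiMul_exp]
  have hn : (Module.finrank ℚ K : ℝ) ≠ 0 := Nat.cast_ne_zero.2 Module.finrank_pos.ne'
  refine Integrable.comp_mul_left' (g := fun τ : ℝ ↦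
    cexp (s * Module.finrank ℚ K * τ) * (phi K τ).toReal) ?_ (inv_ne_zero hn)
  have h := (integrable_twistedGauss (K := K) hs).integral_prod_left
  exact h.congr (Eventually.of_forall fun τ ↦ integral_twistedGauss s τ)

variable (K) in
lemma exists_mellin_phiMul : ∃ κ : ℝ, 0 < κ ∧ ∀ s : ℂ, 0 < s.re →
    mellin (fun u ↦ (phiMul K u : ℂ)) s = κ *
      gammaFactor (InfinitePlace.nrRealPlaces K) (InfinitePlace.nrComplexPlaces K) s := by
  obtain ⟨κ, hκ, h⟩ := exists_integral_twistedGauss K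
  have hn : (0 : ℝ) < Module.finrank ℚ K := Nat.cast_pos.2 Module.finrank_pos
  refine ⟨Module.finrank ℚ K * κ, mul_pos hn hκ, fun s hs ↦ ?_⟩
  have h1 := h s hs
  rw [Measure.volume_eq_prod, integral_prod _ (integrable_twistedGauss hs)] at h1
  simp only [integral_twistedGauss] at h1
  rw [mellin_eq_integral_exp]
  simp only [phiMul_exp]
  rw [Measure.integral_comp_mul_left (fun τ : ℝ ↦
    cexp (s * Module.finrank ℚ K * τ) * (phi K τ).toReal), h1, inv_inv, abs_of_pos hn, Complex.real_smul]
  push_cast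
  ring

end

section

variable {φ : ℝ → ℝ}

lemma exists_le_rpow_of_mellinConvergent (hφ₀ : ∀ t, 0 ≤ φ t) (hφ : AntitoneOn φ (Set.Ioi 0))
    {σ : ℝ} (hσ : 0 < σ) (h : MellinConvergent (fun t ↦ (φ t : ℂ)) σ) :
    ∃ C, 0 ≤ C ∧ ∀ t, 0 < t → φ t ≤ C * t ^ (-σ) := by
  rw [mellinConvergent_iff_integrable_exp] at h
  have h' : Integrable fun x : ℝ ↦ Real.exp (σ * x) * φ (Real.exp x) := by
    refine h.norm.congr (Eventually.of_forall fun x ↦ ?_)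
    simp only [norm_mul, Complex.norm_exp, Complex.norm_real, Real.norm_eq_abs, abs_of_nonneg (hφ₀ _)]
    congr 2
    rw [← ofReal_mul, ofReal_re]
  set M := ∫ x : ℝ, Real.exp (σ * x) * φ (Real.exp x) with hM
  have hM0 : 0 ≤ M := integral_nonneg fun x ↦ mul_nonneg (Real.exp_pos _).le (hφ₀ _)
  refine ⟨M * Real.exp σ, by positivity, fun t ht ↦ ?_⟩
  obtain ⟨x, rfl⟩ : ∃ x, Real.exp x = t := ⟨Real.log t, Real.exp_log ht⟩
  have h1 : Real.exp (σ * (x - 1)) * φ (Real.exp x) ≤ M := by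
    calc Real.exp (σ * (x - 1)) * φ (Real.exp x)
        = ∫ _ in Set.Ioc (x - 1) x, Real.exp (σ * (x - 1)) * φ (Real.exp x) := by
          simp
      _ ≤ ∫ y in Set.Ioc (x - 1) x, Real.exp (σ * y) * φ (Real.exp y) := by
          refine setIntegral_mono_on (integrable_const _) h'.integrableOn measurableSet_Ioc fun y hy ↦ ?_
          refine mul_le_mul (Real.exp_le_exp.2 (mul_le_mul_of_nonneg_left hy.1.le hσ.le))
            (hφ (Real.exp_pos _) (Real.exp_pos _) (Real.exp_le_exp.2 hy.2)) (hφ₀ _)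
            (Real.exp_pos _).le
      _ ≤ M := setIntegral_le_integral h' (Eventually.of_forall fun y ↦
          mul_nonneg (Real.exp_pos _).le (hφ₀ _))
  have h2 : Real.exp x ^ (-σ) * Real.exp σ * Real.exp (σ * (x - 1)) = 1 := by
    rw [← Real.exp_mul, ← Real.exp_add, ← Real.exp_add, Real.exp_eq_one_iff]
    ring
  calc φ (Real.exp x) = Real.exp x ^ (-σ) * Real.exp σ *
        (Real.exp (σ * (x - 1)) * φ (Real.exp x)) := by
        rw [← mul_assoc, h2, one_mul]
    _ ≤ Real.exp x ^ (-σ) * Real.exp σ * M :=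
        mul_le_mul_of_nonneg_left h1 (by positivity)
    _ = _ := by ring

lemma mellin_tsum_comp_mul {ι : Type*} [Countable ι] {a : ι → ℝ} (ha : ∀ i, 0 < a i) {s : ℂ}
    (h : MellinConvergent (fun t ↦ (φ t : ℂ)) s) (hsum : Summable fun i ↦ a i ^ (-s.re)) :
    mellin (fun t ↦ ((∑' i, φ (t * a i) : ℝ) : ℂ)) s =
      (∑' i, (a i : ℂ) ^ (-s)) * mellin (fun t ↦ (φ t : ℂ)) s := by
  rw [mellinConvergent_iff_integrable_exp] at h
  rw [mellin_eq_integral_exp, mellin_eq_integral_exp]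
  set H : ℝ → ℂ := fun x ↦ cexp (s * x) * φ (Real.exp x) with hH
  have key : ∀ i (x : ℝ), cexp (s * x) * φ (Real.exp x * a i) =
      (a i : ℂ) ^ (-s) * H (x + Real.log (a i)) := by
    intro i x
    have h0 : (a i : ℂ) ≠ 0 := ofReal_ne_zero.2 (ha i).ne'
    simp only [hH]
    rw [Real.exp_add, Real.exp_log (ha i), cpow_def_of_ne_zero h0, ← ofReal_log (ha i).le,
      ← mul_assoc, ← Complex.exp_add]
    congr 2
    push_cast
    ring
  have hInt : ∀ i, Integrable fun x : ℝ ↦ cexp (s * x) * φ (Real.exp x * a i) := by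
    intro i
    simp only [key]
    exact (h.comp_add_right _).const_mul _
  have hval : ∀ i, ∫ x : ℝ, cexp (s * x) * φ (Real.exp x * a i) =
      (a i : ℂ) ^ (-s) * ∫ x, H x := by
    intro i
    simp only [key]
    rw [integral_const_mul, integral_add_right_eq_self]
  have hnorm : ∀ i, ∫ x : ℝ, ‖cexp (s * x) * φ (Real.exp x * a i)‖ =
      a i ^ (-s.re) * ∫ x, ‖H x‖ := by
    intro i
    simp only [key, norm_mul (_ ^ _)]
    rw [integral_const_mul, integral_add_right_eq_self (fun x ↦ ‖H x‖),
      Complex.norm_cpow_eq_rpow_re_of_pos (ha i), neg_re]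
  have hS := hasSum_integral_of_summable_integral_norm hInt
    (by simp only [hnorm]; exact hsum.mul_right _)
  simp only [hval] at hS
  rw [← tsum_mul_right, hS.tsum_eq]
  refine integral_congr_ae (Eventually.of_forall fun x ↦ ?_)
  simp only [ofReal_tsum, tsum_mul_left]

end

section

open scoped nonZeroDivisors

variable {K : Type} [Field K] [NumberField K]

lemma antitone_phi : Antitone (phi K) := by
  intro τ τ' h
  refine lintegral_mono fun a ↦ ENNReal.ofReal_le_ofReal (Real.exp_le_exp.2 ?_)
  rw [neg_mul, neg_mul, neg_le_neg_iff]
  refine mul_le_mul_of_nonneg_left (Finset.sum_le_sum fun v _ ↦ ?_) Real.pi_pos.le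
  gcongr
  exact add_le_add_left h _

lemma phi_ne_top (τ : ℝ) : phi K τ ≠ ⊤ := by
  have h := (integrable_twistedGauss (K := K) (s := 1) (by simp)).prod_right_ae
  have h2 : ∀ᵐ τ' : ℝ, phi K τ' ≠ ⊤ := by
    filter_upwards [h] with τ' hτ'
    simp only [twistedGauss] at hτ'
    have h3 := (integrable_const_mul_iff (Complex.exp_ne_zero _).isUnit _).1 hτ'
    have h4 := h3.norm.lintegral_lt_top
    refine (lt_of_le_of_lt (le_of_eq ?_) h4).ne
    refine lintegral_congr fun a ↦ ?_
    rw [Complex.norm_real, Real.norm_eq_abs, abs_of_nonneg ENNReal.toReal_nonneg,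
      ENNReal.ofReal_toReal]
    exact ENNReal.ofReal_ne_top
  have h3 : ∃ᶠ τ' in ae (volume.restrict (Set.Iio τ)), phi K τ' ≠ ⊤ := by
    have : (ae (volume.restrict (Set.Iio τ))).NeBot := by
      rw [ae_neBot]
      simp
    exact (ae_restrict_of_ae h2).frequently
  obtain ⟨τ', h4, h5⟩ := (h3.and_eventually (ae_restrict_mem measurableSet_Iio)).exists
  exact ne_top_of_le_ne_top h4 (antitone_phi (le_of_lt h5))

lemma phiMul_nonneg (u : ℝ) : 0 ≤ phiMul K u := ENNReal.toReal_nonneg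

lemma antitoneOn_phiMul : AntitoneOn (phiMul K) (Set.Ioi 0) := by
  intro u hu u' _ h
  refine ENNReal.toReal_mono (phi_ne_top _) (antitone_phi ?_)
  exact mul_le_mul_of_nonneg_left (Real.log_le_log hu h) (by positivity)

lemma exists_phiMul_le {σ : ℝ} (hσ : 0 < σ) :
    ∃ C, 0 ≤ C ∧ ∀ t, 0 < t → phiMul K t ≤ C * t ^ (-σ) :=
  exists_le_rpow_of_mellinConvergent phiMul_nonneg antitoneOn_phiMul hσ
    (mellinConvergent_phiMul (by simpa using hσ))

end

section

open scoped nonZeroDivisors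

variable {K : Type} [Field K] [NumberField K]

variable (K) in
/-- Nonzero ideals as elements of two different subtypes. -/
def nonZeroIdealEquiv : (Ideal (𝓞 K))⁰ ≃ {I : Ideal (𝓞 K) // I ≠ ⊥} :=
  Equiv.subtypeEquivRight fun _ ↦ mem_nonZeroDivisors_iff_ne_zero

lemma nonZeroIdealEquiv_val (J : (Ideal (𝓞 K))⁰) :
    (nonZeroIdealEquiv K J).1 = (J : Ideal (𝓞 K)) := rfl

lemma summable_absNorm_rpow' {σ : ℝ} (hσ : 1 < σ) :
    Summable fun J : (Ideal (𝓞 K))⁰ ↦ (Ideal.absNorm (J : Ideal (𝓞 K)) : ℝ) ^ (-σ) :=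
  (nonZeroIdealEquiv K).summable_iff.2 (summable_absNorm_rpow K hσ)

variable (K) in
/-- The nonconstant part of the theta function of `K`, up to a factor. -/
def thetaSum (t : ℝ) : ℝ :=
  ∑' J : (Ideal (𝓞 K))⁰, phiMul K (t * Ideal.absNorm (J : Ideal (𝓞 K)))

lemma exists_thetaSum_le {σ : ℝ} (hσ : 1 < σ) :
    ∃ C, 0 ≤ C ∧ ∀ t, 0 < t →
      (Summable fun J : (Ideal (𝓞 K))⁰ ↦ phiMul K (t * Ideal.absNorm (J : Ideal (𝓞 K)))) ∧
        thetaSum K t ≤ C * t ^ (-σ) := by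
  obtain ⟨C, hC, h⟩ := exists_phiMul_le (K := K) (zero_lt_one.trans hσ)
  have hS := summable_absNorm_rpow' (K := K) hσ
  refine ⟨C * ∑' J : (Ideal (𝓞 K))⁰, (Ideal.absNorm (J : Ideal (𝓞 K)) : ℝ) ^ (-σ),
    mul_nonneg hC (tsum_nonneg fun J ↦ by positivity), fun t ht ↦ ?_⟩
  have hle : ∀ J : (Ideal (𝓞 K))⁰, phiMul K (t * Ideal.absNorm (J : Ideal (𝓞 K))) ≤
      C * t ^ (-σ) * (Ideal.absNorm (J : Ideal (𝓞 K)) : ℝ) ^ (-σ) := by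
    intro J
    refine (h _ (mul_pos ht (absNorm_ideal_pos J))).trans (le_of_eq ?_)
    rw [Real.mul_rpow ht.le (absNorm_ideal_pos J).le]
    ring
  have hsum := Summable.of_nonneg_of_le (fun J ↦ phiMul_nonneg _) hle (hS.mul_left _)
  refine ⟨hsum, (hsum.tsum_le_tsum hle (hS.mul_left _)).trans (le_of_eq ?_)⟩
  rw [tsum_mul_left]
  ring

lemma summable_phiMul {t : ℝ} (ht : 0 < t) :
    Summable fun J : (Ideal (𝓞 K))⁰ ↦ phiMul K (t * Ideal.absNorm (J : Ideal (𝓞 K))) := by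
  obtain ⟨C, -, h⟩ := exists_thetaSum_le (K := K) one_lt_two
  exact (h t ht).1

lemma thetaSum_nonneg (t : ℝ) : 0 ≤ thetaSum K t := tsum_nonneg fun _ ↦ phiMul_nonneg _

lemma antitoneOn_thetaSum : AntitoneOn (thetaSum K) (Set.Ioi 0) := by
  intro t ht t' ht' h
  refine (summable_phiMul ht').tsum_le_tsum (fun J ↦ antitoneOn_phiMul
    (mul_pos ht (absNorm_ideal_pos J)) (mul_pos ht' (absNorm_ideal_pos J)) ?_) (summable_phiMul ht)
  exact mul_le_mul_of_nonneg_right h (absNorm_ideal_pos J).le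

variable (K) in
/-- The theta function of `K`. -/
def thetaK (t : ℝ) : ℝ :=
  Fintype.card (IdealClass K) + Units.torsionOrder K * thetaSum K t

lemma thetaK_nonneg (t : ℝ) : 0 ≤ thetaK K t :=
  add_nonneg (Nat.cast_nonneg _) (mul_nonneg (Nat.cast_nonneg _) (thetaSum_nonneg t))

lemma classTheta_eq {t : ℝ} (ht : 0 < t) :
    classTheta K ((Module.finrank ℚ K : ℝ)⁻¹ * Real.log t) = ENNReal.ofReal (thetaK K t) := by
  have h1 : ∀ J : (Ideal (𝓞 K))⁰, phi K ((Module.finrank ℚ K : ℝ)⁻¹ * Real.log t +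
      (Module.finrank ℚ K : ℝ)⁻¹ * Real.log (Ideal.absNorm (J : Ideal (𝓞 K)))) =
      ENNReal.ofReal (phiMul K (t * Ideal.absNorm (J : Ideal (𝓞 K)))) := by
    intro J
    rw [phiMul, ENNReal.ofReal_toReal (phi_ne_top _),
      Real.log_mul ht.ne' (absNorm_ideal_pos J).ne', mul_add]
  rw [classTheta, thetaK, ENNReal.ofReal_add (Nat.cast_nonneg _)
    (mul_nonneg (Nat.cast_nonneg _) (thetaSum_nonneg t)), ENNReal.ofReal_mul (Nat.cast_nonneg _),
    ENNReal.ofReal_natCast, ENNReal.ofReal_natCast, thetaSum,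
    ENNReal.ofReal_tsum_of_nonneg (fun J ↦ phiMul_nonneg _) (summable_phiMul ht)]
  simp only [h1]

lemma natAbs_discr_pos : (0 : ℝ) < (discr K).natAbs :=
  Nat.cast_pos.2 (Int.natAbs_pos.2 (discr_ne_zero K))

theorem thetaK_one_div {t : ℝ} (ht : 0 < t) :
    thetaK K (1 / t) = (√((discr K).natAbs))⁻¹ * t * thetaK K (((discr K).natAbs : ℝ)⁻¹ * t) := by
  have hD := natAbs_discr_pos (K := K)
  have hn : (Module.finrank ℚ K : ℝ) ≠ 0 := Nat.cast_ne_zero.2 Module.finrank_pos.ne'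
  have h := classTheta_functional_equation (K := K)
    ((Module.finrank ℚ K : ℝ)⁻¹ * Real.log (1 / t))
  have e1 : -((Module.finrank ℚ K : ℝ)⁻¹ * Real.log (1 / t)) -
      (Module.finrank ℚ K : ℝ)⁻¹ * Real.log (discr K).natAbs =
      (Module.finrank ℚ K : ℝ)⁻¹ * Real.log (((discr K).natAbs : ℝ)⁻¹ * t) := by
    rw [Real.log_mul (inv_ne_zero hD.ne') ht.ne', Real.log_inv, one_div, Real.log_inv]
    ring
  have e2 : Real.exp (Module.finrank ℚ K * ((Module.finrank ℚ K : ℝ)⁻¹ * Real.log (1 / t))) =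
      1 / t := by
    rw [mul_inv_cancel_left₀ hn, Real.exp_log (by positivity)]
  rw [e1, e2, classTheta_eq (by positivity), classTheta_eq (by positivity),
    ← ENNReal.ofReal_mul (by positivity),
    ENNReal.ofReal_eq_ofReal_iff (thetaK_nonneg _) (mul_nonneg (by positivity) (thetaK_nonneg _))]
    at h
  rw [h]
  congr 1
  rw [mul_inv, one_div, inv_inv]

lemma thetaK_sub_isBigO (r : ℝ) :
    (fun t ↦ ((thetaK K t : ℝ) : ℂ) - (Fintype.card (IdealClass K) : ℂ)) =O[atTop] (· ^ r) := by
  obtain ⟨C, hC, h⟩ := exists_thetaSum_le (K := K) (σ := max 2 (-r))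
    (lt_of_lt_of_le one_lt_two (le_max_left _ _))
  refine Asymptotics.IsBigO.of_bound (Units.torsionOrder K * C) ?_
  filter_upwards [eventually_ge_atTop 1] with t ht
  have ht0 : 0 < t := by linarith
  have e : ((thetaK K t : ℝ) : ℂ) - (Fintype.card (IdealClass K) : ℂ) =
      ((Units.torsionOrder K * thetaSum K t : ℝ) : ℂ) := by
    rw [thetaK]
    push_cast
    ring
  rw [e, Complex.norm_real, Real.norm_of_nonneg (mul_nonneg (Nat.cast_nonneg _)
    (thetaSum_nonneg t)), Real.norm_of_nonneg (by positivity), mul_assoc]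
  refine mul_le_mul_of_nonneg_left (((h t ht0).2).trans ?_) (Nat.cast_nonneg _)
  refine mul_le_mul_of_nonneg_left (Real.rpow_le_rpow_of_exponent_le ht ?_) hC
  have := le_max_right 2 (-r)
  linarith

lemma antitoneOn_thetaK : AntitoneOn (thetaK K) (Set.Ioi 0) := fun _ ht _ ht' h ↦
  add_le_add le_rfl (mul_le_mul_of_nonneg_left (antitoneOn_thetaSum ht ht' h) (Nat.cast_nonneg _))

lemma locallyIntegrableOn_ofReal_of_antitoneOn {f : ℝ → ℝ} (hf : AntitoneOn f (Set.Ioi 0)) :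
    LocallyIntegrableOn (fun t ↦ (f t : ℂ)) (Set.Ioi 0) := by
  rw [locallyIntegrableOn_iff isOpen_Ioi.isLocallyClosed]
  exact fun k hk hkc ↦ Integrable.ofReal ((hf.mono hk).integrableOn_isCompact hkc)

variable (K) in
/-- The theta function of `K` and its functional equation. -/
def thetaPair : WeakFEPair ℂ where
  f t := (thetaK K t : ℂ)
  g t := (thetaK K (((discr K).natAbs : ℝ)⁻¹ * t) : ℂ)
  k := 1
  ε := ((√((discr K).natAbs))⁻¹ : ℝ)
  f₀ := Fintype.card (IdealClass K)
  g₀ := Fintype.card (IdealClass K)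
  hf_int := locallyIntegrableOn_ofReal_of_antitoneOn antitoneOn_thetaK
  hg_int := by
    have hD := natAbs_discr_pos (K := K)
    refine locallyIntegrableOn_ofReal_of_antitoneOn fun _ ht _ ht' h ↦
      antitoneOn_thetaK (mul_pos (inv_pos.2 hD) ht) (mul_pos (inv_pos.2 hD) ht') ?_
    exact mul_le_mul_of_nonneg_left h (inv_pos.2 hD).le
  hk := one_pos
  hε := by
    have hD := natAbs_discr_pos (K := K)
    exact ofReal_ne_zero.2 (by positivity)
  h_feq t ht := by
    rw [thetaK_one_div ht, Real.rpow_one, smul_eq_mul]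
    push_cast
    ring
  hf_top := thetaK_sub_isBigO
  hg_top r := by
    have hD := natAbs_discr_pos (K := K)
    have h := (thetaK_sub_isBigO (K := K) r).comp_tendsto
      (tendsto_id.const_mul_atTop (inv_pos.2 hD))
    refine h.trans ?_
    refine Asymptotics.IsBigO.of_bound ‖(((discr K).natAbs : ℝ)⁻¹) ^ r‖ ?_
    filter_upwards [eventually_ge_atTop 0] with t ht
    simp only [Function.comp_apply, id_eq]
    rw [Real.mul_rpow (inv_pos.2 hD).le ht, norm_mul]

end

lemma exists_norm_mellin_le {f : ℝ → ℂ} (hf : ∀ s, MellinConvergent f s) (x y : ℝ) :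
    ∃ C, ∀ s : ℂ, x ≤ s.re → s.re ≤ y → ‖mellin f s‖ ≤ C := by
  have hx := (hf x).norm
  have hy := (hf y).norm
  refine ⟨∫ t : ℝ in Set.Ioi 0, (‖(t : ℂ) ^ ((x : ℂ) - 1) • f t‖ + ‖(t : ℂ) ^ ((y : ℂ) - 1) • f t‖),
    fun s hxs hsy ↦ ?_⟩
  refine (norm_integral_le_integral_norm _).trans ?_
  refine setIntegral_mono_on (hf s).norm (hx.add hy) measurableSet_Ioi fun t ht ↦ ?_
  have ht0 : (0 : ℝ) < t := ht
  simp only [norm_smul, Complex.norm_cpow_eq_rpow_re_of_pos ht0, sub_re, one_re, ofReal_re]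
  rw [← add_mul]
  refine mul_le_mul_of_nonneg_right ?_ (norm_nonneg _)
  rcases le_total 1 t with h | h
  · exact (Real.rpow_le_rpow_of_exponent_le h (by linarith)).trans
      (le_add_of_nonneg_left (by positivity))
  · exact (Real.rpow_le_rpow_of_exponent_ge ht0 h (by linarith)).trans
      (le_add_of_nonneg_right (by positivity))

section

open scoped nonZeroDivisors

variable {K : Type} [Field K] [NumberField K]

lemma thetaK_sub_eq (t : ℝ) :
    ((thetaK K t : ℝ) : ℂ) - (Fintype.card (IdealClass K) : ℂ) =
      (Units.torsionOrder K : ℂ) • ((thetaSum K t : ℝ) : ℂ) := by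
  rw [thetaK, smul_eq_mul]
  push_cast
  ring

lemma mellin_thetaSum {s : ℂ} (hs : 1 < s.re) :
    mellin (fun t ↦ ((thetaSum K t : ℝ) : ℂ)) s =
      (∑' I : {I : Ideal (𝓞 K) // I ≠ ⊥}, (Ideal.absNorm I.1 : ℂ) ^ (-s)) *
        mellin (fun t ↦ ((phiMul K t : ℝ) : ℂ)) s := by
  have : Countable ((Ideal (𝓞 K))⁰) := by
    have := countable_ideal K
    infer_instance
  have h := mellin_tsum_comp_mul (φ := phiMul K)
    (a := fun J : (Ideal (𝓞 K))⁰ ↦ (Ideal.absNorm (J : Ideal (𝓞 K)) : ℝ)) absNorm_ideal_pos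
    (mellinConvergent_phiMul (zero_lt_one.trans hs)) (summable_absNorm_rpow' hs)
  rw [← (nonZeroIdealEquiv K).tsum_eq]
  simpa only [nonZeroIdealEquiv_val, ofReal_natCast, thetaSum] using h

lemma thetaPair_Λ {s : ℂ} (hs : 1 < s.re) :
    (thetaPair K).Λ s = Units.torsionOrder K * mellin (fun t ↦ ((thetaSum K t : ℝ) : ℂ)) s := by
  rw [← ((thetaPair K).hasMellin hs).2, ← smul_eq_mul, ← mellin_const_smul]
  congr 1
  funext t
  exact thetaK_sub_eq t

lemma thetaPair_symm_Λ {s : ℂ} (hs : 1 < s.re) :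
    (thetaPair K).symm.Λ s = ((discr K).natAbs : ℂ) ^ s * (thetaPair K).Λ s := by
  have hD := natAbs_discr_pos (K := K)
  have h := mellin_comp_mul_left (fun t ↦ (thetaPair K).f t - (thetaPair K).f₀) s (inv_pos.2 hD)
  rw [((thetaPair K).hasMellin hs).2] at h
  rw [← ((thetaPair K).symm.hasMellin hs).2]
  refine h.trans ?_
  rw [smul_eq_mul, ofReal_inv, ofReal_natCast,
    inv_cpow _ _ (natCast_arg.trans_ne Real.pi_pos.ne), cpow_neg, inv_inv]

theorem exists_hasCompletion {Z : ℂ → ℂ} (hZ : IsDedekindZeta K Z) :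
    ∃ Λ₀ a b, HasCompletion (InfinitePlace.nrRealPlaces K) (InfinitePlace.nrComplexPlaces K)
      ((discr K).natAbs : ℝ) Z Λ₀ a b := by
  obtain ⟨κ, hκ, hmel⟩ := exists_mellin_phiMul K
  set P := thetaPair K with hP
  set c : ℂ := (Units.torsionOrder K * κ : ℂ)⁻¹ with hc
  have hw : (Units.torsionOrder K : ℂ) ≠ 0 := Nat.cast_ne_zero.2 (Units.torsionOrder_ne_zero K)
  have hκ' : (κ : ℂ) ≠ 0 := ofReal_ne_zero.2 hκ.ne'
  have hΛ : ∀ s : ℂ, 1 < s.re → c * P.Λ s =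
      gammaFactor (InfinitePlace.nrRealPlaces K) (InfinitePlace.nrComplexPlaces K) s * Z s := by
    intro s hs
    rw [hP, thetaPair_Λ hs, mellin_thetaSum hs, hmel s (zero_lt_one.trans hs), hZ.2 s hs, hc]
    field_simp
  have hΛ₀ : ∀ s : ℂ, c * P.Λ₀ s - c * P.f₀ / s - c * (P.ε * P.g₀) / (1 - s) = c * P.Λ s := by
    intro s
    have hk : (P.k : ℂ) = 1 := ofReal_one
    rw [WeakFEPair.Λ, smul_eq_mul, smul_eq_mul, hk]
    ring
  refine ⟨fun s ↦ c * P.Λ₀ s, c * P.f₀, c * (P.ε * P.g₀),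
    P.differentiable_Λ₀.const_mul c, fun x y ↦ ?_, fun s hs ↦ ?_, fun s hs ↦ ?_⟩
  · obtain ⟨C, hC⟩ := exists_norm_mellin_le
      (fun s ↦ (P.isStrongFEPair_toStrongFEPair.hasMellin s).1) x y
    refine ⟨‖c‖ * C, fun s hx hy ↦ ?_⟩
    rw [norm_mul]
    exact mul_le_mul_of_nonneg_left (hC s hx hy) (norm_nonneg _)
  · rw [← hΛ s hs]
    exact hΛ₀ s
  · have hD := natAbs_discr_pos (K := K)
    have h1 := hΛ₀ (1 - s)
    rw [sub_sub_cancel] at h1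
    have hfe : P.Λ (1 - s) = P.ε * P.symm.Λ s := by
      have := P.functional_equation s
      rwa [show (P.k : ℂ) = 1 from ofReal_one, smul_eq_mul] at this
    have he : P.ε = ((discr K).natAbs : ℂ) ^ (-(1 / 2 : ℂ)) := by
      change (((√((discr K).natAbs))⁻¹ : ℝ) : ℂ) = _
      rw [Real.sqrt_eq_rpow, ← Real.rpow_neg hD.le, ofReal_cpow hD.le]
      push_cast
      rfl
    rw [h1, hfe, hP, thetaPair_symm_Λ hs, ← hP, he, ← hΛ s hs, sub_eq_add_neg,
      cpow_add _ _ (ofReal_ne_zero.2 hD.ne'), ofReal_natCast]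
    ring

end

/-- **Zero counting in unit intervals (Lemma 2.3).**
There is an absolute constant `c > 0` such that for every number field `K` and every
`T ≥ 2`, the number of nontrivial zeros `ρ = β + iγ` of `ζ_K` with `T ≤ |γ| ≤ T + 1`,
counted with multiplicity, is at most `c (log D_K + n_K log T)`. -/
theorem zero_count_unit_interval :
    ∃ c : ℝ, 0 < c ∧
      ∀ (K : Type) [Field K] [NumberField K] (Z : ℂ → ℂ), IsDedekindZeta K Z →
        ∀ T : ℝ, 2 ≤ T →
          ∀ S : Finset ℂ,
            (∀ ρ ∈ S, Z ρ = 0 ∧ 0 < ρ.re ∧ ρ.re < 1 ∧ T ≤ |ρ.im| ∧ |ρ.im| ≤ T + 1) →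
            (∑ ρ ∈ S, (zeroOrder Z ρ : ℝ))
              ≤ c * (Real.log ((NumberField.discr K).natAbs)
                  + (Module.finrank ℚ K) * Real.log T) := by
  obtain ⟨C, hC, h⟩ := HasCompletion.exists_sum_zeroOrder_le
    (A := Real.exp (2 * ∑' m : ℕ, (m : ℝ) ^ (-2 : ℝ)))
    (Real.one_le_exp (mul_nonneg zero_le_two (tsum_nonneg fun m ↦ by positivity)))
  refine ⟨C, hC, fun K _ _ Z hZ T hT S hS ↦ ?_⟩
  obtain ⟨Λ₀, a, b, hΛ⟩ := exists_hasCompletion hZ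
  refine h _ _ _ _ Z Λ₀ a b hΛ (InfinitePlace.card_add_two_mul_card_eq_rank K)
    Module.finrank_pos (Nat.one_le_cast.2 (Int.natAbs_pos.2 (discr_ne_zero K))) hZ.1
    (fun s hs ↦ ?_) (fun s hs ↦ ?_) T hT S hS
  · rw [hZ.2 s (by linarith)]
    exact norm_tsum_absNorm_cpow_le K hs
  · rw [hZ.2 s (by linarith)]
    exact one_le_mul_norm_tsum_absNorm_cpow K hs
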